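/- arXiv:2201.11369 — 4 statements merged into one kernel-verified Lean document; each statement's English description precedes it below -/
import Mathlib

section
/- For every real ε > 0 and all reals 0 < μ₁ < μ₂ < 1 and 0 < ν₁ < ν₂ < 1, there exist positive integers w↓, w↑, w→, w←, reals c↓ > 0, c→ > 0, ε↓ > 0, ε→ > 0, and a constant C ≥ 1 such that μ₁ < w↓/w↑ < μ₂, ν₁ < w→/w← < ν₂, w↑·ε→ ≤ ε, and ε↓ ≤ ε, and such that for every N ∈ ℕ there exist a finite group G with |G| > N, a (w↓, w↑)-regular finite bipartite graph X↕ = (V₀*, V₁*, E↕) that is a 1-sided (c↓, ε↓)-lossless expander, and a (w→, w←)-regular finite bipartite graph X↔ = (V*₀, V*₁, E↔) that is a 1-sided (c→, ε→)-lossless expander, each equipped with a free edge-preserving G-action, with |G| ≤ |V₀*| ≤ C·|G| and |G| ≤ |V*₀| ≤ C·|G|. -/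
/-- Neighborhood of a set `S ⊆ V₀` in a bipartite graph with edge set `E ⊆ V₀ × V₁`. -/
def Nbhd {V₀ V₁ : Type*} (E : Set (V₀ × V₁)) (S : Set V₀) : Set V₁ :=
  {x₁ | ∃ x₀ ∈ S, (x₀, x₁) ∈ E}

/-- Every left vertex has exactly `w₀` neighbors. -/
def LeftRegular {V₀ V₁ : Type*} (E : Set (V₀ × V₁)) (w₀ : ℕ) : Prop :=
  ∀ x₀ : V₀, Nat.card {x₁ : V₁ | (x₀, x₁) ∈ E} = w₀

/-- Every right vertex has exactly `w₁` neighbors. -/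
def RightRegular {V₀ V₁ : Type*} (E : Set (V₀ × V₁)) (w₁ : ℕ) : Prop :=
  ∀ x₁ : V₁, Nat.card {x₀ : V₀ | (x₀, x₁) ∈ E} = w₁

/-- 1-sided `(c, ε)`-lossless expansion from `V₀` to `V₁` for a left-degree-`w₀` graph:
every `S` with `|S| < c·|V₀|` has `|N(S)| ≥ (1 − ε)·w₀·|S|`. -/
def IsLossless {V₀ V₁ : Type*} (E : Set (V₀ × V₁)) (w₀ : ℕ) (c ε : ℝ) : Prop :=
  ∀ S : Set V₀, (Nat.card S : ℝ) < c * Nat.card V₀ →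
    (1 - ε) * (w₀ : ℝ) * (Nat.card S : ℝ) ≤ (Nat.card (Nbhd E S) : ℝ)


section SpectralPart
set_option linter.unusedSectionVars false
open scoped InnerProductSpace

theorem gap_of_pairs {E : Type*} [NormedAddCommGroup E] [InnerProductSpace ℝ E]
    [FiniteDimensional ℝ E] (P : Fin 3 → E →ₗ[ℝ] E)
    (hs : ∀ i u v, ⟪P i u, v⟫_ℝ = ⟪u, P i v⟫_ℝ) (hp : ∀ i u, P i (P i u) = P i u)
    (hpair : ∀ i j, i ≠ j → ∀ f, 0 ≤ 2 * ⟪f - P i f, f - P j f⟫_ℝ +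
      (1/4) * (‖f - P i f‖^2 + ‖f - P j f‖^2))
    (f : E) (hf : ∀ v, (∀ i, P i v = v) → ⟪v, f⟫_ℝ = 0) :
    ‖P 0 f + P 1 f + P 2 f‖ ^ 2 ≤ (5/2)^2 * ‖f‖^2 := by
  set T : E →ₗ[ℝ] E := P 0 + P 1 + P 2 with hT
  have hTs : T.IsSymmetric := by
    intro u v
    simp only [hT, LinearMap.add_apply, inner_add_left, inner_add_right, hs]
  have hTf : P 0 f + P 1 f + P 2 f = T f := by simp [hT]
  rw [hTf]
  let b := hTs.eigenvectorBasis rfl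
  have hb : ∀ i, T (b i) = (hTs.eigenvalues rfl i) • b i := by
    intro i; exact hTs.apply_eigenvectorBasis rfl i
  have hQ : ∀ i u, ‖u - P i u‖^2 = ⟪u - P i u, u⟫_ℝ := by
    intro i u
    rw [← real_inner_self_eq_norm_sq, inner_sub_right (u - P i u), inner_sub_left _ _ (P i u),
      hs i u (P i u), hp, ← hs i u u]
    rw [real_inner_comm, hs]
    rw [real_inner_comm (P i u)]
    simp [hs]
  have key : ∀ i, ⟪b i, T f⟫_ℝ ^ 2 ≤ (5/2)^2 * ⟪b i, f⟫_ℝ^2 := by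
    intro i
    set w := hTs.eigenvalues rfl i with hw
    have hn : ‖b i‖ = 1 := b.orthonormal.1 i
    have e1 : ⟪b i, T f⟫_ℝ = w * ⟪b i, f⟫_ℝ := by
      rw [← hTs, hb, inner_smul_left]; simp [hw]
    set v := b i
    have hv2 : ⟪v, v⟫_ℝ = 1 := by rw [real_inner_self_eq_norm_sq, hn]; norm_num
    set q0 := v - P 0 v with hq0
    set q1 := v - P 1 v with hq1
    set q2 := v - P 2 v with hq2
    have hsum : q0 + q1 + q2 = (3 - w) • v := by
      have := hb i
      simp only [hT, LinearMap.add_apply] at this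
      rw [sub_smul, hw, ← this, hq0, hq1, hq2]
      have : (3:ℝ) • v = v + v + v := by
        rw [show (3:ℝ) = 1 + 1 + 1 by norm_num, add_smul, add_smul, one_smul]
      rw [this]; abel
    have hx : ‖q0‖^2 + ‖q1‖^2 + ‖q2‖^2 = 3 - w := by
      rw [hQ, hQ, hQ, ← inner_add_left, ← inner_add_left, hsum, inner_smul_left, hv2]; simp
    have hx2 : ‖q0 + q1 + q2‖^2 = (3 - w)^2 := by
      rw [hsum, norm_smul, hn]; simp
    have hex : ‖q0 + q1 + q2‖^2 = ‖q0‖^2 + ‖q1‖^2 + ‖q2‖^2 + 2 * ⟪q0, q1⟫_ℝ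
        + 2 * ⟪q0, q2⟫_ℝ + 2 * ⟪q1, q2⟫_ℝ := by
      rw [norm_add_sq_real, norm_add_sq_real, inner_add_left]; ring
    have h01 := hpair 0 1 (by decide) v
    have h02 := hpair 0 2 (by decide) v
    have h12 := hpair 1 2 (by decide) v
    rw [← hq0, ← hq1] at h01
    rw [← hq0, ← hq2] at h02
    rw [← hq1, ← hq2] at h12
    have hw0 : 0 ≤ w := by
      have h1 : ∀ i, 0 ≤ ⟪P i v, v⟫_ℝ := by
        intro i
        rw [← hp, hs]; exact real_inner_self_nonneg
      have : ⟪T v, v⟫_ℝ = w := by rw [hb, inner_smul_left, hv2]; simp [hw]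
      rw [← this, hT]
      simp only [LinearMap.add_apply, inner_add_left]
      linarith [h1 0, h1 1, h1 2]
    have hx3 : 0 ≤ 3 - w := by rw [← hx]; positivity
    have hx4 : (1/2) * (3 - w) ≤ (3 - w)^2 := by nlinarith
    rw [e1]
    rcases hx3.eq_or_lt with h | h
    · have hz : ∀ i, P i v = v := by
        have a0 : ‖q0‖ = 0 := by nlinarith [sq_nonneg ‖q0‖, sq_nonneg ‖q1‖, sq_nonneg ‖q2‖]
        have a1 : ‖q1‖ = 0 := by nlinarith [sq_nonneg ‖q0‖, sq_nonneg ‖q1‖, sq_nonneg ‖q2‖]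
        have a2 : ‖q2‖ = 0 := by nlinarith [sq_nonneg ‖q0‖, sq_nonneg ‖q1‖, sq_nonneg ‖q2‖]
        rw [norm_eq_zero, sub_eq_zero] at a0 a1 a2
        intro i; fin_cases i
        · exact a0.symm
        · exact a1.symm
        · exact a2.symm
      rw [hf v hz]; simp
    · have : w ≤ 5/2 := by
        by_contra hc
        nlinarith
      rw [mul_pow]
      gcongr
  calc ‖T f‖^2 = ∑ i, ⟪b i, T f⟫_ℝ ^ 2 := by
        rw [← b.sum_sq_norm_inner_right (T f)]; simp
    _ ≤ ∑ i, (5/2)^2 * ⟪b i, f⟫_ℝ ^ 2 := Finset.sum_le_sum fun i _ => key i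
    _ = _ := by
        rw [← Finset.mul_sum, ← b.sum_sq_norm_inner_right f]; simp

variable {E : Type*} [NormedAddCommGroup E] [InnerProductSpace ℝ E]
  {F : Type*} [Field F] [Fintype F] {G : Type*} [Group G]

noncomputable def avgOp (ρ : G →* (E →ₗ[ℝ] E)) (x : F → G) : E →ₗ[ℝ] E :=
  ((Fintype.card F : ℝ)⁻¹) • ∑ a, ρ (x a)

theorem avgOp_apply (ρ : G →* (E →ₗ[ℝ] E)) (x : F → G) (u : E) :
    avgOp ρ x u = ((Fintype.card F : ℝ)⁻¹) • ∑ a, ρ (x a) u := by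
  simp [avgOp, LinearMap.sum_apply]

theorem avgOp_avgOp (ρ : G →* (E →ₗ[ℝ] E)) (x y : F → G) (u : E) :
    avgOp ρ x (avgOp ρ y u) = ((Fintype.card F : ℝ)⁻¹) • ((Fintype.card F : ℝ)⁻¹) •
      ∑ a, ∑ b, ρ (x a * y b) u := by
  rw [avgOp_apply, avgOp_apply]
  simp only [map_smul, map_sum, ← Finset.smul_sum, map_mul, Module.End.mul_apply]

theorem avgOp_fixed (ρ : G →* (E →ₗ[ℝ] E)) (x : F → G) (u : E)
    (h : ∀ a, ρ (x a) u = u) : avgOp ρ x u = u := by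
  rw [avgOp_apply]; simp only [h, Finset.sum_const, Finset.card_univ]
  rw [← Nat.cast_smul_eq_nsmul ℝ, smul_smul, inv_mul_cancel₀, one_smul]
  exact_mod_cast Fintype.card_ne_zero

theorem act_avgOp (ρ : G →* (E →ₗ[ℝ] E)) (x : F → G) (hx : ∀ a b, x (a + b) = x a * x b)
    (a : F) (u : E) : ρ (x a) (avgOp ρ x u) = avgOp ρ x u := by
  rw [avgOp_apply, map_smul, map_sum]
  congr 1
  rw [← Equiv.sum_comp (Equiv.addLeft a) (fun b => ρ (x b) u)]
  refine Finset.sum_congr rfl fun b _ => ?_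
  simp [hx]

theorem avgOp_idem (ρ : G →* (E →ₗ[ℝ] E)) (x : F → G) (hx : ∀ a b, x (a + b) = x a * x b)
    (u : E) : avgOp ρ x (avgOp ρ x u) = avgOp ρ x u :=
  avgOp_fixed _ _ _ fun a => act_avgOp ρ x hx a u

theorem avgOp_symm (ρ : G →* (E →ₗ[ℝ] E)) (hρ : ∀ g u v, ⟪ρ g u, ρ g v⟫_ℝ = ⟪u, v⟫_ℝ)
    (x : F → G) (hx : ∀ a b, x (a + b) = x a * x b)
    (u v : E) : ⟪avgOp ρ x u, v⟫_ℝ = ⟪u, avgOp ρ x v⟫_ℝ := by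
  rw [avgOp_apply, avgOp_apply, inner_smul_left, inner_smul_right, sum_inner, inner_sum]
  congr 1
  rw [← Equiv.sum_comp (Equiv.neg F) (fun b => ⟪u, ρ (x b) v⟫_ℝ)]
  refine Finset.sum_congr rfl fun a _ => ?_
  have h0 : x 0 = 1 := by
    have := hx 0 0
    simpa using this
  have : x (-a) * x a = 1 := by rw [← hx]; simp [h0]
  rw [← hρ (x (-a)) (ρ (x a) u), ← Module.End.mul_apply, ← map_mul, this]
  simp

theorem two_proj (f a b : E) (ha : ⟪f, a⟫_ℝ = ‖a‖^2) (hb : ⟪f, b⟫_ℝ = ‖b‖^2)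
    (hab : ⟪a, b⟫_ℝ^2 ≤ (1/16) * (‖a‖^2 * ‖b‖^2)) :
    0 ≤ 2 * ⟪f - a, f - b⟫_ℝ + (1/4) * (‖f - a‖^2 + ‖f - b‖^2) := by
  have e1 : ⟪f - a, f - b⟫_ℝ = ‖f‖^2 - ‖a‖^2 - ‖b‖^2 + ⟪a, b⟫_ℝ := by
    rw [inner_sub_left, inner_sub_right, inner_sub_right, real_inner_self_eq_norm_sq,
      real_inner_comm f a, ha, hb]; ring
  have e2 : ‖f - a‖^2 = ‖f‖^2 - ‖a‖^2 := by rw [norm_sub_sq_real, ha]; ring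
  have e3 : ‖f - b‖^2 = ‖f‖^2 - ‖b‖^2 := by rw [norm_sub_sq_real, hb]; ring
  have hc := real_inner_mul_inner_self_le f (a + b)
  rw [inner_add_right, ha, hb, real_inner_self_eq_norm_sq, real_inner_self_eq_norm_sq,
    norm_add_sq_real] at hc
  rw [e1, e2, e3]
  set α := ‖a‖^2
  set β := ‖b‖^2
  set φ := ‖f‖^2
  set c := ⟪a, b⟫_ℝ
  have hα : 0 ≤ α := sq_nonneg _
  have hβ : 0 ≤ β := sq_nonneg _
  have hφ : 0 ≤ φ := sq_nonneg _
  have hc2 : |2 * c| ≤ (1/4) * (α + β) := by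
    apply abs_le_of_sq_le_sq _ (by positivity)
    nlinarith [sq_nonneg (α - β)]
  obtain ⟨h1, h2⟩ := abs_le.1 hc2
  rcases (add_nonneg hα hβ).eq_or_lt with h | h
  · have : α = 0 := by linarith
    have : β = 0 := by linarith
    have : c = 0 := by nlinarith
    nlinarith
  · set s := α + β with hs
    have hpos : 0 < s + 2 * c := by linarith
    have h3 : 0 ≤ (s + 2*c) * ((5/2) * φ - (9/4) * s + 2 * c) := by
      nlinarith [mul_nonneg (show 0 ≤ (1/4)*s - 2*c by linarith) (show 0 ≤ s - 2*c by linarith)]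
    have := nonneg_of_mul_nonneg_right h3 hpos
    linarith

theorem heis_pair (ρ : G →* (E →ₗ[ℝ] E)) (hρ : ∀ g u v, ⟪ρ g u, ρ g v⟫_ℝ = ⟪u, v⟫_ℝ)
    (hF : 16 ≤ Fintype.card F)
    (x y z : F → G) (hx : ∀ a b, x (a + b) = x a * x b) (hy : ∀ a b, y (a + b) = y a * y b)
    (hz : ∀ a b, z (a + b) = z a * z b) (hxy : ∀ a b, x a * y b = y b * x a * z (a * b))
    (hxz : ∀ a b, x a * z b = z b * x a) (hyz : ∀ a b, y a * z b = z b * y a) (f : E) :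
    0 ≤ 2 * ⟪f - avgOp ρ x f, f - avgOp ρ y f⟫_ℝ +
      (1/4) * (‖f - avgOp ρ x f‖^2 + ‖f - avgOp ρ y f‖^2) := by
  have cardne : (Fintype.card F : ℝ) ≠ 0 := by exact_mod_cast Fintype.card_ne_zero
  have h0 : y 0 = 1 := by simpa using hy 0 0
  set A := avgOp ρ x with hA
  set B := avgOp ρ y with hB
  set C := avgOp ρ z with hC
  have comm : ∀ (x z : F → G), (∀ a b, x a * z b = z b * x a) → ∀ u,
      avgOp ρ x (avgOp ρ z u) = avgOp ρ z (avgOp ρ x u) := by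
    intro x z hxz u
    rw [avgOp_avgOp, avgOp_avgOp, Finset.sum_comm]
    simp only [hxz]
  have hAC : ∀ u, A (C u) = C (A u) := comm x z hxz
  have hBC : ∀ u, B (C u) = C (B u) := comm y z hyz
  have sA := avgOp_symm ρ hρ x hx
  have sB := avgOp_symm ρ hρ y hy
  have sC := avgOp_symm ρ hρ z hz
  have iA := avgOp_idem ρ x hx
  have iB := avgOp_idem ρ y hy
  have iC := avgOp_idem ρ z hz
  rw [← hA] at sA iA
  rw [← hB] at sB iB
  rw [← hC] at sC iC
  -- orthogonality
  have orth : ∀ u v, ⟪C u, v - C v⟫_ℝ = 0 := by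
    intro u v; rw [inner_sub_right, ← sC, iC, sub_self]
  set f1 := C f with hf1
  set f2 := f - C f with hf2
  have hff : f = f1 + f2 := by simp [hf1, hf2]
  have qA1 : f1 - A f1 = C (f - A f) := by rw [map_sub, hf1, hAC]
  have qB1 : f1 - B f1 = C (f - B f) := by rw [map_sub, hf1, hBC]
  have qA2 : f2 - A f2 = (f - A f) - C (f - A f) := by
    rw [hf2, map_sub, map_sub, hAC]; abel
  have qB2 : f2 - B f2 = (f - B f) - C (f - B f) := by
    rw [hf2, map_sub, map_sub, hBC]; abel
  have split : ∀ u v, ⟪u, v⟫_ℝ = ⟪C u, C v⟫_ℝ + ⟪u - C u, v - C v⟫_ℝ := by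
    intro u v
    have h1 := orth u v
    have h2 := orth v u
    rw [real_inner_comm] at h2
    rw [inner_sub_left, inner_sub_right u, h1]
    rw [inner_sub_left, real_inner_comm] at h2
    rw [inner_sub_right] at h1
    have := sC u v
    rw [real_inner_comm] at h2
    linarith [real_inner_comm u (C v), real_inner_comm (C u) (C v), iC v ▸ sC u (C v)]
  have part1 : 0 ≤ ⟪f1 - A f1, f1 - B f1⟫_ℝ := by
    have hz1 : ∀ c, ρ (z c) f1 = f1 := fun c => act_avgOp ρ z hz c f
    have hABc : A (B f1) = B (A f1) := by
      rw [hA, hB, avgOp_avgOp, avgOp_avgOp, Finset.sum_comm]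
      simp only [hxy, map_mul, Module.End.mul_apply, hz1]
    have : ⟪f1 - A f1, f1 - B f1⟫_ℝ = ‖(f1 - A f1) - B (f1 - A f1)‖^2 := by
      rw [← real_inner_self_eq_norm_sq]
      simp only [map_sub, inner_sub_left, inner_sub_right]
      have e1 := sA f1 f1
      have e2 := sB f1 f1
      have e3 := sA f1 (A f1)
      have e4 := sB f1 (B f1)
      have e5 := sB (A f1) (A f1)
      have e6 := sB (A f1) (B (A f1))
      have e7 := sB (A f1) f1
      have e8 := sB f1 (B (A f1))
      have e9 := sB f1 (A f1)
      have e10 := sA f1 (B (A f1))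
      have e11 := sA f1 (B f1)
      have e12 := sB (A f1) (B f1)
      have e13 := sB f1 (B (A f1))
      have hAB2 : A (B (A f1)) = B (A f1) := by rw [← hABc, iA]
      simp only [iA, iB, hABc, hAB2] at *
      simp only [real_inner_comm] at *
      linarith [real_inner_comm (A f1) f1, real_inner_comm (B f1) f1,
        real_inner_comm (B (A f1)) f1, real_inner_comm (A f1) (B f1),
        real_inner_comm (A f1) (B (A f1)), real_inner_comm (B f1) (B (A f1))]
    rw [this]; positivity
  have hCf2 : C f2 = 0 := by rw [hf2, map_sub, iC, sub_self]
  have hABA : A (B (A f2)) = (Fintype.card F : ℝ)⁻¹ • A f2 := by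
    rw [hB, avgOp_apply ρ y, map_smul, map_sum]
    congr 1
    rw [Finset.sum_eq_single 0]
    · rw [h0, map_one, Module.End.one_apply, iA]
    · intro b _ hb
      have : A (ρ (y b) (A f2)) = ρ (y b) (C (A f2)) := by
        rw [hA, avgOp_apply ρ x (ρ (y b) _), hC, avgOp_apply ρ z, map_smul, map_sum]
        congr 1
        rw [← Equiv.sum_comp (Equiv.mulRight₀ b hb) (fun c => (ρ (y b)) ((ρ (z c)) (avgOp ρ x f2)))]
        refine Finset.sum_congr rfl fun a _ => ?_
        rw [← Module.End.mul_apply, ← map_mul, hxy, mul_assoc, hxz, map_mul, map_mul,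
          Module.End.mul_apply, Module.End.mul_apply, act_avgOp ρ x hx]
        simp
      rw [this, ← hAC, hCf2]; simp
    · simp
  have part2 : 0 ≤ 2 * ⟪f2 - A f2, f2 - B f2⟫_ℝ + (1/4) * (‖f2 - A f2‖^2 + ‖f2 - B f2‖^2) := by
    apply two_proj
    · rw [← real_inner_self_eq_norm_sq, sA, iA]
    · rw [← real_inner_self_eq_norm_sq, sB, iB]
    · have n1 : ‖B (A f2)‖^2 = (Fintype.card F : ℝ)⁻¹ * ‖A f2‖^2 := by
        rw [← real_inner_self_eq_norm_sq, sB, iB, ← real_inner_self_eq_norm_sq, sA, hABA,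
          inner_smul_right, sA, iA]
      have n2 : ⟪A f2, B f2⟫_ℝ = ⟪B (A f2), B f2⟫_ℝ := by rw [sB, iB]
      have n3 := real_inner_mul_inner_self_le (B (A f2)) (B f2)
      rw [real_inner_self_eq_norm_sq, real_inner_self_eq_norm_sq, n1, ← n2] at n3
      have n4 : (Fintype.card F : ℝ)⁻¹ ≤ 1/16 := by
        rw [one_div]; apply inv_anti₀ (by norm_num); exact_mod_cast hF
      have n5 : (Fintype.card F : ℝ)⁻¹ * ‖A f2‖^2 * ‖B f2‖^2 ≤ 1/16 * (‖A f2‖^2 * ‖B f2‖^2) := by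
        rw [mul_assoc]; gcongr
      nlinarith
  have s1 := split (f - A f) (f - B f)
  have s2 := split (f - A f) (f - A f)
  have s3 := split (f - B f) (f - B f)
  rw [← qA2, ← qA1] at s2
  rw [← qB2, ← qB1] at s3
  rw [← qA2, ← qB2, ← qA1, ← qB1] at s1
  simp only [real_inner_self_eq_norm_sq] at s2 s3
  have t1 := sq_nonneg ‖f1 - A f1‖
  have t2 := sq_nonneg ‖f1 - B f1‖
  linarith

end SpectralPart

section ExpanderPart
open scoped InnerProductSpace

/-- `g` is a tuple of elements whose right-multiplication walk contracts mean-zero functions. -/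
def HasMix {G : Type} [Group G] [Fintype G] {ι : Type} [Fintype ι] (g : ι → G) (l : ℝ) : Prop :=
  ∀ f : G → ℝ, ∑ x, f x = 0 →
    ∑ x, (∑ e, f (x * g e))^2 ≤ (l * Fintype.card ι)^2 * ∑ x, f x ^ 2

/-- right regular representation -/
noncomputable def rightReg (G : Type) [Group G] [Fintype G] :
    G →* (EuclideanSpace ℝ G →ₗ[ℝ] EuclideanSpace ℝ G) where
  toFun g :=
    { toFun := fun f => WithLp.toLp 2 (fun x => f (x * g))
      map_add' := by intro u v; ext x; simp
      map_smul' := by intro c v; ext x; simp }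
  map_one' := by ext f x; simp
  map_mul' := by intro g h; ext f x; simp [mul_assoc]

theorem rightReg_apply {G : Type} [Group G] [Fintype G] (g : G) (f : EuclideanSpace ℝ G) (x : G) :
    rightReg G g f x = f (x * g) := rfl

theorem rightReg_inner {G : Type} [Group G] [Fintype G] (g : G) (u v : EuclideanSpace ℝ G) :
    ⟪rightReg G g u, rightReg G g v⟫_ℝ = ⟪u, v⟫_ℝ := by
  simp only [PiLp.inner_apply, rightReg_apply]
  exact Equiv.sum_comp (Equiv.mulRight g) (fun x => ⟪u x, v x⟫_ℝ)

theorem pair_symm {E : Type*} [NormedAddCommGroup E] [InnerProductSpace ℝ E] {a b : E}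
    (h : 0 ≤ 2 * ⟪a, b⟫_ℝ + (1/4) * (‖a‖^2 + ‖b‖^2)) :
    0 ≤ 2 * ⟪b, a⟫_ℝ + (1/4) * (‖b‖^2 + ‖a‖^2) := by
  rw [real_inner_comm]; linarith

theorem hasMix_of_heis {G : Type} [Group G] [Fintype G] {F : Type} [Field F] [Fintype F]
    (hF : 16 ≤ Fintype.card F) (x : Fin 3 → F → G)
    (hx : ∀ i a b, x i (a + b) = x i a * x i b)
    (hpair : ∀ i, ∃ z : F → G, (∀ a b, z (a + b) = z a * z b) ∧
      (∀ a b, x i a * x (i+1) b = x (i+1) b * x i a * z (a * b)) ∧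
      (∀ a b, x i a * z b = z b * x i a) ∧ (∀ a b, x (i+1) a * z b = z b * x (i+1) a))
    (hgen : Subgroup.closure {g | ∃ i a, g = x i a} = ⊤) :
    HasMix (fun e : Fin 3 × F => x e.1 e.2) (5/6) := by
  intro f hf
  have cardne : (Fintype.card F : ℝ) ≠ 0 := by exact_mod_cast Fintype.card_ne_zero
  set f' : EuclideanSpace ℝ G := WithLp.toLp 2 f with hf'
  let P : Fin 3 → EuclideanSpace ℝ G →ₗ[ℝ] EuclideanSpace ℝ G := fun i => avgOp (rightReg G) (x i)
  have hpr : ∀ i, ∀ f, 0 ≤ 2 * ⟪f - P i f, f - P (i+1) f⟫_ℝ +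
      (1/4) * (‖f - P i f‖^2 + ‖f - P (i+1) f‖^2) := by
    intro i f
    obtain ⟨z, h1, h2, h3, h4⟩ := hpair i
    exact heis_pair (rightReg G) rightReg_inner hF (x i) (x (i+1)) z (hx i) (hx (i+1)) h1 h2 h3 h4 f
  have hmain := gap_of_pairs P
    (fun i => avgOp_symm (rightReg G) rightReg_inner (x i) (hx i))
    (fun i => avgOp_idem (rightReg G) (x i) (hx i))
    (by
      intro i j hij f
      have h : j = i + 1 ∨ i = j + 1 := by revert i j; decide
      rcases h with h | h
      · subst h; exact hpr i f
      · subst h; exact pair_symm (hpr j f))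
    f'
    (by
      intro v hv
      have hinv : ∀ g : G, rightReg G g v = v := by
        intro g
        have hg : g ∈ Subgroup.closure {g | ∃ i a, g = x i a} := by rw [hgen]; trivial
        induction hg using Subgroup.closure_induction with
        | mem g hg =>
          obtain ⟨i, a, rfl⟩ := hg
          conv_lhs => rw [← hv i]
          rw [act_avgOp _ _ (hx i)]
          exact hv i
        | one => simp
        | mul a b _ _ ha hb => rw [map_mul, Module.End.mul_apply, hb, ha]
        | inv a _ ha =>
          conv_lhs => rw [← ha]
          rw [← Module.End.mul_apply, ← map_mul]; simp
      have hc : ∀ y, v y = v 1 := by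
        intro y
        have := congrArg (fun w : EuclideanSpace ℝ G => w 1) (hinv y)
        simpa [rightReg_apply] using this
      rw [PiLp.inner_apply]
      simp only [hc, hf']
      simp [← Finset.sum_mul, hf])
  have e1 : ∀ y, ∑ e : Fin 3 × F, f (y * x e.1 e.2) =
      (Fintype.card F : ℝ) * (P 0 f' + P 1 f' + P 2 f') y := by
    intro y
    rw [Fintype.sum_prod_type, Fin.sum_univ_three]
    simp only [P, avgOp_apply, PiLp.add_apply, PiLp.smul_apply, smul_eq_mul, WithLp.ofLp_sum,
      Finset.sum_apply, rightReg_apply, hf']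
    field_simp
  simp only [e1, mul_pow, ← Finset.mul_sum]
  rw [EuclideanSpace.real_norm_sq_eq, EuclideanSpace.real_norm_sq_eq] at hmain
  have : (Fintype.card (Fin 3 × F) : ℝ) = 3 * Fintype.card F := by simp
  rw [this]
  have h2 := mul_le_mul_of_nonneg_left hmain (sq_nonneg (Fintype.card F : ℝ))
  simp only [hf'] at h2 ⊢
  nlinarith [h2]

open Matrix in
theorem transv_comm {K : Type} [Field K] {i j k : Fin 3} (hij : i ≠ j) (hjk : j ≠ k) (hik : i ≠ k)
    (a b : K) : SpecialLinearGroup.transvection hij a * SpecialLinearGroup.transvection hjk b =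
      SpecialLinearGroup.transvection hjk b * SpecialLinearGroup.transvection hij a *
        SpecialLinearGroup.transvection hik (a * b) := by
  apply Subtype.ext
  change Matrix.transvection i j a * Matrix.transvection j k b =
    Matrix.transvection j k b * Matrix.transvection i j a * Matrix.transvection i k (a * b)
  simp only [Matrix.transvection, mul_add, add_mul, one_mul, mul_one]
  simp [hij.symm, hjk.symm, hik.symm, hij, hjk, hik]
  abel

open Matrix in
theorem transv_comm1 {K : Type} [Field K] {i j k l : Fin 3} (hij : i ≠ j) (hkl : k ≠ l)
    (h1 : j ≠ k) (h2 : l ≠ i)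
    (a b : K) : SpecialLinearGroup.transvection hij a * SpecialLinearGroup.transvection hkl b =
      SpecialLinearGroup.transvection hkl b * SpecialLinearGroup.transvection hij a := by
  apply Subtype.ext
  change Matrix.transvection i j a * Matrix.transvection k l b =
    Matrix.transvection k l b * Matrix.transvection i j a
  simp only [Matrix.transvection, mul_add, add_mul, one_mul, mul_one]
  simp [h1, h2]
  abel

open Matrix in
theorem transv_add {K : Type} [Field K] {i j : Fin 3} (hij : i ≠ j)
    (a b : K) : SpecialLinearGroup.transvection hij (a + b) =
      SpecialLinearGroup.transvection hij a * SpecialLinearGroup.transvection hij b := by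
  apply Subtype.ext
  change Matrix.transvection i j (a + b) = Matrix.transvection i j a * Matrix.transvection i j b
  simp only [Matrix.transvection, mul_add, add_mul, one_mul, mul_one]
  simp [hij.symm, Matrix.single_add]
  abel

open Matrix in
theorem transv_mem {K : Type} [Field K] {i j k : Fin 3} (hij : i ≠ j) (hjk : j ≠ k) (hik : i ≠ k)
    (H : Subgroup (SpecialLinearGroup (Fin 3) K)) (a b : K)
    (h1 : SpecialLinearGroup.transvection hij a ∈ H)
    (h2 : SpecialLinearGroup.transvection hjk b ∈ H) :
    SpecialLinearGroup.transvection hik (a * b) ∈ H := by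
  have h := transv_comm hij hjk hik a b
  rw [← inv_mul_eq_iff_eq_mul] at h
  rw [← h]
  exact H.mul_mem (H.inv_mem (H.mul_mem h2 h1)) (H.mul_mem h1 h2)

open Matrix in
theorem exists_expander_group (N : ℕ) :
    ∃ (G : Type) (_ : Group G) (_ : Fintype G) (g : Fin 51 → G), N < Fintype.card G ∧
      HasMix g (5/6) := by
  classical
  haveI : Fact (Nat.Prime 17) := ⟨by norm_num⟩
  let K := GaloisField 17 (N+1)
  letI : Fintype K := Fintype.ofFinite K
  have hK : Nat.card K = 17^(N+1) := GaloisField.card 17 (N+1) (by omega)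
  obtain ⟨t, ht⟩ := IsCyclic.exists_monoid_generator (α := Kˣ)
  let F := ZMod 17
  have n01 : (0 : Fin 3) ≠ 1 := by decide
  have n12 : (1 : Fin 3) ≠ 2 := by decide
  have n20 : (2 : Fin 3) ≠ 0 := by decide
  have n02 : (0 : Fin 3) ≠ 2 := by decide
  have n10 : (1 : Fin 3) ≠ 0 := by decide
  have n21 : (2 : Fin 3) ≠ 1 := by decide
  let T : ∀ {i j : Fin 3} (_ : i ≠ j), K → SpecialLinearGroup (Fin 3) K :=
    fun h a => SpecialLinearGroup.transvection h a
  let φ : F →+* K := algebraMap F K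
  let x0 : F → SpecialLinearGroup (Fin 3) K := fun a => T n01 (φ a)
  let x1 : F → SpecialLinearGroup (Fin 3) K := fun a => T n12 (φ a)
  let x2 : F → SpecialLinearGroup (Fin 3) K := fun a => T n20 (t * φ a)
  let X : Fin 3 → F → SpecialLinearGroup (Fin 3) K := ![x0, x1, x2]
  let gens : Set (SpecialLinearGroup (Fin 3) K) := {g | ∃ i a, g = X i a}
  let H := Subgroup.closure gens
  have hXm : ∀ i a, X i a ∈ H := fun i a => Subgroup.subset_closure ⟨i, a, rfl⟩
  let Y : Fin 3 → F → H := fun i a => ⟨X i a, hXm i a⟩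
  letI : Fintype H := Fintype.ofFinite H
  have hz0 : ∀ a, T n02 (φ a) ∈ H := by
    intro a
    have := transv_mem n01 n12 n02 H (φ a) (φ 1) (hXm 0 a) (hXm 1 1)
    simpa using this
  have hz1 : ∀ a, T n10 (t * φ a) ∈ H := by
    intro a
    have := transv_mem n12 n20 n10 H (φ a) (t * φ 1) (hXm 1 a) (hXm 2 1)
    simpa [mul_comm] using this
  have hz2 : ∀ a, T n21 (t * φ a) ∈ H := by
    intro a
    have := transv_mem n20 n01 n21 H (t * φ a) (φ 1) (hXm 2 a) (hXm 0 1)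
    simpa using this
  have hmix : HasMix (fun e : Fin 3 × F => Y e.1 e.2) (5/6) := by
    apply hasMix_of_heis
    · simp [F, ZMod.card]
    · intro i a b
      apply Subtype.ext
      fin_cases i
      · simp [Y, X, x0, T, transv_add]
      · simp [Y, X, x1, T, transv_add]
      · simp [Y, X, x2, T, transv_add, mul_add]
    · intro i
      fin_cases i
      · refine ⟨fun a => ⟨_, hz0 a⟩, ?_, ?_, ?_, ?_⟩
        · intro a b; apply Subtype.ext; simp [T, transv_add]
        · intro a b; apply Subtype.ext
          simpa [Y, X, x0, x1, T] using transv_comm n01 n12 n02 (φ a) (φ b)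
        · intro a b; apply Subtype.ext
          simpa [Y, X, x0, x1, T] using transv_comm1 n01 n02 n10 n20 (φ a) (φ b)
        · intro a b; apply Subtype.ext
          simpa [Y, X, x0, x1, T] using transv_comm1 n12 n02 n20 n21 (φ a) (φ b)
      · refine ⟨fun a => ⟨_, hz1 a⟩, ?_, ?_, ?_, ?_⟩
        · intro a b; apply Subtype.ext; simp [T, transv_add, mul_add]
        · intro a b; apply Subtype.ext
          simpa [Y, X, x1, x2, T, mul_left_comm] using transv_comm n12 n20 n10 (φ a) (t * φ b)
        · intro a b; apply Subtype.ext
          simpa [Y, X, x1, x2, T] using transv_comm1 n12 n10 n21 n01 (φ a) (t * φ b)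
        · intro a b; apply Subtype.ext
          simpa [Y, X, x1, x2, T] using transv_comm1 n20 n10 n01 n02 (t * φ a) (t * φ b)
      · refine ⟨fun a => ⟨_, hz2 a⟩, ?_, ?_, ?_, ?_⟩
        · intro a b; apply Subtype.ext; simp [T, transv_add, mul_add]
        · intro a b; apply Subtype.ext
          simpa [Y, X, x2, x0, T, mul_assoc] using transv_comm n20 n01 n21 (t * φ a) (φ b)
        · intro a b; apply Subtype.ext
          simpa [Y, X, x2, x0, T] using transv_comm1 n20 n21 n02 n12 (t * φ a) (t * φ b)
        · intro a b; apply Subtype.ext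
          simpa [Y, X, x2, x0, T] using transv_comm1 n01 n21 n12 n10 (φ a) (t * φ b)
    · have : {g : H | ∃ i a, g = Y i a} = (Subtype.val : H → _) ⁻¹' gens := by
        ext g
        simp only [Set.mem_setOf_eq, Set.mem_preimage, gens]
        constructor
        · rintro ⟨i, a, rfl⟩; exact ⟨i, a, rfl⟩
        · rintro ⟨i, a, h⟩; exact ⟨i, a, Subtype.ext h⟩
      rw [this]
      exact Subgroup.closure_closure_coe_preimage
  have hcard : Fintype.card (Fin 3 × F) = 51 := by simp [F, ZMod.card]
  let e := (Fintype.equivFinOfCardEq hcard).symm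
  refine ⟨H, inferInstance, inferInstance, fun i => Y (e i).1 (e i).2, ?_, ?_⟩
  · have hpow : ∀ n : ℕ, T n01 ((t:K)^n) ∈ H := by
      intro n
      induction n with
      | zero => simpa [X, x0] using hXm 0 1
      | succ n ih =>
        have a1 := transv_mem n01 n12 n02 H _ (φ 1) ih (hXm 1 1)
        have a2 := transv_mem n02 n21 n01 H _ _ a1 (hz2 1)
        simpa [pow_succ] using a2
    have hu : ∀ u : Kˣ, T n01 (u:K) ∈ H := by
      intro u
      obtain ⟨n, hn⟩ := ht u
      rw [← hn]
      simpa using hpow n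
    have hinj : Function.Injective (fun u : Kˣ => (⟨_, hu u⟩ : H)) := by
      intro u v huv
      have h1 := congrArg (fun w : H => (w.1.1 : Matrix (Fin 3) (Fin 3) K) 0 1) huv
      simp [T, SpecialLinearGroup.transvection_coe, Matrix.transvection] at h1
      exact Units.ext h1
    have h2 := Fintype.card_le_of_injective _ hinj
    rw [Fintype.card_units, ← Nat.card_eq_fintype_card (α := K), hK] at h2
    have h3 : N + 1 < 17^(N+1) := Nat.lt_pow_self (by norm_num)
    omega
  · intro f hf
    have h := hmix f hf
    have e2 : ∀ y : H, ∑ i, f (y * Y (e i).1 (e i).2) = ∑ c : Fin 3 × F, f (y * Y c.1 c.2) :=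
      fun y => Equiv.sum_comp e (fun c : Fin 3 × F => f (y * Y c.1 c.2))
    simp only [e2]
    rw [hcard] at h
    simpa using h

theorem hasMix_pow {G : Type} [Group G] [Fintype G] {D : ℕ} (g : Fin D → G) {l : ℝ}
    (hg : HasMix g l) (t : ℕ) : ∃ g' : Fin (D^t) → G, HasMix g' (l^t) := by
  induction t with
  | zero =>
    refine ⟨fun _ => 1, ?_⟩
    intro f hf
    have h1 : ∀ y : G, ∑ _e : Fin (D^0), f (y * 1) = f y := by
      intro y
      rw [Finset.sum_const, Finset.card_univ, Fintype.card_fin, pow_zero, one_smul, mul_one]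
    simp only [h1, Fintype.card_fin]
    simp
  | succ t ih =>
    obtain ⟨g', hg'⟩ := ih
    have hc : D^t * D = D^(t+1) := (pow_succ D t).symm
    let e : Fin (D^t) × Fin D ≃ Fin (D^(t+1)) := finProdFinEquiv.trans (finCongr hc)
    refine ⟨fun i => g' (e.symm i).1 * g (e.symm i).2, ?_⟩
    intro f hf
    have e2 : ∀ y : G, ∑ i, f (y * (g' (e.symm i).1 * g (e.symm i).2)) =
        ∑ c, ∑ d, f (y * g' c * g d) := by
      intro y
      rw [Equiv.sum_comp e.symm (fun c => f (y * (g' c.1 * g c.2))), Fintype.sum_prod_type]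
      simp [mul_assoc]
    simp only [e2]
    have h0 : ∑ y, (∑ d, f (y * g d)) = 0 := by
      rw [Finset.sum_comm]
      apply Finset.sum_eq_zero
      intro d _
      rw [← hf]; exact Equiv.sum_comp (Equiv.mulRight (g d)) f
    have h1 := hg' (fun y => ∑ d, f (y * g d)) h0
    have h2 := hg f hf
    refine h1.trans ((mul_le_mul_of_nonneg_left h2 (sq_nonneg _)).trans (le_of_eq ?_))
    simp only [Fintype.card_fin]
    push_cast
    ring

theorem mix_edges {G : Type} [Group G] [Fintype G] [DecidableEq G] {D : ℕ} (g : Fin D → G) {l : ℝ}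
    (hl : 0 ≤ l)
    (hg : HasMix g l) (U T : Finset G) (b : ℝ)
    (hT : (T.card : ℝ) ≤ b / 2 * Fintype.card G)
    (hU : ∀ u ∈ U, b * D ≤ ((Finset.univ.filter fun e => u * g e ∈ T).card : ℝ))
    (hb : 0 < b) (hD : 0 < D) :
    b^2 * U.card ≤ 4 * l^2 * T.card := by
  set n : ℝ := ((Fintype.card G : ℕ) : ℝ) with hn
  have hnpos : 0 < n := by rw [hn]; exact_mod_cast Fintype.card_pos
  have hDr : (0:ℝ) < D := by exact_mod_cast hD
  set τ : ℝ := T.card / n with hτ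
  have hτb : τ ≤ b/2 := by rw [hτ, div_le_iff₀ hnpos]; exact hT
  have hτ0 : 0 ≤ τ := by positivity
  let f : G → ℝ := fun x => (if x ∈ T then 1 else 0) - τ
  have hf : ∑ x, f x = 0 := by
    simp only [f, Finset.sum_sub_distrib, Finset.sum_ite_mem, Finset.univ_inter, Finset.sum_const,
      Finset.card_univ, nsmul_eq_mul, mul_one, ← hn, hτ]
    field_simp; ring
  have h := hg f hf
  have hf2 : ∑ x, f x ^ 2 ≤ T.card := by
    have : ∀ x, f x ^ 2 = (1 - 2 * τ) * (if x ∈ T then 1 else 0) + τ^2 := by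
      intro x; simp only [f]; split_ifs <;> ring
    simp only [this, Finset.sum_add_distrib, ← Finset.mul_sum, Finset.sum_ite_mem,
      Finset.univ_inter, Finset.sum_const, Finset.card_univ, nsmul_eq_mul, mul_one, ← hn]
    have : (T.card : ℝ) = τ * n := by rw [hτ]; field_simp
    rw [this]
    nlinarith [mul_nonneg hnpos.le (sq_nonneg τ)]
  have h3 : (b/2 * D)^2 * U.card ≤ ∑ x, (∑ e, f (x * g e))^2 := by
    calc (b/2 * D)^2 * U.card = ∑ u ∈ U, (b/2*D)^2 := by simp [mul_comm]
      _ ≤ ∑ u ∈ U, (∑ e, f (u * g e))^2 := by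
        apply Finset.sum_le_sum
        intro u hu
        have : ∑ e, f (u * g e) = ((Finset.univ.filter fun e => u * g e ∈ T).card : ℝ) - D * τ := by
          simp only [f, Finset.sum_sub_distrib, Finset.sum_const, Finset.card_univ, nsmul_eq_mul,
            Fintype.card_fin]
          congr 1
          simp
        have h5 : b/2 * D ≤ ∑ e, f (u * g e) := by
          rw [this]
          nlinarith [hU u hu]
        gcongr
      _ ≤ _ := Finset.sum_le_sum_of_subset_of_nonneg (Finset.subset_univ _)
          (fun _ _ _ => sq_nonneg _)
  have h4 : (b/2 * D)^2 * U.card ≤ (l * D)^2 * T.card := by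
    refine h3.trans (h.trans ?_)
    rw [Fintype.card_fin]
    gcongr
  have h5 : (D:ℝ)^2 * (b^2 * U.card) ≤ (D:ℝ)^2 * (4 * l^2 * T.card) := by nlinarith
  exact le_of_mul_le_mul_left h5 (by positivity)

end ExpanderPart

section GadgetPart
open Finset

theorem perm_count {A : Type} [Fintype A] [DecidableEq A] (S B : Finset A) :
    (univ.filter fun π : Equiv.Perm A => ∀ a ∈ S, π a ∈ B).card * (Fintype.card A)^S.card ≤
      (Fintype.card (Equiv.Perm A)) * B.card^S.card := by
  induction S using Finset.induction_on with
  | empty => simp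
  | insert a S ha ih =>
    rw [card_insert_of_notMem ha, pow_succ, pow_succ]
    set Q := univ.filter fun π : Equiv.Perm A => ∀ a ∈ S, π a ∈ B with hQ
    set X := univ.filter fun π : Equiv.Perm A => ∀ c ∈ insert a S, π c ∈ B with hX
    have key : X.card * Fintype.card A ≤ B.card * Q.card := by
      have h1 : ∑ c : A, (Q.filter fun π => π c ∈ B).card = B.card * Q.card := by
        simp only [card_filter]
        rw [sum_comm]
        have : ∀ π ∈ Q, ∑ c : A, (if π c ∈ B then 1 else 0) = B.card := by
          intro π _
          rw [Equiv.sum_comp π (fun c => if c ∈ B then 1 else 0)]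
          simp
        rw [sum_congr rfl this, sum_const, smul_eq_mul, mul_comm]
      rw [← h1, mul_comm, ← smul_eq_mul, ← card_univ]
      apply card_nsmul_le_sum
      intro c _
      by_cases hc : c ∈ S
      · apply card_le_card
        intro π hπ
        simp only [hX, hQ, mem_filter, mem_univ, true_and, mem_insert, forall_eq_or_imp] at hπ ⊢
        exact ⟨hπ.2, hπ.2 c hc⟩
      · apply card_le_card_of_injOn (fun π => (Equiv.swap a c).trans π)
        · intro π hπ
          simp only [hX, hQ, coe_filter, mem_filter, mem_univ, true_and, mem_insert,
            forall_eq_or_imp, Set.mem_setOf_eq] at hπ ⊢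
          refine ⟨fun b hb => ?_, ?_⟩
          · rw [Equiv.trans_apply, Equiv.swap_apply_of_ne_of_ne]
            · exact hπ.2 b hb
            · rintro rfl; exact ha hb
            · rintro rfl; exact hc hb
          · simpa using hπ.1
        · intro π _ π' _ h
          have := congrArg (fun σ => (Equiv.swap a c).trans σ) h
          simpa [← Equiv.trans_assoc] using this
    calc X.card * ((Fintype.card A)^S.card * Fintype.card A)
        = (X.card * Fintype.card A) * (Fintype.card A)^S.card := by ring
      _ ≤ (B.card * Q.card) * (Fintype.card A)^S.card := by gcongr
      _ = (Q.card * (Fintype.card A)^S.card) * B.card := by ring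
      _ ≤ (Fintype.card (Equiv.Perm A) * B.card^S.card) * B.card := by gcongr
      _ = _ := by ring

theorem prod_le_mean {d : ℕ} (hd : 0 < d) (t : Fin d → ℝ) (ht : ∀ i, 0 ≤ t i) (τ : ℝ) (hτ : 0 < τ)
    (hsum : ∑ i, t i = d * τ) : ∏ i, t i ≤ τ^d := by
  have h1 : ∏ i, (t i / τ) ≤ ∏ i, Real.exp (t i / τ - 1) := by
    apply prod_le_prod
    · intro i _; have := ht i; positivity
    · intro i _; have := Real.add_one_le_exp (t i / τ - 1); linarith
  rw [← Real.exp_sum, sum_sub_distrib, ← sum_div, hsum, prod_div_distrib] at h1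
  simp only [prod_const, card_univ, Fintype.card_fin, sum_const, nsmul_eq_mul, mul_one] at h1
  rw [mul_div_assoc, div_self hτ.ne', mul_one, sub_self, Real.exp_zero,
    div_le_one (by positivity)] at h1
  exact h1

theorem choose_le_exp (K j : ℕ) (hj : 0 < j) :
    ((K.choose j : ℕ) : ℝ) ≤ (Real.exp 1 * K / j)^j := by
  have h1 : ((K.choose j : ℕ) : ℝ) ≤ (K:ℝ)^j / (j.factorial : ℝ) := Nat.choose_le_pow_div j K
  have h2 : (j:ℝ)^j / (j.factorial : ℝ) ≤ Real.exp j :=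
    Real.pow_div_factorial_le_exp (j:ℝ) (by positivity) j
  have hjr : (0:ℝ) < j := by exact_mod_cast hj
  have hf : (0:ℝ) < j.factorial := by exact_mod_cast j.factorial_pos
  refine h1.trans ?_
  rw [div_pow, mul_pow, ← Real.exp_nat_mul, mul_one, div_le_div_iff₀ hf (by positivity)]
  rw [div_le_iff₀ hf] at h2
  nlinarith [mul_le_mul_of_nonneg_left h2 (show (0:ℝ) ≤ (K:ℝ)^j by positivity)]

theorem gadget_term (q s n m : ℕ) (hq : 1 ≤ q) (hs : 1 ≤ s) (hn : 1 ≤ n) (hm : 1 ≤ m)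
    (hmn : (m:ℝ) ≤ 1 / (4 * Real.exp 1 ^ (q+1) * s) * n) :
    (((n*s).choose m : ℕ) : ℝ) * ((((q+2)*n).choose (q*m) : ℕ) : ℝ) *
      ((q*m : ℝ) / ((q+2) * n))^((q+2)*m) ≤ (1/4)^m := by
  have a1 := choose_le_exp (n*s) m hm
  have a2 := choose_le_exp ((q+2)*n) (q*m) (Nat.mul_pos hq hm)
  have hqr : (1:ℝ) ≤ q := by exact_mod_cast hq
  have hsr : (1:ℝ) ≤ s := by exact_mod_cast hs
  have hnr : (1:ℝ) ≤ n := by exact_mod_cast hn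
  have hmr : (1:ℝ) ≤ m := by exact_mod_cast hm
  have he : 0 < Real.exp 1 := Real.exp_pos 1
  push_cast at a1 a2
  set e := Real.exp 1
  calc _ ≤ (e * (n * s) / m)^m * (e * ((q+2)*n) / (q*m))^(q*m) *
        ((q*m : ℝ) / ((q+2) * n))^((q+2)*m) := by gcongr
    _ = ((e * (n * s) / m) * (e * ((q+2)*n) / (q*m))^q * ((q*m : ℝ) / ((q+2) * n))^(q+2))^m := by
        rw [mul_pow, mul_pow, ← pow_mul, ← pow_mul]
    _ = ((e * (n * s) / m) * e^q * ((q*m : ℝ) / ((q+2) * n))^2)^m := by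
        congr 1
        rw [pow_add]
        have : (e * ((q+2)*n) / (q*m) : ℝ)^q * ((q*m : ℝ) / ((q+2) * n))^q = e^q := by
          rw [← mul_pow]; congr 1; field_simp
        calc _ = (e * (n * s) / m) * ((e * ((q+2)*n) / (q*m) : ℝ)^q *
              ((q*m : ℝ) / ((q+2) * n))^q) * ((q*m : ℝ) / ((q+2) * n))^2 := by ring
          _ = _ := by rw [this]
    _ ≤ ((e * (n * s) / m) * e^q * ((m : ℝ) / n)^2)^m := by
        have : (q*m : ℝ) / ((q+2) * n) ≤ (m : ℝ) / n := by
          rw [div_le_div_iff₀ (by positivity) (by positivity)]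
          nlinarith [mul_pos (show (0:ℝ) < m by linarith) (show (0:ℝ) < n by linarith)]
        gcongr
    _ = (e^(q+1) * s * (m / n))^m := by
        congr 1
        field_simp
        ring
    _ ≤ (1/4)^m := by
        have : e^(q+1) * s * (m / n) ≤ 1/4 := by
          rw [← mul_div_assoc, div_le_iff₀ (by positivity)]
          have h := mul_le_mul_of_nonneg_left hmn (show 0 ≤ e^(q+1) * s by positivity)
          refine h.trans (le_of_eq ?_)
          field_simp
        gcongr

theorem quarter_sum (M : ℕ) : ∑ m ∈ Icc 1 M, (1/4 : ℝ)^m < 1 := by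
  have : ∑ m ∈ Icc 1 M, (1/4 : ℝ)^m = (1 - (1/4)^M) / 3 := by
    induction M with
    | zero => simp
    | succ M ih => rw [sum_Icc_succ_top (by omega), ih]; ring
  rw [this]
  have : (0:ℝ) < (1/4)^M := by positivity
  linarith

theorem gadget_bad (q s : ℕ) (hq : 1 ≤ q) (hs : 1 ≤ s) (N : Type) [Fintype N] [DecidableEq N]
    (hN : 1 ≤ Fintype.card N) (m : ℕ) (hm : 1 ≤ m) (S : Finset (N × Fin s))
    (T : Finset (Fin (q+2) × N)) (hS : S.card = m) (hT : T.card = q * m) :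
    (((univ.filter fun π : Fin (q+2) → Equiv.Perm (N × Fin s) =>
      ∀ j, ∀ a ∈ S, (j, (π j a).1) ∈ T).card : ℕ) : ℝ) ≤
      ((Fintype.card (Equiv.Perm (N × Fin s)) : ℕ) : ℝ)^(q+2) *
        ((q*m : ℝ) / ((q+2) * (Fintype.card N : ℕ)))^((q+2)*m) := by
  have hqr : (1:ℝ) ≤ q := by exact_mod_cast hq
  have hsr : (1:ℝ) ≤ s := by exact_mod_cast hs
  have hnr : (1:ℝ) ≤ Fintype.card N := by exact_mod_cast hN
  have hmr : (1:ℝ) ≤ m := by exact_mod_cast hm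
  have hA : Fintype.card (N × Fin s) = Fintype.card N * s := by simp
  obtain ⟨Tj, hTj⟩ : ∃ Tj : Fin (q+2) → Finset N, ∀ j r, r ∈ Tj j ↔ (j, r) ∈ T :=
    ⟨fun j => univ.filter fun r => (j, r) ∈ T, by intro j r; simp⟩
  have hsumT : ∑ j, (Tj j).card = q * m := by
    rw [← hT]
    have : ∀ j, (Tj j).card = ∑ r, if (j, r) ∈ T then 1 else 0 := by
      intro j
      rw [← card_filter]
      congr 1; ext r; simp [hTj]
    simp only [this]
    rw [← Fintype.sum_prod_type' (f := fun j r => if (j, r) ∈ T then 1 else 0)]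
    simp
  generalize hPc : ((Fintype.card (Equiv.Perm (N × Fin s)) : ℕ) : ℝ) = Pc
  have hPcpos : 0 ≤ Pc := by rw [← hPc]; positivity
  obtain ⟨F, hF⟩ : ∃ F : Fin (q+2) → Finset (Equiv.Perm (N × Fin s)), ∀ j,
      F j = univ.filter fun π : Equiv.Perm (N × Fin s) => ∀ a ∈ S, π a ∈ Tj j ×ˢ univ :=
    ⟨_, fun j => rfl⟩
  have e1 : (univ.filter fun π : Fin (q+2) → Equiv.Perm (N × Fin s) =>
      ∀ j, ∀ a ∈ S, (j, (π j a).1) ∈ T) = Fintype.piFinset F := by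
    ext π
    simp only [Fintype.mem_piFinset, hF, mem_filter, mem_univ, true_and, mem_product, hTj, and_true]
  rw [e1, Fintype.card_piFinset, Nat.cast_prod]
  have e2 : ∀ j, (((F j).card : ℕ) : ℝ) ≤ Pc * (((Tj j).card : ℝ) / Fintype.card N)^m := by
    intro j
    have h := perm_count S (Tj j ×ˢ (univ : Finset (Fin s)))
    rw [← hF, hS, hA, card_product, card_univ, Fintype.card_fin] at h
    have h' : (((F j).card : ℕ) : ℝ)
        * ((Fintype.card N:ℝ) * s)^m ≤ Pc * (((Tj j).card : ℝ) * s)^m := by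
      rw [← hPc]; exact_mod_cast h
    have h3 : (((Tj j).card : ℝ) / Fintype.card N)^m =
        (((Tj j).card : ℝ) * s)^m / ((Fintype.card N:ℝ) * s)^m := by
      rw [← div_pow]; congr 1; field_simp
    rw [h3, ← mul_div_assoc, le_div_iff₀ (by positivity)]
    exact h'
  generalize (Fintype.card N : ℝ) = n at *
  calc _ ≤ ∏ j, (Pc * (((Tj j).card : ℝ) / n)^m) := by
        apply prod_le_prod
        · intro j _; positivity
        · intro j _; exact e2 j
    _ = Pc^(q+2) * (∏ j, (((Tj j).card : ℝ) / n))^m := by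
        rw [prod_mul_distrib, prod_pow, prod_const, card_univ, Fintype.card_fin]
    _ ≤ Pc^(q+2) * (((q*m : ℝ) / ((q+2) * n))^(q+2))^m := by
        have : ∏ j, (((Tj j).card : ℝ) / n) ≤ ((q*m : ℝ) / ((q+2) * n))^(q+2) := by
          apply prod_le_mean (by omega)
          · intro i; positivity
          · positivity
          · rw [← sum_div, ← Nat.cast_sum, hsumT]
            push_cast
            field_simp
        have h0 : 0 ≤ ∏ j, (((Tj j).card : ℝ) / n) := prod_nonneg fun j _ => by positivity
        exact mul_le_mul_of_nonneg_left (pow_le_pow_left₀ h0 this m) (by positivity)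
    _ = _ := by rw [← pow_mul]

set_option maxHeartbeats 1000000 in
theorem exists_gadget (q s : ℕ) (hq : 1 ≤ q) (hs : 1 ≤ s) : ∃ c₀ : ℝ, 0 < c₀ ∧
    ∀ (N : Type) [Fintype N] [DecidableEq N], 1 ≤ Fintype.card N →
    ∃ φ : Fin (q+2) → N × Fin s → N,
      (∀ j r, (univ.filter fun a => φ j a = r).card = s) ∧
      ∀ S : Finset (N × Fin s), (S.card : ℝ) ≤ c₀ * Fintype.card N →
        q * S.card ≤ ∑ j, (S.image (φ j)).card := by
  have hqr : (1:ℝ) ≤ q := by exact_mod_cast hq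
  have hsr : (1:ℝ) ≤ s := by exact_mod_cast hs
  have he : 1 ≤ Real.exp 1 := Real.one_le_exp (by norm_num)
  refine ⟨1 / (4 * Real.exp 1 ^ (q+1) * s), by positivity, ?_⟩
  intro N _ _ hN
  set c₀ := 1 / (4 * Real.exp 1 ^ (q+1) * s) with hc₀
  have hc1 : c₀ ≤ 1 := by
    rw [hc₀, div_le_one (by positivity)]
    have : 1 ≤ Real.exp 1 ^ (q+1) := one_le_pow₀ he
    nlinarith
  set n := Fintype.card N with hn
  have hnr : (1:ℝ) ≤ n := by exact_mod_cast hN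
  have hA : Fintype.card (N × Fin s) = n * s := by simp [hn]
  let bad : Finset (N × Fin s) → Finset (Fin (q+2) × N) → Finset (Fin (q+2) → Equiv.Perm (N × Fin s)) := fun S T =>
    univ.filter fun π => ∀ j, ∀ a ∈ S, (j, (π j a).1) ∈ T
  set Pc : ℝ := ((Fintype.card (Equiv.Perm (N × Fin s)) : ℕ) : ℝ) with hPc
  have hPcpos : 0 < Pc := by rw [hPc]; exact_mod_cast Fintype.card_pos
  have hPT : ((Fintype.card (Fin (q+2) → Equiv.Perm (N × Fin s)) : ℕ) : ℝ) = Pc^(q+2) := by simp [hPc]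
  have hbad : ∀ m, 1 ≤ m → ∀ S T, S.card = m → T.card = q * m →
      ((bad S T).card : ℝ) ≤ Pc^(q+2) * ((q*m : ℝ) / ((q+2) * n))^((q+2)*m) := by
    intro m hm S T hS hT
    exact gadget_bad q s hq hs N hN m hm S T hS hT
  set M := ⌊c₀ * n⌋₊ with hM
  let Bad : Finset (Fin (q+2) → Equiv.Perm (N × Fin s)) := (Icc 1 M).biUnion fun m => (powersetCard m univ).biUnion fun S =>
    (powersetCard (q*m) univ).biUnion fun T => bad S T
  have hBad : (Bad.card : ℝ) < Fintype.card (Fin (q+2) → Equiv.Perm (N × Fin s)) := by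
    have b1 : (Bad.card : ℝ) ≤ ∑ m ∈ Icc 1 M, ∑ S ∈ powersetCard m (univ : Finset (N × Fin s)),
        ∑ T ∈ powersetCard (q*m) (univ : Finset (Fin (q+2) × N)), ((bad S T).card : ℝ) := by
      have : Bad.card ≤ ∑ m ∈ Icc 1 M, ∑ S ∈ powersetCard m (univ : Finset (N × Fin s)),
        ∑ T ∈ powersetCard (q*m) (univ : Finset (Fin (q+2) × N)), (bad S T).card := by
        refine card_biUnion_le.trans (sum_le_sum fun m _ => ?_)
        refine card_biUnion_le.trans (sum_le_sum fun S _ => ?_)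
        exact card_biUnion_le
      exact_mod_cast this
    have b2 : ∀ m ∈ Icc 1 M, ∑ S ∈ powersetCard m (univ : Finset (N × Fin s)),
        ∑ T ∈ powersetCard (q*m) (univ : Finset (Fin (q+2) × N)), ((bad S T).card : ℝ) ≤
        Pc^(q+2) * (1/4)^m := by
      intro m hm
      rw [mem_Icc] at hm
      have hmM : (m:ℝ) ≤ c₀ * n := (Nat.cast_le.2 hm.2).trans (Nat.floor_le (by positivity))
      have ht := gadget_term q s n m hq hs hN hm.1 hmM
      calc _ ≤ ∑ S ∈ powersetCard m (univ : Finset (N × Fin s)),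
          ∑ T ∈ powersetCard (q*m) (univ : Finset (Fin (q+2) × N)),
            Pc^(q+2) * ((q*m : ℝ) / ((q+2) * n))^((q+2)*m) := by
            refine sum_le_sum fun S hS => sum_le_sum fun T hT => ?_
            exact hbad m hm.1 S T (mem_powersetCard.1 hS).2 (mem_powersetCard.1 hT).2
        _ = Pc^(q+2) * ((((n*s).choose m : ℕ) : ℝ) * ((((q+2)*n).choose (q*m) : ℕ) : ℝ) *
              ((q*m : ℝ) / ((q+2) * n))^((q+2)*m)) := by
            simp only [sum_const, card_powersetCard, card_univ, hA, Fintype.card_prod,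
              Fintype.card_fin, ← hn, nsmul_eq_mul]
            ring
        _ ≤ _ := by gcongr
    rw [hPT]
    calc (Bad.card : ℝ) ≤ ∑ m ∈ Icc 1 M, Pc^(q+2) * (1/4)^m := b1.trans (sum_le_sum b2)
      _ = Pc^(q+2) * ∑ m ∈ Icc 1 M, (1/4)^m := by rw [mul_sum]
      _ < Pc^(q+2) * 1 := by
          have := quarter_sum M
          gcongr
      _ = _ := mul_one _
  obtain ⟨π, hπ⟩ : ∃ π, π ∉ Bad := by
    by_contra hcon
    push Not at hcon
    have : Bad = univ := eq_univ_iff_forall.2 hcon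
    rw [this, card_univ] at hBad
    exact lt_irrefl _ hBad
  refine ⟨fun j a => (π j a).1, ?_, ?_⟩
  · intro j r
    have : (univ.filter fun a : N × Fin s => (π j a).1 = r).card = (univ.filter fun a : N × Fin s => a.1 = r).card := by
      apply card_bij (fun a _ => π j a)
      · intro a ha; simpa using ha
      · intro a _ b _ h; exact (π j).injective h
      · intro b hb; exact ⟨(π j).symm b, by simpa using hb, by simp⟩
    rw [this]
    have h2 : (univ.filter fun a : N × Fin s => a.1 = r) = {r} ×ˢ univ := by
      ext a
      simp only [mem_filter, mem_univ, true_and, mem_product, mem_singleton, and_true]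
    rw [h2]; simp
  · intro S hS
    by_contra hcon
    push Not at hcon
    apply hπ
    have hm1 : 1 ≤ S.card := by
      rcases Nat.eq_zero_or_pos S.card with h | h
      · rw [h] at hcon; simp at hcon
      · exact h
    let T0 : Finset (Fin (q+2) × N) := univ.biUnion fun j => (S.image fun a => (j, (π j a).1))
    have hT0 : T0.card ≤ q * S.card := by
      refine card_biUnion_le.trans (le_trans (sum_le_sum fun j _ => ?_) hcon.le)
      have : (S.image fun a => (j, (π j a).1)) = (S.image fun a => (π j a).1).image (fun r => (j, r)) := by
        rw [image_image]; rfl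
      rw [this]
      exact card_image_le
    have hSn : S.card ≤ n := by
      have : (S.card : ℝ) ≤ n := hS.trans (by nlinarith)
      exact_mod_cast this
    obtain ⟨T, hT, hTc⟩ := exists_superset_card_eq hT0
      (show q * S.card ≤ Fintype.card (Fin (q+2) × N) by
        simp only [Fintype.card_prod, Fintype.card_fin, ← hn]; nlinarith)
    simp only [Bad, mem_biUnion]
    refine ⟨S.card, mem_Icc.2 ⟨hm1, Nat.le_floor hS⟩, S, mem_powersetCard.2 ⟨subset_univ _, rfl⟩,
      T, mem_powersetCard.2 ⟨subset_univ _, hTc⟩, ?_⟩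
    simp only [bad, mem_filter, mem_univ, true_and]
    intro j a ha
    apply hT
    exact mem_biUnion.2 ⟨j, mem_univ _, mem_image.2 ⟨a, ha, rfl⟩⟩

end GadgetPart

section GraphPart
open Finset

theorem count_many {D k : ℕ} (B : Finset (Fin D)) (β : ℝ) (hβ : 0 < β) (hβ1 : β ≤ 1)
    (hB : (B.card : ℝ) ≤ β * D) (r : ℕ) :
    ((univ.filter fun v : Fin k → Fin D => r ≤ (univ.filter fun i => v i ∈ B).card).card : ℝ) ≤
      (2 * D)^k * β^r := by
  have h1 : ∑ v : Fin k → Fin D, ∏ i, (if v i ∈ B then 1/β else 1) =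
      (∑ e : Fin D, if e ∈ B then 1/β else 1)^k := by
    have := Finset.prod_univ_sum (fun _ : Fin k => (univ : Finset (Fin D)))
      (fun _ e => if e ∈ B then 1/β else (1:ℝ))
    rw [prod_const, card_univ, Fintype.card_fin] at this
    rw [this, Fintype.piFinset_univ]
  have h2 : (∑ e : Fin D, if e ∈ B then 1/β else 1) ≤ 2 * (D:ℝ) := by
    have : ∀ e : Fin D, (if e ∈ B then 1/β else 1) ≤ 1 + (if e ∈ B then 1/β else 0) := by
      intro e; split_ifs <;> simp
    refine (sum_le_sum fun e _ => this e).trans ?_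
    rw [sum_add_distrib, sum_const, card_univ, Fintype.card_fin, ← sum_filter, sum_const,
      filter_mem_eq_inter, univ_inter]
    simp only [nsmul_eq_mul, mul_one]
    have : (B.card : ℝ) * (1/β) ≤ D := by
      rw [mul_one_div, div_le_iff₀ hβ]; linarith
    linarith
  have h3 : ∀ v : Fin k → Fin D, ∏ i, (if v i ∈ B then 1/β else 1) =
      (1/β)^(univ.filter fun i => v i ∈ B).card := by
    intro v
    rw [prod_ite, prod_const, prod_const_one, mul_one]
  have h4 : ((univ.filter fun v : Fin k → Fin D => r ≤ (univ.filter fun i => v i ∈ B).card).card : ℝ)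
      * (1/β)^r ≤ (2 * D)^k := by
    have h0 : (0:ℝ) ≤ ∑ e : Fin D, if e ∈ B then 1/β else 1 := by
      apply sum_nonneg; intro e _; split_ifs <;> positivity
    calc _ = ∑ v ∈ univ.filter (fun v : Fin k → Fin D => r ≤ (univ.filter fun i => v i ∈ B).card),
          (1/β)^r := by rw [sum_const, nsmul_eq_mul]
      _ ≤ ∑ v ∈ univ.filter (fun v : Fin k → Fin D => r ≤ (univ.filter fun i => v i ∈ B).card),
          ∏ i, (if v i ∈ B then 1/β else 1) := by
          apply sum_le_sum
          intro v hv
          rw [h3]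
          apply pow_le_pow_right₀
          · rw [le_div_iff₀ hβ]; linarith
          · exact (mem_filter.1 hv).2
      _ ≤ ∑ v : Fin k → Fin D, ∏ i, (if v i ∈ B then 1/β else 1) := by
          apply sum_le_sum_of_subset_of_nonneg (subset_univ _)
          intro v _ _
          rw [h3]; positivity
      _ ≤ _ := by rw [h1]; gcongr
  rw [one_div, inv_pow, ← div_eq_mul_inv, div_le_iff₀ (by positivity)] at h4
  exact h4

/-- The fibre of `S` over `(y, i)`. -/
def Pfib {G : Type} [Group G] [DecidableEq G] {D k s : ℕ} (g : Fin D → G)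
    (S : Finset (G × ((Fin k → Fin D) × Fin s))) (y : G) (i : Fin k) :
    Finset (G × ((Fin k → Fin D) × Fin s)) :=
  S.filter fun p => p.1 * g (p.2.1 i) = y

theorem sum_Pfib {G : Type} [Group G] [Fintype G] [DecidableEq G] {D k s : ℕ} (g : Fin D → G)
    (S : Finset (G × ((Fin k → Fin D) × Fin s))) (i : Fin k) (P : G → Prop) [DecidablePred P] :
    ∑ y, (if P y then ((Pfib g S y i).card : ℝ) else 0) =
      ∑ p ∈ S, if P (p.1 * g (p.2.1 i)) then 1 else 0 := by
  simp only [Pfib, card_filter, Nat.cast_sum, Nat.cast_ite, Nat.cast_one, Nat.cast_zero]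
  have : ∀ y, (if P y then (∑ p ∈ S, if p.1 * g (p.2.1 i) = y then (1:ℝ) else 0) else 0) =
      ∑ p ∈ S, if p.1 * g (p.2.1 i) = y then (if P y then (1:ℝ) else 0) else 0 := by
    intro y
    split_ifs <;> simp
  simp only [this]
  rw [sum_comm]
  apply sum_congr rfl
  intro p _
  rw [sum_ite_eq]
  simp

theorem heavy_bound {G : Type} [Group G] [Fintype G] [DecidableEq G] {D k s : ℕ} (g : Fin D → G)
    (l : ℝ) (hl : 0 ≤ l) (hg : HasMix g l) (hD : 0 < D) (hk : 0 < k) (hs : 0 < s)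
    (ε β c₀ : ℝ) (hε : 0 < ε) (hβ : 0 < β) (hβ1 : β ≤ 1) (hc₀ : 0 < c₀) (r : ℕ)
    (hr : (r:ℝ) ≤ ε * k + 1)
    (h1 : s * 2^k * β^r * D ≤ ε^2 * c₀)
    (h2 : 4 * s * k * l^2 ≤ ε * β^2 * c₀)
    (S : Finset (G × ((Fin k → Fin D) × Fin s)))
    (hS : (k:ℝ) * S.card ≤ β / 2 * Fintype.card G * (c₀ * (D:ℝ)^k)) :
    ∑ i : Fin k, ∑ y : G, (if c₀ * (D:ℝ)^k < (Pfib g S y i).card then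
      ((Pfib g S y i).card : ℝ) else 0) ≤ 4 * ε * (k * S.card) := by
  classical
  have hDr : (0:ℝ) < D := by exact_mod_cast hD
  have hkr : (0:ℝ) < k := by exact_mod_cast hk
  have hsr : (0:ℝ) < s := by exact_mod_cast hs
  have hn0 : 0 < c₀ * (D:ℝ)^k := by positivity
  obtain ⟨T, hT⟩ : ∃ T : Finset G, ∀ y, y ∈ T ↔ ∃ i, c₀ * (D:ℝ)^k < (Pfib g S y i).card :=
    ⟨univ.filter fun y => ∃ i, c₀ * (D:ℝ)^k < (Pfib g S y i).card, by intro y; simp⟩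
  have hsumP : ∀ i : Fin k, ∑ y, ((Pfib g S y i).card : ℝ) = S.card := by
    intro i
    have := sum_Pfib g S i (fun _ => True)
    simpa using this
  have hTc : (T.card : ℝ) * (c₀ * (D:ℝ)^k) ≤ k * S.card := by
    calc (T.card : ℝ) * (c₀ * (D:ℝ)^k) = ∑ y ∈ T, c₀ * (D:ℝ)^k := by
          rw [sum_const, nsmul_eq_mul]
      _ ≤ ∑ y ∈ T, ∑ i : Fin k, ((Pfib g S y i).card : ℝ) := by
          apply sum_le_sum
          intro y hy
          obtain ⟨i, hi⟩ := (hT y).1 hy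
          exact hi.le.trans (single_le_sum (f := fun i => ((Pfib g S y i).card : ℝ))
            (fun i _ => by positivity) (mem_univ i))
      _ ≤ ∑ y, ∑ i : Fin k, ((Pfib g S y i).card : ℝ) := by
          apply sum_le_sum_of_subset_of_nonneg (subset_univ _)
          intro y _ _
          positivity
      _ = k * S.card := by
          rw [sum_comm, sum_congr rfl fun i _ => hsumP i]
          simp
  let B : G → Finset (Fin D) := fun u => univ.filter fun e => u * g e ∈ T
  let cnt : G × ((Fin k → Fin D) × Fin s) → ℕ := fun p => (univ.filter fun i => p.2.1 i ∈ B p.1).card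
  have hcntk : ∀ p, (cnt p : ℝ) ≤ k := by
    intro p
    have : cnt p ≤ k := (card_le_univ _).trans (by simp)
    exact_mod_cast this
  let U : Finset G := univ.filter fun u => β * D ≤ ((B u).card : ℝ)
  have hU : β^2 * U.card ≤ 4 * l^2 * T.card := by
    apply mix_edges g hl hg U T β _ _ hβ hD
    · have := hTc.trans hS
      exact le_of_mul_le_mul_right this hn0
    · intro u hu
      exact (mem_filter.1 hu).2
  let Su : G → Finset (G × ((Fin k → Fin D) × Fin s)) := fun u => S.filter fun p => p.1 = u
  let small : G → Prop := fun u => ((Su u).card : ℝ) ≤ ε * (c₀ * (D:ℝ)^k) / D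
  let S1 := S.filter fun p => small p.1
  let S2 := S.filter fun p => ¬ small p.1 ∧ p.1 ∉ U
  let S3 := S.filter fun p => p.1 ∈ U
  have hsplit : ∀ y i, ((Pfib g S y i).card : ℝ) ≤ (Pfib g S1 y i).card + (Pfib g S2 y i).card +
      (Pfib g S3 y i).card := by
    intro y i
    have : Pfib g S y i ⊆ (Pfib g S1 y i ∪ Pfib g S2 y i) ∪ Pfib g S3 y i := by
      intro p hp
      simp only [Pfib, S1, S2, S3, mem_union, mem_filter] at hp ⊢
      by_cases a : small p.1 <;> by_cases b : p.1 ∈ U <;> simp [a, b, hp.1, hp.2]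
    have := (card_le_card this).trans ((card_union_le _ _).trans
      (Nat.add_le_add_right (card_union_le _ _) _))
    exact_mod_cast this
  have hH1 : ∀ y i, c₀ * (D:ℝ)^k < (Pfib g S y i).card →
      ((Pfib g S1 y i).card : ℝ) ≤ ε * (Pfib g S y i).card := by
    intro y i hy
    have e1 : (Pfib g S1 y i).card =
        ∑ e : Fin D, ((Pfib g S1 y i).filter fun p => p.2.1 i = e).card :=
      card_eq_sum_card_fiberwise (fun p _ => mem_coe.2 (mem_univ _))
    have e2 : ∀ e : Fin D, (((Pfib g S1 y i).filter fun p => p.2.1 i = e).card : ℝ) ≤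
        ε * (c₀ * (D:ℝ)^k) / D := by
      intro e
      rcases Finset.eq_empty_or_nonempty ((Pfib g S1 y i).filter fun p => p.2.1 i = e) with h | ⟨p, hp⟩
      · rw [h]; simp only [card_empty, Nat.cast_zero]; positivity
      · simp only [Pfib, S1, mem_filter] at hp
        refine le_trans ?_ hp.1.1.2
        have : ((Pfib g S1 y i).filter fun p => p.2.1 i = e) ⊆ Su p.1 := by
          intro p' hp'
          simp only [Pfib, S1, Su, mem_filter] at hp' ⊢
          refine ⟨hp'.1.1.1, ?_⟩
          have a1 := hp'.1.2
          have a2 := hp.1.2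
          rw [hp'.2] at a1
          rw [hp.2] at a2
          exact mul_right_cancel (a1.trans a2.symm)
        exact_mod_cast card_le_card this
    rw [e1, Nat.cast_sum]
    calc _ ≤ ∑ e : Fin D, ε * (c₀ * (D:ℝ)^k) / D := sum_le_sum fun e _ => e2 e
      _ = ε * (c₀ * (D:ℝ)^k) := by
          rw [sum_const, card_univ, Fintype.card_fin, nsmul_eq_mul]; field_simp
      _ ≤ _ := by gcongr
  have hcount : ∀ S' : Finset (G × ((Fin k → Fin D) × Fin s)), ∑ i : Fin k, ∑ y : G,
      (if c₀ * (D:ℝ)^k < (Pfib g S y i).card then ((Pfib g S' y i).card : ℝ) else 0) ≤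
      ∑ p ∈ S', (cnt p : ℝ) := by
    intro S'
    calc _ = ∑ i : Fin k, ∑ p ∈ S', (if c₀ * (D:ℝ)^k < (Pfib g S (p.1 * g (p.2.1 i)) i).card
          then (1:ℝ) else 0) := by
          apply sum_congr rfl
          intro i _
          exact sum_Pfib g S' i (fun y => c₀ * (D:ℝ)^k < (Pfib g S y i).card)
      _ = ∑ p ∈ S', ∑ i : Fin k, (if c₀ * (D:ℝ)^k < (Pfib g S (p.1 * g (p.2.1 i)) i).card
          then (1:ℝ) else 0) := sum_comm
      _ ≤ _ := by
          apply sum_le_sum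
          intro p _
          simp only [cnt, card_filter, Nat.cast_sum, Nat.cast_ite, Nat.cast_one, Nat.cast_zero]
          apply sum_le_sum
          intro i _
          by_cases h : c₀ * (D:ℝ)^k < (Pfib g S (p.1 * g (p.2.1 i)) i).card
          · have : p.2.1 i ∈ B p.1 := by
              simp only [B, mem_filter, mem_univ, true_and]
              exact (hT _).2 ⟨i, h⟩
            simp [this, h]
          · rw [if_neg h]; split_ifs <;> simp
  have hH2 : ∑ p ∈ S2, (cnt p : ℝ) ≤ 2 * ε * (k * S.card) := by
    let U2 : Finset G := univ.filter fun u => ¬ small u ∧ u ∉ U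
    have a1 : ∀ p ∈ S2, (cnt p : ℝ) ≤ ε * k + k * (if r ≤ cnt p then 1 else 0) := by
      intro p _
      split_ifs with h
      · have := hcntk p
        have : 0 < ε * k := by positivity
        linarith
      · push Not at h
        have : (cnt p : ℝ) + 1 ≤ r := by exact_mod_cast h
        linarith
    have a2 : ∀ u ∈ U2, (((S2.filter fun p => r ≤ cnt p).filter fun p => p.1 = u).card : ℝ) ≤
        ε * (Su u).card := by
      intro u hu
      simp only [U2, U, small, mem_filter, mem_univ, true_and, not_le] at hu
      have b1 : ((univ.filter fun v : Fin k → Fin D =>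
          r ≤ (univ.filter fun i => v i ∈ B u).card).card : ℝ) ≤ (2 * D)^k * β^r :=
        count_many (B u) β hβ hβ1 hu.2.le r
      have b2 : ((S2.filter fun p => r ≤ cnt p).filter fun p => p.1 = u).card ≤
          ((univ.filter fun v : Fin k → Fin D =>
          r ≤ (univ.filter fun i => v i ∈ B u).card) ×ˢ (univ : Finset (Fin s))).card := by
        apply card_le_card_of_injOn (fun p => p.2)
        · intro p hp
          rw [mem_coe, mem_filter, mem_filter] at hp
          rw [mem_coe, mem_product]
          refine ⟨?_, mem_univ _⟩
          rw [mem_filter]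
          refine ⟨mem_univ _, ?_⟩
          have := hp.1.2
          simp only [cnt, hp.2] at this
          exact this
        · intro p hp p' hp' h
          rw [mem_coe, mem_filter] at hp hp'
          exact Prod.ext (hp.2.trans hp'.2.symm) h
      rw [card_product, card_univ, Fintype.card_fin] at b2
      have b3 : (((S2.filter fun p => r ≤ cnt p).filter fun p => p.1 = u).card : ℝ) ≤
          ((univ.filter fun v : Fin k → Fin D =>
          r ≤ (univ.filter fun i => v i ∈ B u).card).card : ℝ) * s := by exact_mod_cast b2
      calc _ ≤ _ := b3
        _ ≤ ((2 * D)^k * β^r) * s := by gcongr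
        _ = (s * 2^k * β^r * D) * ((D:ℝ)^k / D) := by rw [mul_pow]; field_simp
        _ ≤ (ε^2 * c₀) * ((D:ℝ)^k / D) := by gcongr
        _ = ε * (ε * (c₀ * (D:ℝ)^k) / D) := by ring
        _ ≤ _ := by have := hu.1.le; gcongr
    have a3 : ((S2.filter fun p => r ≤ cnt p).card : ℝ) ≤ ε * S.card := by
      have c1 : (S2.filter fun p => r ≤ cnt p).card =
          ∑ u ∈ U2, ((S2.filter fun p => r ≤ cnt p).filter fun p => p.1 = u).card := by
        apply card_eq_sum_card_fiberwise
        intro p hp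
        simp only [S2, coe_filter, mem_filter, Set.mem_setOf_eq] at hp
        simp only [U2, coe_filter, mem_univ, true_and, Set.mem_setOf_eq]
        exact hp.1.2
      have c2 : S.card = ∑ u : G, (Su u).card :=
        card_eq_sum_card_fiberwise (fun p _ => mem_coe.2 (mem_univ _))
      rw [c1, c2, Nat.cast_sum, Nat.cast_sum, mul_sum]
      refine (sum_le_sum a2).trans ?_
      apply sum_le_sum_of_subset_of_nonneg (subset_univ _)
      intro u _ _
      positivity
    have a4 : (S2.card : ℝ) ≤ S.card := by exact_mod_cast card_le_card (filter_subset _ _)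
    calc _ ≤ ∑ p ∈ S2, (ε * k + k * (if r ≤ cnt p then (1:ℝ) else 0)) := sum_le_sum a1
      _ = S2.card * (ε * k) + k * ((S2.filter fun p => r ≤ cnt p).card : ℝ) := by
          rw [sum_add_distrib, sum_const, nsmul_eq_mul, ← mul_sum, sum_boole]
      _ ≤ S.card * (ε * k) + k * (ε * S.card) := by gcongr
      _ = _ := by ring
  have hH3 : ∑ p ∈ S3, (cnt p : ℝ) ≤ ε * (k * S.card) := by
    have a1 : (S3.card : ℝ) ≤ U.card * ((D:ℝ)^k * s) := by
      have : S3 ⊆ U ×ˢ univ := by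
        intro p hp
        rw [mem_product]
        exact ⟨(mem_filter.1 hp).2, mem_univ _⟩
      have := card_le_card this
      rw [card_product, card_univ, Fintype.card_prod, Fintype.card_fun, Fintype.card_fin,
        Fintype.card_fin, Fintype.card_fin] at this
      exact_mod_cast this
    have a2 : β^2 * c₀ * (U.card * ((D:ℝ)^k * s) * k) ≤ β^2 * c₀ * (ε * (k * S.card)) := by
      calc _ = (β^2 * U.card) * (c₀ * (D:ℝ)^k * s * k) := by ring
        _ ≤ (4 * l^2 * T.card) * (c₀ * (D:ℝ)^k * s * k) := by gcongr
        _ = (4 * s * k * l^2) * (T.card * (c₀ * (D:ℝ)^k)) := by ring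
        _ ≤ (ε * β^2 * c₀) * (k * S.card) := by gcongr
        _ = _ := by ring
    have a3 := le_of_mul_le_mul_left a2 (by positivity)
    calc _ ≤ ∑ p ∈ S3, (k:ℝ) := sum_le_sum fun p _ => hcntk p
      _ = S3.card * k := by rw [sum_const, nsmul_eq_mul]
      _ ≤ U.card * ((D:ℝ)^k * s) * k := by gcongr
      _ ≤ _ := a3
  have hfin : ∀ i : Fin k, ∀ y : G, (if c₀ * (D:ℝ)^k < (Pfib g S y i).card then
      ((Pfib g S y i).card : ℝ) else 0) ≤ ε * (Pfib g S y i).card +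
      ((if c₀ * (D:ℝ)^k < (Pfib g S y i).card then ((Pfib g S2 y i).card : ℝ) else 0) +
      (if c₀ * (D:ℝ)^k < (Pfib g S y i).card then ((Pfib g S3 y i).card : ℝ) else 0)) := by
    intro i y
    split_ifs with h
    · have := hH1 y i h
      have := hsplit y i
      linarith
    · simp only [add_zero]; positivity
  refine (sum_le_sum fun i _ => sum_le_sum fun y _ => hfin i y).trans ?_
  simp only [sum_add_distrib, ← mul_sum, hsumP]
  have e2 := (hcount S2).trans hH2
  have e3 := (hcount S3).trans hH3
  rw [sum_const, card_univ, Fintype.card_fin, nsmul_eq_mul]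
  linarith

end GraphPart

section GraphPart2
open Finset

/-- The edge set of the main construction. -/
def mainE {G : Type} [Group G] {D k s d : ℕ} (g : Fin D → G)
    (φ : Fin d → (Fin k → Fin D) × Fin s → (Fin k → Fin D)) :
    Set ((G × ((Fin k → Fin D) × Fin s)) × (G × Fin k × Fin d × (Fin k → Fin D))) :=
  {z | z.2.1 = z.1.1 * g (z.1.2.1 z.2.2.1) ∧ z.2.2.2.2 = φ z.2.2.2.1 z.1.2}

theorem main_left {G : Type} [Group G] {D k s d : ℕ} (g : Fin D → G)
    (φ : Fin d → (Fin k → Fin D) × Fin s → (Fin k → Fin D)) :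
    LeftRegular (mainE g φ) (k * d) := by
  intro x₀
  have e : {x₁ | (x₀, x₁) ∈ mainE g φ} ≃ Fin k × Fin d :=
    { toFun := fun x => (x.1.2.1, x.1.2.2.1)
      invFun := fun p => ⟨(x₀.1 * g (x₀.2.1 p.1), p.1, p.2, φ p.2 x₀.2), rfl, rfl⟩
      left_inv := by
        rintro ⟨⟨y, i, j, r⟩, h1, h2⟩
        simp only at h1 h2
        subst h1 h2
        rfl
      right_inv := fun p => rfl }
  rw [Nat.card_congr e]
  simp

theorem main_right {G : Type} [Group G] {D k s d : ℕ} (g : Fin D → G)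
    (φ : Fin d → (Fin k → Fin D) × Fin s → (Fin k → Fin D))
    (hφ : ∀ j r, (univ.filter fun a => φ j a = r).card = s) :
    RightRegular (mainE g φ) s := by
  rintro ⟨y, i, j, r⟩
  have e : {x₀ | (x₀, (y, i, j, r)) ∈ mainE g φ} ≃ {a // φ j a = r} :=
    { toFun := fun x => ⟨x.1.2, x.2.2.symm⟩
      invFun := fun a => ⟨(y * (g (a.1.1 i))⁻¹, a.1), by
        refine ⟨?_, a.2.symm⟩
        simp⟩
      left_inv := by
        rintro ⟨⟨x, a⟩, h1, h2⟩
        simp only at h1 h2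
        apply Subtype.ext
        simp [h1]
      right_inv := fun p => rfl }
  rw [Nat.card_congr e, Nat.card_eq_fintype_card, Fintype.card_subtype, hφ]

theorem main_lossless {G : Type} [Group G] [Fintype G] {D k s q : ℕ} (g : Fin D → G)
    (l : ℝ) (hl : 0 ≤ l) (hg : HasMix g l) (hD : 0 < D) (hk : 0 < k) (hs : 0 < s)
    (ε β c₀ : ℝ) (hε : 0 < ε) (hβ : 0 < β) (hβ1 : β ≤ 1) (hc₀ : 0 < c₀) (r : ℕ)
    (hr : (r:ℝ) ≤ ε * k + 1)
    (h1 : s * 2^k * β^r * D ≤ ε^2 * c₀)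
    (h2 : 4 * s * k * l^2 ≤ ε * β^2 * c₀)
    (φ : Fin (q+2) → (Fin k → Fin D) × Fin s → (Fin k → Fin D))
    (hφ : ∀ S : Finset ((Fin k → Fin D) × Fin s), (S.card : ℝ) ≤ c₀ * (D:ℝ)^k →
        q * S.card ≤ ∑ j, (S.image (φ j)).card)
    (δ : ℝ) (hδ : (1 - δ) * (q + 2) ≤ q * (1 - 4 * ε)) :
    IsLossless (mainE g φ) (k * (q+2)) (β * c₀ / (2 * k * s)) δ := by
  classical
  have hDr : (0:ℝ) < D := by exact_mod_cast hD
  have hkr : (0:ℝ) < k := by exact_mod_cast hk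
  have hsr : (0:ℝ) < s := by exact_mod_cast hs
  intro S₀ hS₀
  obtain ⟨S, rfl⟩ : ∃ S : Finset (G × ((Fin k → Fin D) × Fin s)), (S : Set _) = S₀ :=
    ⟨S₀.toFinite.toFinset, by simp⟩
  have hcS : Nat.card (S : Set (G × ((Fin k → Fin D) × Fin s))) = S.card := by simp
  rw [hcS] at hS₀ ⊢
  have hcV : (Nat.card (G × ((Fin k → Fin D) × Fin s)) : ℝ) = Fintype.card G * ((D:ℝ)^k * s) := by
    rw [Nat.card_eq_fintype_card]
    simp
  rw [hcV] at hS₀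
  have hS : (k:ℝ) * S.card ≤ β / 2 * Fintype.card G * (c₀ * (D:ℝ)^k) := by
    calc (k:ℝ) * S.card ≤ k * (β * c₀ / (2 * k * s) * (Fintype.card G * ((D:ℝ)^k * s))) := by gcongr
      _ = _ := by field_simp
  have hH := heavy_bound g l hl hg hD hk hs ε β c₀ hε hβ hβ1 hc₀ r hr h1 h2 S hS
  have hsumP : ∀ i : Fin k, ∑ y, ((Pfib g S y i).card : ℝ) = S.card := by
    intro i
    have := sum_Pfib g S i (fun _ => True)
    simpa using this
  have hN : Nat.card (Nbhd (mainE g φ) (S : Set (G × ((Fin k → Fin D) × Fin s)))) =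
      ∑ y : G, ∑ i : Fin k, ∑ j : Fin (q+2), (((Pfib g S y i).image Prod.snd).image (φ j)).card := by
    rw [Nat.card_eq_fintype_card, Fintype.card_subtype, card_filter, Fintype.sum_prod_type]
    refine sum_congr rfl fun y _ => ?_
    rw [Fintype.sum_prod_type]
    refine sum_congr rfl fun i _ => ?_
    rw [Fintype.sum_prod_type]
    refine sum_congr rfl fun j _ => ?_
    rw [← card_filter]
    congr 1
    ext r
    simp only [mem_filter, mem_univ, true_and, Nbhd, mainE, Set.mem_setOf_eq, mem_image, Pfib,
      mem_coe]
    constructor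
    · rintro ⟨p, hp, h1, h2⟩
      exact ⟨p.2, ⟨p, ⟨hp, h1.symm⟩, rfl⟩, h2.symm⟩
    · rintro ⟨a, ⟨p, ⟨hp, h1⟩, rfl⟩, h2⟩
      exact ⟨p, hp, h1.symm, h2.symm⟩
  have hloc : ∀ y i, (q:ℝ) * ((Pfib g S y i).card -
      (if c₀ * (D:ℝ)^k < (Pfib g S y i).card then ((Pfib g S y i).card : ℝ) else 0)) ≤
      ((∑ j : Fin (q+2), (((Pfib g S y i).image Prod.snd).image (φ j)).card : ℕ) : ℝ) := by
    intro y i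
    split_ifs with h
    · rw [sub_self, mul_zero]; positivity
    · push Not at h
      have hc : ((Pfib g S y i).image Prod.snd).card = (Pfib g S y i).card := by
        apply card_image_of_injOn
        intro p hp p' hp' hpp
        simp only [Pfib, coe_filter, Set.mem_setOf_eq] at hp hp'
        have a1 := hp.2.trans hp'.2.symm
        rw [hpp] at a1
        exact Prod.ext (mul_right_cancel a1) hpp
      have := hφ ((Pfib g S y i).image Prod.snd) (by rw [hc]; exact h)
      rw [hc] at this
      rw [sub_zero]
      exact_mod_cast this
  rw [hN]
  calc (1 - δ) * ((k * (q+2) : ℕ) : ℝ) * (S.card : ℝ)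
      = ((1 - δ) * (q + 2)) * (k * S.card) := by push_cast; ring
    _ ≤ (q * (1 - 4 * ε)) * (k * S.card) := by gcongr
    _ = q * (k * S.card - 4 * ε * (k * S.card)) := by ring
    _ ≤ q * (k * S.card - ∑ i : Fin k, ∑ y : G, (if c₀ * (D:ℝ)^k < (Pfib g S y i).card then
      ((Pfib g S y i).card : ℝ) else 0)) := by gcongr
    _ = ∑ y : G, ∑ i : Fin k, (q:ℝ) * ((Pfib g S y i).card -
      (if c₀ * (D:ℝ)^k < (Pfib g S y i).card then ((Pfib g S y i).card : ℝ) else 0)) := by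
        conv_rhs => rw [sum_comm]
        simp only [← mul_sum, sum_sub_distrib, hsumP]
        simp
    _ ≤ ∑ y : G, ∑ i : Fin k,
        ((∑ j : Fin (q+2), (((Pfib g S y i).image Prod.snd).image (φ j)).card : ℕ) : ℝ) :=
        sum_le_sum fun y _ => sum_le_sum fun i _ => hloc y i
    _ = _ := by push_cast; rfl

/-- Left multiplication on the first coordinate. -/
def actL (G : Type) [Group G] (X : Type) : G →* Equiv.Perm (G × X) where
  toFun h :=
    { toFun := fun p => (h * p.1, p.2)
      invFun := fun p => (h⁻¹ * p.1, p.2)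
      left_inv := fun p => by simp
      right_inv := fun p => by simp }
  map_one' := by ext p <;> simp
  map_mul' a b := by ext p <;> simp [mul_assoc]

theorem actL_free (G : Type) [Group G] (X : Type) (h : G) (x : G × X) (hx : actL G X h x = x) :
    h = 1 := by
  have : h * x.1 = x.1 := congrArg Prod.fst hx
  simpa using this

theorem main_equi {G : Type} [Group G] {D k s d : ℕ} (g : Fin D → G)
    (φ : Fin d → (Fin k → Fin D) × Fin s → (Fin k → Fin D)) (h : G) (x₀ x₁)
    (hx : (x₀, x₁) ∈ mainE g φ) : (actL G _ h x₀, actL G _ h x₁) ∈ mainE g φ := by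
  obtain ⟨h1, h2⟩ := hx
  refine ⟨?_, h2⟩
  change h * x₁.1 = h * x₀.1 * g (x₀.2.1 x₁.2.1)
  rw [mul_assoc]
  exact congrArg (h * ·) h1

end GraphPart2

theorem lossless_family (ε μ₁ μ₂ : ℝ) (hε : 0 < ε) (hμ₁ : 0 < μ₁) (hμ : μ₁ < μ₂) :
    ∃ (w₀ w₁ : ℕ) (c C : ℝ), 0 < w₀ ∧ 0 < w₁ ∧ 0 < c ∧ 1 ≤ C ∧
      μ₁ < (w₀ : ℝ) / w₁ ∧ (w₀ : ℝ) / w₁ < μ₂ ∧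
      ∀ (G : Type) [Group G] [Fintype G] (g : Fin 51 → G), HasMix g (5/6) →
        ∃ (V₀ V₁ : Type) (_ : Finite V₀) (_ : Finite V₁) (E : Set (V₀ × V₁))
          (σ₀ : G →* Equiv.Perm V₀) (σ₁ : G →* Equiv.Perm V₁),
          LeftRegular E w₀ ∧ RightRegular E w₁ ∧ IsLossless E w₀ c ε ∧
          (∀ (g : G) (x₀ : V₀) (x₁ : V₁), (x₀, x₁) ∈ E → (σ₀ g x₀, σ₁ g x₁) ∈ E) ∧
          (∀ (g : G) (x : V₀), σ₀ g x = x → g = 1) ∧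
          (∀ (g : G) (x : V₁), σ₁ g x = x → g = 1) ∧
          Nat.card G ≤ Nat.card V₀ ∧ (Nat.card V₀ : ℝ) ≤ C * Nat.card G := by
  have hμ₂ : 0 < μ₂ := hμ₁.trans hμ
  obtain ⟨e, he⟩ : ∃ e, e = ε / 8 := ⟨_, rfl⟩
  have hepos : 0 < e := by rw [he]; positivity
  -- the inner degree
  obtain ⟨q, hq⟩ : ∃ q : ℕ, q = ⌈4 / ε⌉₊ := ⟨_, rfl⟩
  have hq1 : 1 ≤ q := by rw [hq]; exact Nat.ceil_pos.2 (by positivity)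
  have hq4 : 4 ≤ q * ε := by
    have := Nat.le_ceil (4 / ε)
    rw [← hq, div_le_iff₀ hε] at this
    exact this
  have hδ : (1 - ε) * (q + 2) ≤ q * (1 - 4 * e) := by rw [he]; nlinarith
  -- the base rate
  obtain ⟨σ, hσ⟩ : ∃ σ, σ = √(5/6 : ℝ) := ⟨_, rfl⟩
  have hσ0 : 0 < σ := by rw [hσ]; positivity
  have hσ2 : σ^2 = 5/6 := by rw [hσ]; exact Real.sq_sqrt (by norm_num)
  have hσ1 : σ < 1 := by nlinarith
  obtain ⟨R, hR⟩ := exists_pow_lt_of_lt_one (show (0:ℝ) < 1/51 by norm_num) hσ1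
  have hgap : 0 < 1/μ₁ - 1/μ₂ := sub_pos.2 (one_div_lt_one_div_of_lt hμ₁ hμ)
  obtain ⟨k, hk⟩ : ∃ k : ℕ, k = max 1 (max ⌈R / e⌉₊ ⌈1 / (1/μ₁ - 1/μ₂)⌉₊) := ⟨_, rfl⟩
  have hk1 : 1 ≤ k := by rw [hk]; exact le_max_left _ _
  have hkr : (1:ℝ) ≤ k := by exact_mod_cast hk1
  have hkR : (R:ℝ) ≤ e * k := by
    have h1 : ⌈R / e⌉₊ ≤ k := by rw [hk]; exact (le_max_left _ _).trans (le_max_right _ _)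
    have h2 : R / e ≤ k := (Nat.le_ceil _).trans (by exact_mod_cast h1)
    rw [div_le_iff₀ hepos] at h2
    linarith
  have hkg : 1 ≤ k * (1/μ₁ - 1/μ₂) := by
    have h1 : ⌈1 / (1/μ₁ - 1/μ₂)⌉₊ ≤ k := by
      rw [hk]; exact (le_max_right _ _).trans (le_max_right _ _)
    have h2 : 1 / (1/μ₁ - 1/μ₂) ≤ k := (Nat.le_ceil _).trans (by exact_mod_cast h1)
    rwa [div_le_iff₀ hgap] at h2
  obtain ⟨r, hr⟩ : ∃ r : ℕ, r = ⌈e * k⌉₊ := ⟨_, rfl⟩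
  have hr1 : (r:ℝ) ≤ e * k + 1 := by rw [hr]; exact (Nat.ceil_lt_add_one (by positivity)).le
  have hrR : R ≤ r := by
    have : (R:ℝ) ≤ r := by rw [hr]; exact hkR.trans (Nat.le_ceil _)
    exact_mod_cast this
  have hρ : σ^r * 51 < 1 := by
    have : σ^r ≤ σ^R := pow_le_pow_of_le_one hσ0.le hσ1.le hrR
    linarith
  have hρ0 : 0 ≤ σ^r * 51 := by positivity
  -- the right degree
  obtain ⟨s, hs⟩ : ∃ s : ℕ, s = ⌊((k * (q+2) : ℕ) : ℝ) / μ₂⌋₊ + 1 := ⟨_, rfl⟩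
  have hs1 : 1 ≤ s := by rw [hs]; omega
  have hsr : (1:ℝ) ≤ s := by exact_mod_cast hs1
  have hsl : ((k * (q+2) : ℕ) : ℝ) / μ₂ < s := by
    rw [hs]; push_cast; exact_mod_cast Nat.lt_floor_add_one _
  have hqr : (1:ℝ) ≤ q := by exact_mod_cast hq1
  have hsu : s < ((k * (q+2) : ℕ) : ℝ) / μ₁ := by
    have h1 : (s:ℝ) ≤ ((k * (q+2) : ℕ) : ℝ) / μ₂ + 1 := by
      rw [hs, Nat.cast_add, Nat.cast_one]
      have := Nat.floor_le (show 0 ≤ ((k * (q+2) : ℕ) : ℝ) / μ₂ by positivity)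
      linarith
    have h2 : 1 < ((k * (q+2) : ℕ) : ℝ) * (1/μ₁ - 1/μ₂) := by
      push_cast
      nlinarith
    have h3 : ((k * (q+2) : ℕ) : ℝ) * (1/μ₁ - 1/μ₂) =
      ((k * (q+2) : ℕ) : ℝ) / μ₁ - ((k * (q+2) : ℕ) : ℝ) / μ₂ := by ring
    linarith
  obtain ⟨c₀, hc₀, hgad⟩ := exists_gadget q s hq1 hs1
  -- the number of steps
  obtain ⟨t1, ht1⟩ := exists_pow_lt_of_lt_one
    (show 0 < e^2 * c₀ / (s * 2^k) by positivity) hρ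
  obtain ⟨t2, ht2⟩ := exists_pow_lt_of_lt_one
    (show 0 < e * c₀ / (4 * s * k) by positivity) (show (5/6 : ℝ) < 1 by norm_num)
  obtain ⟨t, ht⟩ : ∃ t, t = t1 + t2 := ⟨_, rfl⟩
  have p1 : (σ^r * 51)^t ≤ e^2 * c₀ / (s * 2^k) :=
    (pow_le_pow_of_le_one hρ0 hρ.le (by omega)).trans ht1.le
  have p2 : (5/6 : ℝ)^t ≤ e * c₀ / (4 * s * k) :=
    (pow_le_pow_of_le_one (by norm_num) (by norm_num) (by omega)).trans ht2.le
  have hD : 0 < 51^t := by positivity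
  have hβ0 : 0 < σ^t := by positivity
  have hβ1 : σ^t ≤ 1 := pow_le_one₀ hσ0.le hσ1.le
  have hβ2 : (σ^t)^2 = (5/6 : ℝ)^t := by rw [← pow_mul, mul_comm, pow_mul, hσ2]
  have h1 : (s:ℝ) * 2^k * (σ^t)^r * ((51^t : ℕ) : ℝ) ≤ e^2 * c₀ := by
    rw [le_div_iff₀ (by positivity)] at p1
    refine le_trans (le_of_eq ?_) p1
    push_cast
    rw [mul_pow, ← pow_mul, ← pow_mul, mul_comm t r]
    ring
  have h2 : 4 * (s:ℝ) * k * ((5/6 : ℝ)^t)^2 ≤ e * (σ^t)^2 * c₀ := by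
    rw [hβ2]
    rw [le_div_iff₀ (by positivity)] at p2
    have := mul_le_mul_of_nonneg_right p2 (show (0:ℝ) ≤ (5/6)^t by positivity)
    linarith
  have hDk : 1 ≤ (51^t)^k := Nat.one_le_pow _ _ hD
  have hDks : 1 ≤ (51^t)^k * s := Nat.mul_pos hDk hs1
  refine ⟨k * (q+2), s, σ^t * c₀ / (2 * k * s), (((51^t)^k * s : ℕ) : ℝ),
    Nat.mul_pos hk1 (by omega), hs1, by positivity, by exact_mod_cast hDks, ?_, ?_, ?_⟩
  · rw [lt_div_iff₀ (by positivity)]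
    rw [lt_div_iff₀ hμ₁] at hsu
    linarith
  · rw [div_lt_iff₀ (by positivity)]
    rw [div_lt_iff₀ hμ₂] at hsl
    linarith
  intro G _ _ g hg
  obtain ⟨g', hg'⟩ := hasMix_pow g hg t
  have hcard : Fintype.card (Fin k → Fin (51^t)) = (51^t)^k := by simp
  obtain ⟨φ, hφ1, hφ2⟩ := hgad (Fin k → Fin (51^t)) (by rw [hcard]; exact hDk)
  rw [hcard] at hφ2
  have hV : Nat.card (G × ((Fin k → Fin (51^t)) × Fin s)) = Nat.card G * ((51^t)^k * s) := by
    rw [Nat.card_prod, Nat.card_prod, Nat.card_eq_fintype_card (α := Fin k → Fin (51^t)), hcard,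
      Nat.card_eq_fintype_card (α := Fin s), Fintype.card_fin]
  refine ⟨G × ((Fin k → Fin (51^t)) × Fin s), G × Fin k × Fin (q+2) × (Fin k → Fin (51^t)),
    inferInstance, inferInstance, mainE g' φ, actL G _, actL G _, main_left g' φ,
    main_right g' φ hφ1, ?_, main_equi g' φ, actL_free G _, actL_free G _, ?_, ?_⟩
  · refine main_lossless g' ((5/6)^t) (by positivity) hg' hD hk1 hs1 e (σ^t) c₀ hepos hβ0 hβ1 hc₀ r
      hr1 h1 h2 φ ?_ ε hδ
    intro S hS
    apply hφ2 S
    rw [Nat.cast_pow]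
    exact hS
  · rw [hV]
    exact Nat.le_mul_of_pos_right _ hDks
  · rw [hV, Nat.cast_mul, mul_comm]


/-- 1-sided lossless expanders with prescribed degree ratios and
free group symmetry; the group action is given by homomorphisms into permutations. -/
theorem lossless_expanders_with_symmetry
    (ε μ₁ μ₂ ν₁ ν₂ : ℝ) (hε : 0 < ε)
    (hμ₁ : 0 < μ₁) (hμ : μ₁ < μ₂) (hμ₂ : μ₂ < 1)
    (hν₁ : 0 < ν₁) (hν : ν₁ < ν₂) (hν₂ : ν₂ < 1) :
    ∃ (wd wu wr wl : ℕ) (cd cr εd εr C : ℝ),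
      0 < wd ∧ 0 < wu ∧ 0 < wr ∧ 0 < wl ∧
      0 < cd ∧ 0 < cr ∧ 0 < εd ∧ 0 < εr ∧ 1 ≤ C ∧
      μ₁ < (wd : ℝ) / wu ∧ (wd : ℝ) / wu < μ₂ ∧
      ν₁ < (wr : ℝ) / wl ∧ (wr : ℝ) / wl < ν₂ ∧
      (wu : ℝ) * εr ≤ ε ∧ εr ≤ ε ∧ εd ≤ ε ∧
      ∀ N : ℕ,
        ∃ (G : Type) (_ : Group G) (_ : Finite G)
          (V₀ V₁ : Type) (_ : Finite V₀) (_ : Finite V₁) (E : Set (V₀ × V₁))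
          (W₀ W₁ : Type) (_ : Finite W₀) (_ : Finite W₁) (E' : Set (W₀ × W₁))
          (σ₀ : G →* Equiv.Perm V₀) (σ₁ : G →* Equiv.Perm V₁)
          (τ₀ : G →* Equiv.Perm W₀) (τ₁ : G →* Equiv.Perm W₁),
          N < Nat.card G ∧
          -- X↕ is (w↓, w↑)-regular, X↔ is (w→, w←)-regular
          LeftRegular E wd ∧ RightRegular E wu ∧
          LeftRegular E' wr ∧ RightRegular E' wl ∧
          -- lossless expansion
          IsLossless E wd cd εd ∧ IsLossless E' wr cr εr ∧
          -- the actions preserve edges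
          (∀ (g : G) (x₀ : V₀) (x₁ : V₁), (x₀, x₁) ∈ E → (σ₀ g x₀, σ₁ g x₁) ∈ E) ∧
          (∀ (g : G) (y₀ : W₀) (y₁ : W₁), (y₀, y₁) ∈ E' → (τ₀ g y₀, τ₁ g y₁) ∈ E') ∧
          -- the actions are free
          (∀ (g : G) (x : V₀), σ₀ g x = x → g = 1) ∧
          (∀ (g : G) (x : V₁), σ₁ g x = x → g = 1) ∧
          (∀ (g : G) (y : W₀), τ₀ g y = y → g = 1) ∧
          (∀ (g : G) (y : W₁), τ₁ g y = y → g = 1) ∧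
          -- |G| ≤ |V₀*| ≤ C·|G| and |G| ≤ |V*₀| ≤ C·|G|
          Nat.card G ≤ Nat.card V₀ ∧ (Nat.card V₀ : ℝ) ≤ C * Nat.card G ∧
          Nat.card G ≤ Nat.card W₀ ∧ (Nat.card W₀ : ℝ) ≤ C * Nat.card G := by
  obtain ⟨wd, wu, cd, C1, h1, h2, h3, h4, h5, h6, H⟩ := lossless_family ε μ₁ μ₂ hε hμ₁ hμ
  have hwu : (1:ℝ) ≤ wu := by exact_mod_cast h2
  have hεr : 0 < ε / wu := by positivity
  obtain ⟨wr, wl, cr, C2, k1, k2, k3, k4, k5, k6, K⟩ := lossless_family (ε / wu) ν₁ ν₂ hεr hν₁ hν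
  refine ⟨wd, wu, wr, wl, cd, cr, ε, ε / wu, max C1 C2, h1, h2, k1, k2, h3, k3, hε, hεr,
    h4.trans (le_max_left _ _), h5, h6, k5, k6, ?_, div_le_self hε.le hwu, le_refl _, ?_⟩
  · exact le_of_eq (mul_div_cancel₀ ε (by positivity))
  intro N
  obtain ⟨G, i1, i2, g, hN, hg⟩ := exists_expander_group N
  obtain ⟨V₀, V₁, f0, f1, E, σ₀, σ₁, a1, a2, a3, a4, a5, a6, a7, a8⟩ := H G g hg
  obtain ⟨W₀, W₁, f0', f1', E', τ₀, τ₁, b1, b2, b3, b4, b5, b6, b7, b8⟩ := K G g hg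
  refine ⟨G, i1, inferInstance, V₀, V₁, f0, f1, E, W₀, W₁, f0', f1', E', σ₀, σ₁, τ₀, τ₁,
    by rw [Nat.card_eq_fintype_card]; exact hN, a1, a2, b1, b2, a3, b3, a4, b4, a5, a6, b5, b6, a7,
    a8.trans ?_, b7, b8.trans ?_⟩
  · exact mul_le_mul_of_nonneg_right (le_max_left _ _) (Nat.cast_nonneg _)
  · exact mul_le_mul_of_nonneg_right (le_max_right _ _) (Nat.cast_nonneg _)
end

section
/- For every real ε₀ > 0 and every positive integer T, there exist a positive integer D, a constant C ≥ 1, and a real γ > 0 such that for every N ∈ ℕ there exist a (D, D·T)-regular finite bipartite graph (V₀, V₁, E) with |V₀| > N and a finite group G with a free edge-preserving action on the graph, such that |V₀| ≤ C·|G| and the graph is a 1-sided (γ·ε₀/T, ε₀)-lossless expander from V₀ to V₁. -/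
section helpers
open Finset

lemma gad_perm_count {X : Type} [Fintype X] [DecidableEq X] (W S : Finset X) :
    ((univ.filter (fun σ : Equiv.Perm X => ∀ x ∈ S, σ x ∈ W)).card : ℝ) * (Fintype.card X : ℝ) ^ S.card
      ≤ (W.card : ℝ) ^ S.card * (Fintype.card (Equiv.Perm X) : ℝ) := by
  induction S using Finset.induction_on with
  | empty => simp
  | insert x0 S hx ih =>
    set A := univ.filter (fun σ : Equiv.Perm X => ∀ x ∈ S, σ x ∈ W) with hA
    set B := univ.filter (fun σ : Equiv.Perm X => ∀ x ∈ insert x0 S, σ x ∈ W) with hB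
    -- symmetric count
    have hsym : ∀ y ∈ Sᶜ, (A.filter (fun σ => σ y ∈ W)).card = B.card := by
      intro y hy
      have hy : y ∉ S := by simpa using hy
      apply Finset.card_bij (fun σ _ => σ * Equiv.swap x0 y)
      · intro σ hσ
        simp only [hA, hB, mem_filter, mem_univ, true_and] at hσ ⊢
        intro x hxm
        rcases Finset.mem_insert.1 hxm with rfl | hxS
        · simpa using hσ.2
        · have h1 : x ≠ x0 := fun h => hx (h ▸ hxS)
          have h2 : x ≠ y := fun h => hy (h ▸ hxS)
          simpa [Equiv.swap_apply_of_ne_of_ne h1 h2] using hσ.1 x hxS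
      · intro a _ b _ h
        exact mul_right_cancel h
      · intro σ hσ
        refine ⟨σ * Equiv.swap x0 y, ?_, by simp [mul_assoc]⟩
        simp only [hA, hB, mem_filter, mem_univ, true_and] at hσ ⊢
        refine ⟨?_, by simpa using hσ x0 (by simp)⟩
        intro x hxS
        have h1 : x ≠ x0 := fun h => hx (h ▸ hxS)
        have h2 : x ≠ y := fun h => hy (h ▸ hxS)
        simpa [Equiv.swap_apply_of_ne_of_ne h1 h2] using hσ x (by simp [hxS])
    have hdc : Sᶜ.card * B.card = ∑ σ ∈ A, (Sᶜ.filter (fun y => σ y ∈ W)).card := by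
      rw [← Finset.sum_const_nat hsym]
      simp_rw [Finset.card_filter]
      exact Finset.sum_comm
    have hin : ∀ σ ∈ A, (Sᶜ.filter (fun y => σ y ∈ W)).card + S.card = W.card := by
      intro σ hσ
      simp only [hA, mem_filter, mem_univ, true_and] at hσ
      have h1 : (univ.filter (fun y => σ y ∈ W)).card = W.card := by
        apply Finset.card_bij (fun y _ => σ y)
        · intro y hy; simpa using hy
        · intro a _ b _ h; exact σ.injective h
        · intro b hb; exact ⟨σ.symm b, by simpa using hb, by simp⟩
      rw [← h1]
      have h2 : (univ.filter (fun y => σ y ∈ W)) = (Sᶜ.filter (fun y => σ y ∈ W)) ∪ S := by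
        ext y
        simp only [mem_filter, mem_univ, true_and, mem_union, mem_compl]
        constructor
        · intro h; by_cases hy : y ∈ S <;> simp [hy, h]
        · rintro (h | h)
          · exact h.2
          · exact hσ y h
      rw [h2, Finset.card_union_of_disjoint]
      rw [Finset.disjoint_left]; intro y hy; simp at hy; exact hy.1
    have hS : Sᶜ.card + S.card = Fintype.card X := by rw [add_comm]; exact Finset.card_add_card_compl S
    have hSpos : 0 < Sᶜ.card := Finset.card_pos.2 ⟨x0, by simpa using hx⟩
    have hkey : (B.card : ℝ) * Fintype.card X ≤ W.card * A.card := by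
      rcases A.eq_empty_or_nonempty with h0 | ⟨σ0, hσ0⟩
      · have : B.card = 0 := by
          have : Sᶜ.card * B.card = 0 := by rw [hdc, h0]; simp
          rcases Nat.mul_eq_zero.1 this with h | h
          · omega
          · exact h
        simp [this, h0]
      · have h3 : (Sᶜ.card : ℝ) * B.card = A.card * ((W.card : ℝ) - S.card) := by
          have : (Sᶜ.card : ℝ) * B.card = ∑ σ ∈ A, ((Sᶜ.filter (fun y => σ y ∈ W)).card : ℝ) := by
            exact_mod_cast hdc
          rw [this, Finset.sum_congr rfl (g := fun _ => (W.card : ℝ) - S.card)]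
          · rw [Finset.sum_const, nsmul_eq_mul]
          · intro σ hσ
            have := hin σ hσ
            rw [← this]; push_cast; ring
        have h4 : (Sᶜ.card : ℝ) = Fintype.card X - S.card := by
          rw [← hS]; push_cast; ring
        have hWX : (W.card : ℝ) ≤ Fintype.card X := by exact_mod_cast Finset.card_le_univ W
        have hp : (0:ℝ) < Sᶜ.card := by exact_mod_cast hSpos
        have : (Sᶜ.card : ℝ) * (B.card * Fintype.card X) ≤ Sᶜ.card * (W.card * A.card) := by
          calc (Sᶜ.card : ℝ) * (B.card * Fintype.card X) = (Sᶜ.card * B.card) * Fintype.card X := by ring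
            _ = A.card * (((W.card : ℝ) - S.card) * Fintype.card X) := by rw [h3]; ring
            _ ≤ A.card * ((Fintype.card X - S.card) * W.card) := by
                apply mul_le_mul_of_nonneg_left _ (by positivity)
                have : (0:ℝ) ≤ S.card := by positivity
                nlinarith
            _ = Sᶜ.card * (W.card * A.card) := by rw [h4]; ring
        exact le_of_mul_le_mul_left this hp
    rw [Finset.card_insert_of_notMem hx, pow_succ, pow_succ]
    calc (B.card : ℝ) * ((Fintype.card X : ℝ) ^ S.card * Fintype.card X)
        = (B.card * Fintype.card X) * (Fintype.card X : ℝ) ^ S.card := by ring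
      _ ≤ (W.card * A.card) * (Fintype.card X : ℝ) ^ S.card := by gcongr
      _ = W.card * (A.card * (Fintype.card X : ℝ) ^ S.card) := by ring
      _ ≤ W.card * ((W.card : ℝ) ^ S.card * (Fintype.card (Equiv.Perm X) : ℝ)) := by gcongr
      _ = _ := by ring

lemma gad_pow_fact (n : ℕ) : (n : ℝ) ^ n ≤ 3 ^ n * n.factorial := by
  have h := Real.pow_div_factorial_le_exp (n : ℝ) (by positivity) n
  rw [div_le_iff₀ (by positivity)] at h
  refine h.trans ?_
  gcongr
  rw [← Real.exp_one_pow]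
  gcongr
  exact (Real.exp_one_lt_d9.le).trans (by norm_num)

/-- moment bound -/
lemma gad_moment {X : Type} [Fintype X] [DecidableEq X] (m s : ℕ) (hs : 0 < s) (hm : 0 < m)
    (hX : Fintype.card X = m * s) (π : X → Fin s)
    (hπ : ∀ b, (univ.filter (fun x => π x = b)).card = m) (S : Finset X) (hS : 0 < S.card) 
    (hSs : S.card ≤ s) :
    ∑ σ : Equiv.Perm X, ((s : ℝ) / S.card) ^ (S.card - (S.image (fun x => π (σ x))).card)
      ≤ 6 ^ S.card * (Fintype.card (Equiv.Perm X) : ℝ) := by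
  set n := S.card with hn
  have hn0 : (0:ℝ) < n := by exact_mod_cast hS
  have hs0 : (0:ℝ) < s := by exact_mod_cast hs
  have hm0 : (0:ℝ) < m := by exact_mod_cast hm
  -- count for fixed w
  have hcount : ∀ w ∈ Finset.range (n+1), 
      ((univ.filter (fun σ : Equiv.Perm X => (S.image (fun x => π (σ x))).card = w)).card : ℝ)
        * ((s : ℝ) / n) ^ (n - w) ≤ 3 ^ n * (Fintype.card (Equiv.Perm X) : ℝ) := by
    intro w hw
    have hwn : w ≤ n := by simpa [Nat.lt_succ_iff] using hw
    have h1 : (univ.filter (fun σ : Equiv.Perm X => (S.image (fun x => π (σ x))).card = w)) ⊆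
        (Finset.powersetCard w (univ : Finset (Fin s))).biUnion (fun B => 
          univ.filter (fun σ : Equiv.Perm X => ∀ x ∈ S, σ x ∈ univ.filter (fun x => π x ∈ B))) := by
      intro σ hσ
      simp only [mem_filter, mem_univ, true_and, mem_biUnion, mem_powersetCard, subset_univ] at hσ ⊢
      exact ⟨_, hσ, fun x hx => Finset.mem_image_of_mem _ hx⟩
    have h2 : ∀ B ∈ Finset.powersetCard w (univ : Finset (Fin s)),
        ((univ.filter (fun σ : Equiv.Perm X => ∀ x ∈ S, σ x ∈ univ.filter (fun x => π x ∈ B))).card : ℝ)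
        ≤ ((w : ℝ) / s) ^ n * (Fintype.card (Equiv.Perm X) : ℝ) := by
      intro B hB
      have hBw : B.card = w := (mem_powersetCard.1 hB).2
      have hW : (univ.filter (fun x => π x ∈ B)).card = w * m := by
        have : (univ.filter (fun x => π x ∈ B)) = B.biUnion (fun b => univ.filter (fun x => π x = b)) := by
          ext x; simp
        rw [this, Finset.card_biUnion]
        · rw [Finset.sum_const_nat (fun b _ => hπ b), hBw]
        · intro a _ b _ hab
          rw [Function.onFun, Finset.disjoint_left]
          intro x hx hx'
          simp at hx hx'
          exact hab (hx.symm.trans hx')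
      have := gad_perm_count (univ.filter (fun x => π x ∈ B)) S
      rw [hW, hX, ← hn] at this
      rw [div_pow, div_mul_eq_mul_div, le_div_iff₀ (by positivity)]
      push_cast at this
      rw [mul_pow, mul_pow] at this
      have hmn : (0:ℝ) < (m:ℝ)^n := by positivity
      apply le_of_mul_le_mul_left _ hmn
      calc _ = _ := by ring
        _ ≤ _ := this
        _ = _ := by ring
    have h3 : ((univ.filter (fun σ : Equiv.Perm X => (S.image (fun x => π (σ x))).card = w)).card : ℝ)
        ≤ (s.choose w : ℝ) * (((w : ℝ) / s) ^ n * (Fintype.card (Equiv.Perm X) : ℝ)) := by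
      calc _ ≤ (((Finset.powersetCard w (univ : Finset (Fin s))).biUnion (fun B => 
          univ.filter (fun σ : Equiv.Perm X => ∀ x ∈ S, σ x ∈ univ.filter (fun x => π x ∈ B)))).card : ℝ) := by
              exact_mod_cast Finset.card_le_card h1
        _ ≤ ∑ B ∈ Finset.powersetCard w (univ : Finset (Fin s)), ((univ.filter (fun σ : Equiv.Perm X => ∀ x ∈ S, σ x ∈ univ.filter (fun x => π x ∈ B))).card : ℝ) := by
              exact_mod_cast Finset.card_biUnion_le
        _ ≤ ∑ B ∈ Finset.powersetCard w (univ : Finset (Fin s)), (((w : ℝ) / s) ^ n * (Fintype.card (Equiv.Perm X) : ℝ)) := Finset.sum_le_sum h2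
        _ = _ := by simp
    have h4 : (s.choose w : ℝ) * ((w : ℝ) / s) ^ n * ((s : ℝ) / n) ^ (n - w) ≤ 3 ^ n := by
      have hc : (s.choose w : ℝ) ≤ (s:ℝ)^w / w.factorial := Nat.choose_le_pow_div w s
      have hf := gad_pow_fact w
      clear_value n
      obtain ⟨r, rfl⟩ : ∃ r, n = w + r := ⟨n - w, by omega⟩
      rw [Nat.add_sub_cancel_left]
      calc (s.choose w : ℝ) * ((w : ℝ) / s) ^ (w+r) * ((s : ℝ) / (w+r : ℕ)) ^ r 
          ≤ ((s:ℝ)^w / w.factorial) * ((w : ℝ) / s) ^ (w+r) * ((s : ℝ) / (w+r:ℕ)) ^ r := by gcongr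
        _ = ((w:ℝ)^w / w.factorial) * ((w:ℝ) / (w+r:ℕ))^r := by
            rw [pow_add, div_pow, div_pow, div_pow, div_pow]
            field_simp
        _ ≤ 3^w * 1 := by
            gcongr
            · rw [div_le_iff₀ (by positivity)]; exact hf
            · apply pow_le_one₀ (by positivity)
              rw [div_le_one (by exact_mod_cast hS)]
              exact_mod_cast hwn
        _ ≤ 3^(w+r) := by
            rw [mul_one]; exact pow_le_pow_right₀ (by norm_num) (by omega)
    calc _ ≤ ((s.choose w : ℝ) * (((w : ℝ) / s) ^ n * (Fintype.card (Equiv.Perm X) : ℝ))) * ((s : ℝ) / n) ^ (n - w) := by gcongr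
      _ = ((s.choose w : ℝ) * ((w : ℝ) / s) ^ n * ((s : ℝ) / n) ^ (n - w)) * (Fintype.card (Equiv.Perm X) : ℝ) := by ring
      _ ≤ _ := by gcongr
  have hfib : ∑ σ : Equiv.Perm X, ((s : ℝ) / n) ^ (n - (S.image (fun x => π (σ x))).card)
      = ∑ w ∈ Finset.range (n+1), ((univ.filter (fun σ : Equiv.Perm X => (S.image (fun x => π (σ x))).card = w)).card : ℝ)
        * ((s : ℝ) / n) ^ (n - w) := by
    rw [← Finset.sum_fiberwise_of_maps_to (s := univ) (t := Finset.range (n+1)) (g := fun σ : Equiv.Perm X => (S.image (fun x => π (σ x))).card)]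
    · apply Finset.sum_congr rfl
      intro w _
      rw [Finset.sum_congr rfl (g := fun _ => ((s : ℝ) / n) ^ (n - w))]
      · simp
      · intro σ hσ; simp at hσ; rw [hσ]
    · intro σ _
      simp only [Finset.mem_range, Nat.lt_succ_iff]
      exact Finset.card_image_le
  rw [hfib]
  calc _ ≤ ∑ w ∈ Finset.range (n+1), (3 ^ n * (Fintype.card (Equiv.Perm X) : ℝ)) := Finset.sum_le_sum hcount
    _ = ((n + 1 : ℕ) : ℝ) * (3 ^ n * (Fintype.card (Equiv.Perm X) : ℝ)) := by simp
    _ ≤ 2 ^ n * (3 ^ n * (Fintype.card (Equiv.Perm X) : ℝ)) := by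
        gcongr
        exact_mod_cast Nat.lt_two_pow_self (n := n)
    _ = _ := by rw [← mul_assoc, ← mul_pow]; norm_num

set_option maxHeartbeats 1000000 in
lemma gad_exists (ε : ℝ) (hε : 0 < ε) (d m : ℕ) (hd : 2 ≤ ε * d) (hm : 0 < m) (s : ℕ) (hs : 0 < s)
    {X : Type} [Fintype X] [DecidableEq X] (hX : Fintype.card X = m * s) :
    ∃ f : Fin d → X → Fin s, (∀ j b, (univ.filter (fun x => f j x = b)).card = m) ∧
      ∀ S : Finset X, (S.card : ℝ) ≤ (1 / (12 * m * 6 ^ d)) * s →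
        (1 - ε) * d * S.card ≤ ∑ j, ((S.image (f j)).card : ℝ) := by
  have hs0 : (0:ℝ) < s := by exact_mod_cast hs
  have hm0 : (0:ℝ) < m := by exact_mod_cast hm
  have hm1 : (1:ℝ) ≤ m := by exact_mod_cast hm
  let e : X ≃ Fin m × Fin s := Fintype.equivOfCardEq (by simp [hX])
  let π : X → Fin s := fun x => (e x).2
  have hπ : ∀ b, (univ.filter (fun x => π x = b)).card = m := by
    intro b
    have : (univ.filter (fun x => π x = b)).card = (univ : Finset (Fin m)).card := by
      apply Finset.card_bij (fun x _ => (e x).1)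
      · simp
      · intro x hx y hy h
        simp [π] at hx hy
        apply e.injective
        exact Prod.ext h (hx.trans hy.symm)
      · intro a _
        exact ⟨e.symm (a, b), by simp [π], by simp⟩
    simpa using this
  clear_value π
  clear e
  set P := (Fintype.card (Equiv.Perm X) : ℝ) with hP
  have hPpos : 0 < P := by rw [hP]; exact_mod_cast Fintype.card_pos
  set c : ℝ := 1 / (12 * m * 6 ^ d) with hc
  have hcpos : 0 < c := by positivity
  have hc1 : c ≤ 1 := by
    rw [hc, div_le_one (by positivity)]
    have : (1:ℝ) ≤ 6 ^ d := one_le_pow₀ (by norm_num)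
    nlinarith
  let bad : Finset X → Finset (Fin d → Equiv.Perm X) := fun S => 
    univ.filter (fun σ => ∑ j, ((S.image (fun x => π (σ j x))).card : ℝ) < (1 - ε) * d * S.card)
  -- bad count
  have hbad : ∀ S : Finset X, 0 < S.card → (S.card : ℝ) ≤ c * s → 
      ((bad S).card : ℝ) ≤ 6 ^ (d * S.card) * P ^ d * ((S.card : ℝ) / s) ^ (2 * S.card) := by
    intro S hS hSc
    have hSs : S.card ≤ s := by
      have : (S.card : ℝ) ≤ s := hSc.trans (by nlinarith)
      exact_mod_cast this
    have hn0 : (0:ℝ) < S.card := by exact_mod_cast hS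
    have hq : 1 ≤ (s:ℝ) / S.card := by rw [one_le_div hn0]; exact_mod_cast hSs
    have hmom := gad_moment m s hs hm hX π hπ S hS hSs
    have hprod : ∑ σ : Fin d → Equiv.Perm X, ∏ j, ((s : ℝ) / S.card) ^ (S.card - (S.image (fun x => π (σ j x))).card)
        ≤ (6 ^ S.card * P) ^ d := by
      rw [← Fintype.piFinset_univ, ← Finset.prod_univ_sum (fun _ => univ) (fun (_ : Fin d) (τ : Equiv.Perm X) => ((s : ℝ) / S.card) ^ (S.card - (S.image (fun x => π (τ x))).card))]
      rw [Finset.prod_const, Finset.card_univ, Fintype.card_fin]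
      gcongr
    have hmark : ((bad S).card : ℝ) * ((s : ℝ) / S.card) ^ (2 * S.card) ≤ (6 ^ S.card * P) ^ d := by
      refine le_trans ?_ hprod
      calc _ = ∑ σ ∈ bad S, ((s : ℝ) / S.card) ^ (2 * S.card) := by simp
        _ ≤ ∑ σ ∈ bad S, ∏ j, ((s : ℝ) / S.card) ^ (S.card - (S.image (fun x => π (σ j x))).card) := by
            apply Finset.sum_le_sum
            intro σ hσ
            rw [Finset.prod_pow_eq_pow_sum]
            apply pow_le_pow_right₀ hq
            simp only [bad, mem_filter, mem_univ, true_and] at hσ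
            have h1 : ((∑ j : Fin d, (S.card - (S.image (fun x => π (σ j x))).card) : ℕ) : ℝ) = 
                d * S.card - ∑ j, ((S.image (fun x => π (σ j x))).card : ℝ) := by
              rw [Nat.cast_sum, Finset.sum_congr rfl (fun j _ => Nat.cast_sub Finset.card_image_le)]
              simp
            have : ((2 * S.card : ℕ) : ℝ) ≤ ((∑ j : Fin d, (S.card - (S.image (fun x => π (σ j x))).card) : ℕ) : ℝ) := by
              rw [h1]; push_cast; nlinarith
            exact_mod_cast this
        _ ≤ _ := Finset.sum_le_sum_of_subset_of_nonneg (Finset.subset_univ _) (fun σ _ _ => by positivity)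
    have : ((s : ℝ) / S.card) ^ (2 * S.card) * ((S.card : ℝ) / s) ^ (2 * S.card) = 1 := by
      rw [← mul_pow, div_mul_div_cancel₀ (by positivity), div_self (by positivity), one_pow]
    calc ((bad S).card : ℝ) = ((bad S).card * ((s : ℝ) / S.card) ^ (2 * S.card)) * ((S.card : ℝ) / s) ^ (2 * S.card) := by
            rw [mul_assoc, this, mul_one]
      _ ≤ (6 ^ S.card * P) ^ d * ((S.card : ℝ) / s) ^ (2 * S.card) := by gcongr
      _ = _ := by rw [mul_pow, ← pow_mul, mul_comm S.card d]
  -- sum over sets of size n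
  have hlev : ∀ n : ℕ, 0 < n → (n : ℝ) ≤ c * s → 
      ∑ S ∈ powersetCard n (univ : Finset X), ((bad S).card : ℝ) ≤ P ^ d * (1/4) ^ n := by
    intro n hn hnc
    have hn0 : (0:ℝ) < n := by exact_mod_cast hn
    have h1 : ∑ S ∈ powersetCard n (univ : Finset X), ((bad S).card : ℝ) ≤ 
        ((m * s).choose n : ℝ) * (6 ^ (d * n) * P ^ d * ((n : ℝ) / s) ^ (2 * n)) := by
      calc _ ≤ ∑ S ∈ powersetCard n (univ : Finset X), (6 ^ (d * n) * P ^ d * ((n : ℝ) / s) ^ (2 * n)) := by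
            apply Finset.sum_le_sum
            intro S hS
            have : S.card = n := (mem_powersetCard.1 hS).2
            have := hbad S (by omega) (by rw [this]; exact hnc)
            rwa [(mem_powersetCard.1 hS).2] at this
        _ = _ := by simp [hX]
    have hch : ((m * s).choose n : ℝ) ≤ (3 * m * s / n) ^ n := by
      have h2 : ((m * s).choose n : ℝ) ≤ ((m * s : ℕ) : ℝ) ^ n / n.factorial := Nat.choose_le_pow_div n (m * s)
      refine h2.trans ?_
      rw [div_pow, div_le_div_iff₀ (by positivity) (by positivity)]
      have := gad_pow_fact n
      push_cast
      calc ((m:ℝ) * s)^n * (n:ℝ)^n ≤ ((m:ℝ) * s)^n * (3 ^ n * n.factorial) := by gcongr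
        _ = _ := by rw [show (3:ℝ) * m * s = 3 * (m * s) by ring, mul_pow 3]; ring
    calc _ ≤ _ := h1
      _ ≤ (3 * m * s / n) ^ n * (6 ^ (d * n) * P ^ d * ((n : ℝ) / s) ^ (2 * n)) := by gcongr
      _ = P ^ d * (3 * m * 6 ^ d * (n / s)) ^ n := by
          rw [pow_mul, pow_mul]
          rw [show (3 * (m:ℝ) * s / n) ^ n * ((6 ^ d) ^ n * P ^ d * (((n:ℝ) / s) ^ 2) ^ n) = 
            P ^ d * ((3 * (m:ℝ) * s / n) * 6 ^ d * ((n / s) ^ 2)) ^ n by rw [mul_pow, mul_pow]; ring]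
          congr 2
          field_simp
      _ ≤ P ^ d * (1/4) ^ n := by
          gcongr
          have : (n:ℝ) / s ≤ c := by rw [div_le_iff₀ hs0]; exact hnc
          calc 3 * (m:ℝ) * 6 ^ d * (n / s) ≤ 3 * (m:ℝ) * 6 ^ d * c := by gcongr
            _ = 1/4 := by rw [hc]; field_simp; norm_num
  -- total
  set L := ⌊c * s⌋₊ with hL
  have htot : ((((univ : Finset (Finset X)).filter (fun S => 0 < S.card ∧ (S.card : ℝ) ≤ c * s)).biUnion bad).card : ℝ) < P ^ d := by
    calc _ ≤ ∑ S ∈ (univ : Finset (Finset X)).filter (fun S => 0 < S.card ∧ (S.card : ℝ) ≤ c * s), ((bad S).card : ℝ) := by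
            exact_mod_cast Finset.card_biUnion_le
      _ = ∑ n ∈ Finset.Ico 1 (L+1), ∑ S ∈ powersetCard n (univ : Finset X), ((bad S).card : ℝ) := by
            rw [← Finset.sum_fiberwise_of_maps_to (t := Finset.Ico 1 (L+1)) (g := fun S : Finset X => S.card)]
            · apply Finset.sum_congr rfl
              intro n hn
              apply Finset.sum_congr _ (fun _ _ => rfl)
              ext S
              simp only [mem_filter, mem_univ, true_and, mem_powersetCard, subset_univ]
              constructor
              · rintro ⟨_, h⟩; exact h
              · intro h
                simp only [Finset.mem_Ico] at hn
                refine ⟨⟨by omega, ?_⟩, h⟩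
                have : S.card ≤ L := by omega
                exact (Nat.le_floor_iff (by positivity)).1 this
            · intro S hS
              simp only [mem_filter, mem_univ, true_and, Finset.mem_Ico] at hS ⊢
              have : S.card ≤ L := Nat.le_floor hS.2
              omega
      _ ≤ ∑ n ∈ Finset.Ico 1 (L+1), P ^ d * (1/4) ^ n := by
            apply Finset.sum_le_sum
            intro n hn
            simp only [Finset.mem_Ico] at hn
            exact hlev n (by omega) ((Nat.le_floor_iff (by positivity)).1 (by omega))
      _ = P ^ d * ∑ n ∈ Finset.Ico 1 (L+1), ((1:ℝ)/4) ^ n := by rw [Finset.mul_sum]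
      _ < P ^ d * 1 := by
            apply mul_lt_mul_of_pos_left _ (by positivity)
            rw [geom_sum_Ico (by norm_num) (by omega)]
            have : (0:ℝ) < (1/4)^(L+1) := by positivity
            rw [div_lt_iff_of_neg (by norm_num)]
            generalize ((1:ℝ)/4)^(L+1) = y at *
            norm_num
            linarith
      _ = _ := mul_one _
  have hex : ∃ σ : Fin d → Equiv.Perm X, σ ∉ ((univ : Finset (Finset X)).filter (fun S => 0 < S.card ∧ (S.card : ℝ) ≤ c * s)).biUnion bad := by
    by_contra hcon
    push Not at hcon
    have h1 : ((univ : Finset (Finset X)).filter (fun S => 0 < S.card ∧ (S.card : ℝ) ≤ c * s)).biUnion bad = univ := by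
      ext σ; simpa using hcon σ
    rw [h1, Finset.card_univ, Fintype.card_fun, Fintype.card_fin] at htot
    push_cast at htot
    exact lt_irrefl _ htot
  obtain ⟨σ, hσ⟩ := hex
  refine ⟨fun j x => π (σ j x), ?_, ?_⟩
  · intro j b
    refine Eq.trans ?_ (hπ b)
    apply Finset.card_bij (fun x _ => σ j x)
    · intro x hx; simpa using hx
    · intro x _ y _ h; exact (σ j).injective h
    · intro y hy; exact ⟨(σ j).symm y, by simpa using hy, by simp⟩
  · intro S hS
    by_contra hcon
    push Not at hcon
    apply hσ
    rcases Nat.eq_zero_or_pos S.card with h0 | h0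
    · exfalso
      rw [h0] at hcon
      rw [Nat.cast_zero, mul_zero] at hcon
      have : (0:ℝ) ≤ ∑ j, ((S.image (fun x => π (σ j x))).card : ℝ) :=
        Finset.sum_nonneg (fun _ _ => Nat.cast_nonneg _)
      linarith
    · simp only [mem_biUnion, mem_filter, mem_univ, true_and]
      exact ⟨S, ⟨h0, hS⟩, by simp only [bad, mem_filter, mem_univ, true_and]; exact hcon⟩

section geo
variable {V : Type} [NormedAddCommGroup V] [InnerProductSpace ℝ V] [FiniteDimensional ℝ V]

/-- small angle between two subspaces -/
def GeoAngle (A B : Submodule ℝ V) : Prop :=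
  ∀ x ∈ A, (∀ w ∈ A ⊓ B, inner ℝ x w = 0) → ‖B.starProjection x‖ ≤ (1/4) * ‖x‖

lemma geo_dist_le (B : Submodule ℝ V) (x y : V) (hy : y ∈ B) : ‖x - B.starProjection x‖ ≤ ‖x - y‖ := by
  rw [Submodule.starProjection_minimal]
  exact ciInf_le ⟨0, by rintro _ ⟨z, rfl⟩; positivity⟩ (⟨y, hy⟩ : B)

lemma geo_proj_self (B : Submodule ℝ V) (y : V) (hy : y ∈ B) : B.starProjection y = y :=
  Submodule.starProjection_eq_self_iff.2 hy

lemma geo_step (A C : Submodule ℝ V) (h : GeoAngle A C) (y : V) (hy : y ∈ A) :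
    ‖C.starProjection y - (A ⊓ C).starProjection y‖ ≤ (1/3) * ‖y - C.starProjection y‖ ∧
    ‖y - (A ⊓ C).starProjection y‖ ≤ (4/3) * ‖y - C.starProjection y‖ := by
  set y' := (A ⊓ C).starProjection y with hy'
  have hm : y' ∈ A ⊓ C := Submodule.starProjection_apply_mem _ _
  have h1 := h (y - y') (A.sub_mem hy hm.1) (fun w hw => Submodule.starProjection_inner_eq_zero _ _ hw)
  rw [map_sub, geo_proj_self C y' hm.2] at h1
  have h2 : ‖y - y'‖ ≤ ‖y - C.starProjection y‖ + ‖C.starProjection y - y'‖ := by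
    simpa using norm_add_le (y - C.starProjection y) (C.starProjection y - y')
  constructor <;> linarith

lemma geo_contract (A B C : Submodule ℝ V) (hAC : GeoAngle A C) (hBC : GeoAngle B C)
    (K : ℝ) (hK0 : 0 ≤ K)
    (hK : ∀ y ∈ A ⊓ C, (∀ w ∈ A ⊓ B ⊓ C, inner ℝ y w = 0) → ‖y‖ ≤ K * ‖y - B.starProjection y‖)
    (y : V) (hy : y ∈ A ⊓ B) (hyo : ∀ w ∈ A ⊓ B ⊓ C, inner ℝ y w = 0) :
    ‖y‖ ≤ (4/3 + 2/3 * K) * ‖y - C.starProjection y‖ := by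
  obtain ⟨a1, a2⟩ := geo_step A C hAC y hy.1
  obtain ⟨b1, b2⟩ := geo_step B C hBC y hy.2
  set y' := (A ⊓ C).starProjection y with hy'
  set y'' := (B ⊓ C).starProjection y with hy''
  have hm : y' ∈ A ⊓ C := Submodule.starProjection_apply_mem _ _
  have hm2 : y'' ∈ B ⊓ C := Submodule.starProjection_apply_mem _ _
  have h1 := hK y' hm (by
    intro w hw
    have h0 := Submodule.starProjection_inner_eq_zero (K := A ⊓ C) y w ⟨hw.1.1, hw.2⟩
    rw [inner_sub_left, hyo w hw] at h0
    linarith)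
  have h2 := geo_dist_le B y' y'' hm2.1
  have h3 : ‖y' - y''‖ ≤ ‖C.starProjection y - y'‖ + ‖C.starProjection y - y''‖ := by
    rw [norm_sub_rev (C.starProjection y) y']
    simpa using norm_add_le (y' - C.starProjection y) (C.starProjection y - y'')
  have h4 : ‖y‖ ≤ ‖y - y'‖ + ‖y'‖ := by simpa using norm_add_le (y - y') y'
  have h5 : ‖y' - B.starProjection y'‖ ≤ (2/3) * ‖y - C.starProjection y‖ := by linarith
  have h6 := mul_le_mul_of_nonneg_left h5 hK0
  nlinarith

lemma geo_base (A B C : Submodule ℝ V) : ∃ K : ℝ, 0 ≤ K ∧ 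
    ∀ y ∈ A ⊓ B, (∀ w ∈ A ⊓ B ⊓ C, inner ℝ y w = 0) → ‖y‖ ≤ K * ‖y - C.starProjection y‖ := by
  let U : Submodule ℝ V := (A ⊓ B) ⊓ (A ⊓ B ⊓ C)ᗮ
  let f : U →ₗ[ℝ] V := (LinearMap.id - (C.starProjection : V →L[ℝ] V).toLinearMap) ∘ₗ U.subtype
  have hf : LinearMap.ker f = ⊥ := by
    rw [LinearMap.ker_eq_bot']
    rintro ⟨y, hy1, hy2⟩ h
    simp only [f, LinearMap.comp_apply, LinearMap.sub_apply, LinearMap.id_apply, Submodule.subtype_apply] at h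
    have h1 : C.starProjection y = y := (sub_eq_zero.1 h).symm
    have h2 : y ∈ C := Submodule.starProjection_eq_self_iff.1 h1
    have h3 := (Submodule.mem_orthogonal _ _).1 hy2 y ⟨hy1, h2⟩
    ext
    exact inner_self_eq_zero.1 h3
  obtain ⟨K, _, hK⟩ := f.exists_antilipschitzWith hf
  refine ⟨K, K.2, ?_⟩
  intro y hy hyo
  have hyU : y ∈ U := ⟨hy, (Submodule.mem_orthogonal' _ _).2 hyo⟩
  have := hK.le_mul_dist ⟨y, hyU⟩ 0
  simpa [f, dist_eq_norm] using this

lemma geo_main (A B C : Submodule ℝ V) (hAB : GeoAngle A B) (hAC : GeoAngle A C) (hBC : GeoAngle B C)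
    (hCB : GeoAngle C B) (x : V) (hx : ∀ w ∈ A ⊓ B ⊓ C, inner ℝ x w = 0) :
    ‖x‖ ^ 2 ≤ 529 * (‖x - A.starProjection x‖ ^ 2 + ‖x - B.starProjection x‖ ^ 2 + ‖x - C.starProjection x‖ ^ 2) := by
  have hACB : A ⊓ C ⊓ B = A ⊓ B ⊓ C := inf_right_comm _ _ _
  obtain ⟨K1, hK1, h1⟩ := geo_base A B C
  obtain ⟨K2, hK2, h2⟩ := geo_base A C B
  rw [hACB] at h2
  set K := max K1 K2 with hK
  have hK0 : 0 ≤ K := hK1.trans (le_max_left _ _)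
  have hiter : ∀ n : ℕ, 
      (∀ y ∈ A ⊓ B, (∀ w ∈ A ⊓ B ⊓ C, inner ℝ y w = 0) → ‖y‖ ≤ (4 + (2/3)^n * K) * ‖y - C.starProjection y‖) ∧
      (∀ y ∈ A ⊓ C, (∀ w ∈ A ⊓ B ⊓ C, inner ℝ y w = 0) → ‖y‖ ≤ (4 + (2/3)^n * K) * ‖y - B.starProjection y‖) := by
    intro n
    induction n with
    | zero => 
      constructor
      · intro y hy hyo
        refine (h1 y hy hyo).trans ?_
        gcongr
        have := le_max_left K1 K2
        simp; linarith
      · intro y hy hyo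
        refine (h2 y hy hyo).trans ?_
        gcongr
        have := le_max_right K1 K2
        simp; linarith
    | succ n ih =>
      have e : (4 + (2/3)^(n+1) * K) = 4/3 + 2/3 * (4 + (2/3)^n * K) := by ring
      rw [e]
      constructor
      · exact geo_contract A B C hAC hBC _ (by positivity) ih.2
      · have := geo_contract A C B hAB hCB (4 + (2/3)^n * K) (by positivity)
        rw [hACB] at this
        exact this ih.1
  have hlim : ∀ y ∈ A ⊓ B, (∀ w ∈ A ⊓ B ⊓ C, inner ℝ y w = 0) → ‖y‖ ≤ 4 * ‖y - C.starProjection y‖ := by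
    intro y hy hyo
    have ht : Filter.Tendsto (fun n : ℕ => (4 + (2/3 : ℝ)^n * K) * ‖y - C.starProjection y‖) Filter.atTop
        (nhds ((4 + 0 * K) * ‖y - C.starProjection y‖)) := by
      apply Filter.Tendsto.mul_const
      apply Filter.Tendsto.const_add
      apply Filter.Tendsto.mul_const
      exact tendsto_pow_atTop_nhds_zero_of_lt_one (by norm_num) (by norm_num)
    have := ge_of_tendsto' ht (fun n => (hiter n).1 y hy hyo)
    simpa using this
  set a := ‖x - A.starProjection x‖ with ha
  set b := ‖x - B.starProjection x‖ with hb
  set c := ‖x - C.starProjection x‖ with hc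
  have ha0 : 0 ≤ a := norm_nonneg _
  have hb0 : 0 ≤ b := norm_nonneg _
  have hc0 : 0 ≤ c := norm_nonneg _
  set z := A.starProjection x with hz
  have hzA : z ∈ A := Submodule.starProjection_apply_mem _ _
  obtain ⟨_, s2⟩ := geo_step A B hAB z hzA
  set y := (A ⊓ B).starProjection z with hy
  have hyAB : y ∈ A ⊓ B := Submodule.starProjection_apply_mem _ _
  have e1 : ‖z - B.starProjection z‖ ≤ a + b := by
    refine (geo_dist_le B z (B.starProjection x) (Submodule.starProjection_apply_mem _ _)).trans ?_
    have := norm_add_le (z - x) (x - B.starProjection x)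
    rw [norm_sub_rev z x] at this
    simpa using this
  have e2 : ‖x - y‖ ≤ a + 4/3 * (a + b) := by
    have : ‖x - y‖ ≤ ‖x - z‖ + ‖z - y‖ := by simpa using norm_add_le (x - z) (z - y)
    linarith
  have e3 : ‖y - C.starProjection y‖ ≤ ‖x - y‖ + c := by
    refine (geo_dist_le C y (C.starProjection x) (Submodule.starProjection_apply_mem _ _)).trans ?_
    have := norm_add_le (y - x) (x - C.starProjection x)
    rw [norm_sub_rev y x] at this
    simpa using this
  have e4 := hlim y hyAB (by
    intro w hw
    have h0 := Submodule.starProjection_inner_eq_zero (K := A ⊓ B) z w hw.1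
    have h0' := Submodule.starProjection_inner_eq_zero (K := A) x w hw.1.1
    rw [inner_sub_left] at h0 h0'
    rw [hx w hw] at h0'
    linarith)
  have e5 : ‖x‖ ≤ ‖x - y‖ + ‖y‖ := by simpa using norm_add_le (x - y) y
  have e6 : ‖x‖ ≤ 35/3 * a + 20/3 * b + 4 * c := by linarith
  have hx0 : 0 ≤ ‖x‖ := norm_nonneg x
  have e7 : ‖x‖^2 ≤ (35/3 * a + 20/3 * b + 4 * c)^2 := by gcongr
  nlinarith [sq_nonneg (a-b), sq_nonneg (a-c), sq_nonneg (b-c)]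
end geo

section rep
set_option linter.unusedSectionVars false
variable {V : Type} [NormedAddCommGroup V] [InnerProductSpace ℝ V] [FiniteDimensional ℝ V]
variable {G : Type} [Group G] (ρ : G →* (V ≃ₗᵢ[ℝ] V)) {p : ℕ} [Fact p.Prime]

def repFix (a : ZMod p → G) : Submodule ℝ V where
  carrier := {v | ∀ s, ρ (a s) v = v}
  zero_mem' := by intro s; simp
  add_mem' := by intro x y hx hy s; rw [map_add, hx s, hy s]
  smul_mem' := by intro c x hx s; rw [map_smul, hx s]

noncomputable def repAvg (a : ZMod p → G) (v : V) : V := (p : ℝ)⁻¹ • ∑ s, ρ (a s) v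

lemma rep_mul (g h : G) (v : V) : ρ (g * h) v = ρ g (ρ h v) := by rw [map_mul]; rfl

lemma repAvg_eq (a : ZMod p → G) (ha : ∀ s t, a (s + t) = a s * a t) (v : V) :
    repAvg ρ a v = (repFix ρ a).starProjection v := by
  have hp : (p : ℝ) ≠ 0 := by exact_mod_cast (Fact.out : p.Prime).ne_zero
  have ha0 : a 0 = 1 := by
    have := ha 0 0
    rw [add_zero] at this
    exact (mul_eq_left.1 this.symm)
  symm
  apply Submodule.eq_starProjection_of_mem_of_inner_eq_zero
  · intro s
    rw [repAvg, map_smul, map_sum]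
    congr 1
    simp_rw [← rep_mul, ← ha]
    exact Fintype.sum_equiv (Equiv.addLeft s) _ _ (fun t => rfl)
  · intro w hw
    rw [inner_sub_left, repAvg, inner_smul_left, sum_inner]
    have : ∀ s ∈ (univ : Finset (ZMod p)), inner ℝ (ρ (a s) v) w = inner ℝ v w := by
      intro s _
      conv_lhs => rw [← hw s]
      exact (ρ (a s)).inner_map_map v w
    rw [Finset.sum_congr rfl this]
    simp [ZMod.card]
    field_simp
    simp

lemma rep_angle (hp16 : 16 ≤ p) (a b z : ZMod p → G) (ha : ∀ s t, a (s + t) = a s * a t)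
    (hb : ∀ s t, b (s + t) = b s * b t) (hz : ∀ s t, z (s + t) = z s * z t)
    (hab : ∀ s t, a s * b t = b t * z (s * t) * a s) (hza : ∀ s t, z s * a t = a t * z s) :
    GeoAngle (repFix ρ a) (repFix ρ b) := by
  have hp0 : (p : ℝ) ≠ 0 := by exact_mod_cast (Fact.out : p.Prime).ne_zero
  have hpp : (0:ℝ) < p := by exact_mod_cast (Fact.out : p.Prime).pos
  intro x hx hxo
  have hxA : ∀ s, ρ (a s) x = x := hx
  have ha0 : ∀ (a : ZMod p → G) (ha : ∀ s t, a (s + t) = a s * a t), a 0 = 1 := by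
    intro a ha
    have := ha 0 0
    rw [add_zero] at this
    exact (mul_eq_left.1 this.symm)
  set Zx := repAvg ρ z x with hZx
  have hZfix : ∀ s, ρ (z s) Zx = Zx := by
    intro s
    have : Zx ∈ repFix ρ z := by rw [hZx, repAvg_eq ρ z hz]; exact Submodule.starProjection_apply_mem _ _
    exact this s
  have hZA : ∀ s, ρ (a s) Zx = Zx := by
    intro s
    rw [hZx, repAvg, map_smul, map_sum]
    congr 1
    apply Finset.sum_congr rfl
    intro t _
    rw [← rep_mul, ← hza, rep_mul, hxA]
  -- P_B P_Z x is invariant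
  have hinv : repAvg ρ b Zx ∈ repFix ρ a ⊓ repFix ρ b := by
    constructor
    · intro s
      rw [repAvg, map_smul, map_sum]
      congr 1
      apply Finset.sum_congr rfl
      intro t _
      rw [← rep_mul, hab, rep_mul, rep_mul, hZA, hZfix]
    · rw [repAvg_eq ρ b hb]; exact Submodule.starProjection_apply_mem _ _
  have hcomp : repAvg ρ a (repAvg ρ b x) = (p:ℝ)⁻¹ • (x - Zx) + repAvg ρ b Zx := by
    have h1 : ∀ t : ZMod p, ∑ s, ρ (a s) (ρ (b t) x) = 
        (p:ℝ) • ρ (b t) Zx + (if t = 0 then (p:ℝ) • (x - Zx) else 0) := by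
      intro t
      have h2 : ∀ s, ρ (a s) (ρ (b t) x) = ρ (b t) (ρ (z (s * t)) x) := by
        intro s
        rw [← rep_mul, hab, rep_mul, rep_mul, hxA]
      simp_rw [h2, ← map_sum]
      by_cases ht : t = 0
      · subst ht
        simp only [mul_zero, ha0 z hz, ha0 b hb, map_one]
        simp [ZMod.card, ← Nat.cast_smul_eq_nsmul ℝ, smul_sub]
      · rw [if_neg ht, add_zero, ← map_smul]
        congr 1
        rw [hZx, repAvg, smul_inv_smul₀ hp0]
        exact Fintype.sum_equiv (Equiv.mulRight₀ t ht) _ _ (fun s => rfl)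
    have h3 : repAvg ρ a (repAvg ρ b x) = (p:ℝ)⁻¹ • (p:ℝ)⁻¹ • ∑ t, ∑ s, ρ (a s) (ρ (b t) x) := by
      rw [repAvg]
      simp_rw [repAvg, map_smul, map_sum]
      rw [← Finset.smul_sum, Finset.sum_comm]
    rw [h3]
    simp_rw [h1]
    rw [Finset.sum_add_distrib, Finset.sum_ite_eq' univ (0 : ZMod p), if_pos (mem_univ _), ← Finset.smul_sum, smul_add, smul_add]
    rw [inv_smul_smul₀ hp0, inv_smul_smul₀ hp0, add_comm]
    rfl
  set PB := (repFix ρ b).starProjection x with hPB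
  have k1 : ‖PB‖^2 = inner ℝ x PB := by
    have := Submodule.starProjection_inner_eq_zero (K := repFix ρ b) x PB (Submodule.starProjection_apply_mem _ _)
    rw [inner_sub_left] at this
    rw [← real_inner_self_eq_norm_sq]; linarith
  have k2 : inner ℝ x PB = inner ℝ x (repAvg ρ a (repAvg ρ b x)) := by
    rw [repAvg_eq ρ b hb, repAvg_eq ρ a ha, ← Submodule.inner_starProjection_left_eq_right (K := repFix ρ a), geo_proj_self _ x hx]
  have k3 : inner ℝ x Zx = ‖Zx‖^2 := by
    have h0 := Submodule.starProjection_inner_eq_zero (K := repFix ρ z) x Zx hZfix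
    rw [inner_sub_left, ← repAvg_eq ρ z hz, ← hZx] at h0
    rw [← real_inner_self_eq_norm_sq]; linarith
  rw [k2, hcomp, inner_add_right, hxo _ hinv, add_zero, inner_smul_right, inner_sub_right, k3, real_inner_self_eq_norm_sq] at k1
  have hp' : (p:ℝ)⁻¹ ≤ 1/16 := by
    rw [inv_le_comm₀ hpp (by norm_num)]; norm_num; exact_mod_cast hp16
  have k4 : ‖PB‖^2 ≤ (1/16) * ‖x‖^2 := by
    rw [k1]
    calc (p:ℝ)⁻¹ * (‖x‖^2 - ‖Zx‖^2) ≤ (p:ℝ)⁻¹ * ‖x‖^2 := by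
          gcongr; have := sq_nonneg ‖Zx‖; linarith
      _ ≤ _ := by gcongr
  apply le_of_sq_le_sq _ (by positivity)
  rw [mul_pow]; norm_num; linarith

end rep

section grp

/-- spectral bound for a finite group with an indexed family of elements -/
def SpecBound (G : Type) [Group G] [Fintype G] (I : Type) [Fintype I] (γ : I → G) (r : ℝ) : Prop :=
  ∀ h : G → ℝ, ∑ g, h g = 0 →
    ∑ g, ((Fintype.card I : ℝ)⁻¹ * ∑ i, h (g * γ i)) ^ 2 ≤ r * ∑ g, h g ^ 2

noncomputable def regRep (G : Type) [Group G] [Fintype G] : G →* (EuclideanSpace ℝ G ≃ₗᵢ[ℝ] EuclideanSpace ℝ G) where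
  toFun γ := LinearIsometryEquiv.piLpCongrLeft 2 ℝ ℝ (Equiv.mulRight γ⁻¹)
  map_one' := by
    ext f g
    simp [LinearIsometryEquiv.piLpCongrLeft_apply]
    rfl
  map_mul' := by
    intro a b
    ext f g
    have : ∀ (c : G) (f : EuclideanSpace ℝ G), (LinearIsometryEquiv.piLpCongrLeft 2 ℝ ℝ (Equiv.mulRight c⁻¹) f) g = f (g * c) := by
      intro c f
      simp [LinearIsometryEquiv.piLpCongrLeft_apply]
    rw [this]
    simp only [LinearIsometryEquiv.coe_mul, Function.comp_apply]
    rw [this]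
    simp [LinearIsometryEquiv.piLpCongrLeft_apply, mul_assoc]

lemma regRep_apply (G : Type) [Group G] [Fintype G] (γ g : G) (f : EuclideanSpace ℝ G) :
    regRep G γ f g = f (g * γ) := by
  simp [regRep, LinearIsometryEquiv.piLpCongrLeft_apply]

lemma spec_three (G : Type) [Group G] [Fintype G] {p : ℕ} [Fact p.Prime] (hp16 : 16 ≤ p)
    (a b c x y y' z : ZMod p → G) 
    (ha : ∀ s t, a (s + t) = a s * a t) (hb : ∀ s t, b (s + t) = b s * b t) (hc : ∀ s t, c (s + t) = c s * c t)
    (hx : ∀ s t, x (s + t) = x s * x t) (hy : ∀ s t, y (s + t) = y s * y t) 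
    (hy' : ∀ s t, y' (s + t) = y' s * y' t) (hz : ∀ s t, z (s + t) = z s * z t)
    (hab : ∀ s t, a s * b t = b t * x (s * t) * a s)
    (hbc : ∀ s t, b s * c t = c t * y (s * t) * b s)
    (hcb : ∀ s t, c s * b t = b t * y' (s * t) * c s)
    (hac : ∀ s t, a s * c t = c t * z (s * t) * a s)
    (hxa : ∀ s t, x s * a t = a t * x s)
    (hyb : ∀ s t, y s * b t = b t * y s) (hyc : ∀ s t, y' s * c t = c t * y' s)
    (hza : ∀ s t, z s * a t = a t * z s)
    (hgen : Subgroup.closure (Set.range a ∪ Set.range b ∪ Set.range c) = ⊤) :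
    SpecBound G (Fin 3 × ZMod p) (fun i => ![a, b, c] i.1 i.2) (1 - 1/1587) := by
  intro h hh
  have hp0 : (p : ℝ) ≠ 0 := by exact_mod_cast (Fact.out : p.Prime).ne_zero
  set f : EuclideanSpace ℝ G := WithLp.toLp 2 h with hf
  set ρ := regRep G with hρ
  have hAB := rep_angle ρ hp16 a b x ha hb hx hab hxa
  have hAC := rep_angle ρ hp16 a c z ha hc hz hac hza
  have hBC := rep_angle ρ hp16 b c y hb hc hy hbc hyb
  have hCB := rep_angle ρ hp16 c b y' hc hb hy' hcb hyc
  have hmain := geo_main _ _ _ hAB hAC hBC hCB f (by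
    rintro w ⟨⟨hwa, hwb⟩, hwc⟩
    have hfix : ∀ γ : G, ∀ g, w (g * γ) = w g := by
      intro γ
      have hγ : γ ∈ Subgroup.closure (Set.range a ∪ Set.range b ∪ Set.range c) := by rw [hgen]; trivial
      induction hγ using Subgroup.closure_induction with
      | mem γ hγ =>
        intro g
        rw [← regRep_apply]
        rcases hγ with (⟨s, rfl⟩ | ⟨s, rfl⟩) | ⟨s, rfl⟩
        · exact congrArg (fun v : EuclideanSpace ℝ G => v g) (hwa s)
        · exact congrArg (fun v : EuclideanSpace ℝ G => v g) (hwb s)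
        · exact congrArg (fun v : EuclideanSpace ℝ G => v g) (hwc s)
      | one => intro g; rw [mul_one]
      | mul u v _ _ hu hv => intro g; rw [← mul_assoc, hv, hu]
      | inv u _ hu => intro g; rw [← hu (g * u⁻¹)]; simp
    have hconst : ∀ g, w g = w 1 := fun g => by simpa using hfix g 1
    rw [PiLp.inner_apply]
    have : ∀ g ∈ (univ : Finset G), inner ℝ (f g) (w g) = w 1 * h g := by
      intro g _
      rw [hconst g, hf]; simp
    rw [Finset.sum_congr rfl this, ← Finset.mul_sum, hh, mul_zero])
  have hpyth : ∀ K : Submodule ℝ (EuclideanSpace ℝ G), ‖K.starProjection f‖^2 = ‖f‖^2 - ‖f - K.starProjection f‖^2 := by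
    intro K
    have h0 := Submodule.starProjection_inner_eq_zero (K := K) f _ (Submodule.starProjection_apply_mem K f)
    have h1 : f = (f - K.starProjection f) + K.starProjection f := by simp
    have h2 : ‖f‖^2 = ‖f - K.starProjection f‖^2 + ‖K.starProjection f‖^2 := by
      conv_lhs => rw [h1]
      rw [norm_add_sq_real, h0]; ring
    linarith
  have e1 := hpyth (repFix ρ a)
  have e2 := hpyth (repFix ρ b)
  have e3 := hpyth (repFix ρ c)
  set u := (repFix ρ a).starProjection f with hu
  set v := (repFix ρ b).starProjection f with hv
  set w := (repFix ρ c).starProjection f with hw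
  have hnf : ‖f‖^2 = ∑ g, h g ^ 2 := by rw [EuclideanSpace.real_norm_sq_eq]
  have hM : ∑ g, ((Fintype.card (Fin 3 × ZMod p) : ℝ)⁻¹ * ∑ i : Fin 3 × ZMod p, h (g * ![a, b, c] i.1 i.2)) ^ 2
      = ∑ g, ((u g + v g + w g) / 3)^2 := by
    apply Finset.sum_congr rfl
    intro g _
    congr 1
    rw [hu, hv, hw, ← repAvg_eq ρ a ha, ← repAvg_eq ρ b hb, ← repAvg_eq ρ c hc]
    simp only [repAvg, PiLp.smul_apply, WithLp.ofLp_sum, Finset.sum_apply, hρ, regRep_apply, smul_eq_mul]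
    rw [Fintype.sum_prod_type, Fin.sum_univ_three]
    simp [ZMod.card]
    field_simp
    rfl
  rw [hM, ← hnf]
  have hu2 : ‖u‖^2 = ∑ g, u g ^ 2 := by rw [EuclideanSpace.real_norm_sq_eq]
  have hv2 : ‖v‖^2 = ∑ g, v g ^ 2 := by rw [EuclideanSpace.real_norm_sq_eq]
  have hw2 : ‖w‖^2 = ∑ g, w g ^ 2 := by rw [EuclideanSpace.real_norm_sq_eq]
  have hcs : ∑ g, ((u g + v g + w g) / 3)^2 ≤ (1/3) * (‖u‖^2 + ‖v‖^2 + ‖w‖^2) := by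
    rw [hu2, hv2, hw2, ← Finset.sum_add_distrib, ← Finset.sum_add_distrib, Finset.mul_sum]
    apply Finset.sum_le_sum
    intro g _
    nlinarith [sq_nonneg (u g - v g), sq_nonneg (u g - w g), sq_nonneg (v g - w g)]
  linarith

lemma SpecBound.mul {G : Type} [Group G] [Fintype G] {I J : Type} [Fintype I] [Fintype J] [Nonempty J]
    {γ : I → G} {δ : J → G} {r r' : ℝ} (hr : 0 ≤ r) (h1 : SpecBound G I γ r) (h2 : SpecBound G J δ r') :
    SpecBound G (I × J) (fun q => γ q.1 * δ q.2) (r * r') := by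
  intro h hh
  set h' : G → ℝ := fun g => (Fintype.card J : ℝ)⁻¹ * ∑ j, h (g * δ j) with hh'
  have hs : ∑ g, h' g = 0 := by
    rw [hh']
    simp only
    rw [← Finset.mul_sum, Finset.sum_comm]
    have : ∀ j ∈ (univ : Finset J), ∑ g, h (g * δ j) = 0 := by
      intro j _
      rw [← hh]
      exact Fintype.sum_equiv (Equiv.mulRight (δ j)) _ _ (fun g => rfl)
    rw [Finset.sum_congr rfl this]; simp
  have a1 := h1 h' hs
  have a2 := h2 h hh
  calc _ = ∑ g, ((Fintype.card I : ℝ)⁻¹ * ∑ i, h' (g * γ i)) ^ 2 := by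
        apply Finset.sum_congr rfl
        intro g _
        congr 1
        rw [hh', Fintype.sum_prod_type, Fintype.card_prod, ← Finset.mul_sum]
        push_cast
        rw [mul_inv]
        simp_rw [mul_assoc]
    _ ≤ r * ∑ g, h' g ^ 2 := a1
    _ ≤ r * (r' * ∑ g, h g ^ 2) := by gcongr
    _ = _ := by ring

end grp

section mat
open Matrix
variable {F : Type} [Field F]

def m12 (x : F) : SpecialLinearGroup (Fin 3) F := ⟨!![1, x, 0; 0, 1, 0; 0, 0, 1], by simp [Matrix.det_fin_three]⟩
def m13 (x : F) : SpecialLinearGroup (Fin 3) F := ⟨!![1, 0, x; 0, 1, 0; 0, 0, 1], by simp [Matrix.det_fin_three]⟩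
def m23 (x : F) : SpecialLinearGroup (Fin 3) F := ⟨!![1, 0, 0; 0, 1, x; 0, 0, 1], by simp [Matrix.det_fin_three]⟩
def m21 (x : F) : SpecialLinearGroup (Fin 3) F := ⟨!![1, 0, 0; x, 1, 0; 0, 0, 1], by simp [Matrix.det_fin_three]⟩
def m31 (x : F) : SpecialLinearGroup (Fin 3) F := ⟨!![1, 0, 0; 0, 1, 0; x, 0, 1], by simp [Matrix.det_fin_three]⟩
def m32 (x : F) : SpecialLinearGroup (Fin 3) F := ⟨!![1, 0, 0; 0, 1, 0; 0, x, 1], by simp [Matrix.det_fin_three]⟩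

lemma sl_ext {A B : SpecialLinearGroup (Fin 3) F} (h : A.1 = B.1) : A = B := Subtype.ext h
lemma sl_mul (A B : SpecialLinearGroup (Fin 3) F) : (A * B).1 = A.1 * B.1 := rfl
lemma m12_add (x y : F) : m12 (x + y) = m12 x * m12 y := by
  apply sl_ext; simp only [sl_mul]; simp [m12, add_comm]
lemma m13_add (x y : F) : m13 (x + y) = m13 x * m13 y := by
  apply sl_ext; simp only [sl_mul]; simp [m13, add_comm]
lemma m23_add (x y : F) : m23 (x + y) = m23 x * m23 y := by
  apply sl_ext; simp only [sl_mul]; simp [m23, add_comm]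
lemma m21_add (x y : F) : m21 (x + y) = m21 x * m21 y := by
  apply sl_ext; simp only [sl_mul]; simp [m21, add_comm]
lemma m31_add (x y : F) : m31 (x + y) = m31 x * m31 y := by
  apply sl_ext; simp only [sl_mul]; simp [m31, add_comm]
lemma m32_add (x y : F) : m32 (x + y) = m32 x * m32 y := by
  apply sl_ext; simp only [sl_mul]; simp [m32, add_comm]

lemma m_ab (s t : F) : m12 s * m23 t = m23 t * m13 (s * t) * m12 s := by
  apply sl_ext; simp only [sl_mul]; simp [m12, m23, m13]
lemma m_bc (s t : F) : m23 s * m31 t = m31 t * m21 (s * t) * m23 s := by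
  apply sl_ext; simp only [sl_mul]; simp [m31, m23, m21]
lemma m_cb (s t : F) : m31 s * m23 t = m23 t * m21 (-(s * t)) * m31 s := by
  apply sl_ext; simp only [sl_mul]; simp [m31, m23, m21, mul_comm]
lemma m_ac (s t : F) : m12 s * m31 t = m31 t * m32 (-(s * t)) * m12 s := by
  apply sl_ext; simp only [sl_mul]; simp [m31, m12, m32, mul_comm]
lemma m_xa (s t : F) : m13 s * m12 t = m12 t * m13 s := by
  apply sl_ext; simp only [sl_mul]; simp [m12, m13]
lemma m_yb (s t : F) : m21 s * m23 t = m23 t * m21 s := by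
  apply sl_ext; simp only [sl_mul]; simp [m21, m23]
lemma m_yc (s t : F) : m21 s * m31 t = m31 t * m21 s := by
  apply sl_ext; simp only [sl_mul]; simp [m21, m31]
lemma m_za (s t : F) : m32 s * m12 t = m12 t * m32 s := by
  apply sl_ext; simp only [sl_mul]; simp [m32, m12]
lemma m_step (s t : F) : m13 s * m32 t = m32 t * m12 (s * t) * m13 s := by
  apply sl_ext; simp only [sl_mul]; simp [m32, m12, m13]

lemma mat_group (N : ℕ) : ∃ (G : Type) (_ : Group G) (_ : Fintype G) (γ : Fin 3 × ZMod 17 → G),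
    N < Fintype.card G ∧ SpecBound G (Fin 3 × ZMod 17) γ (1 - 1/1587) := by
  classical
  haveI : Fact (Nat.Prime 17) := ⟨by norm_num⟩
  let F := GaloisField 17 (N + 1)
  haveI : Finite F := inferInstance
  haveI : Fintype F := Fintype.ofFinite F
  have hcF : Nat.card F = 17 ^ (N + 1) := GaloisField.card 17 (N + 1) (by omega)
  obtain ⟨τ, hτ⟩ := IsCyclic.exists_generator (α := Fˣ)
  let ι : ZMod 17 → F := algebraMap (ZMod 17) F
  have ι_add : ∀ s t, ι (s + t) = ι s + ι t := map_add _
  have ι_mul : ∀ s t, ι (s * t) = ι s * ι t := map_mul _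
  have ι_one : ι 1 = 1 := map_one _
  clear_value ι
  let A : ZMod 17 → SpecialLinearGroup (Fin 3) F := fun s => m12 (ι s)
  let B : ZMod 17 → SpecialLinearGroup (Fin 3) F := fun s => m23 (ι s)
  let C : ZMod 17 → SpecialLinearGroup (Fin 3) F := fun s => m31 (ι s * τ)
  let H : Subgroup (SpecialLinearGroup (Fin 3) F) := Subgroup.closure (Set.range A ∪ Set.range B ∪ Set.range C)
  have hA : ∀ s, A s ∈ H := fun s => Subgroup.subset_closure (Or.inl (Or.inl ⟨s, rfl⟩))
  have hB : ∀ s, B s ∈ H := fun s => Subgroup.subset_closure (Or.inl (Or.inr ⟨s, rfl⟩))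
  have hC : ∀ s, C s ∈ H := fun s => Subgroup.subset_closure (Or.inr ⟨s, rfl⟩)
  have hcomm : ∀ u v w : SpecialLinearGroup (Fin 3) F, u ∈ H → v ∈ H → u * v = v * w * u → w ∈ H := by
    intro u v w hu hv h
    have : w = v⁻¹ * (u * v) * u⁻¹ := by rw [h]; group
    rw [this]
    exact H.mul_mem (H.mul_mem (H.inv_mem hv) (H.mul_mem hu hv)) (H.inv_mem hu)
  have hX : ∀ s, m13 (ι s) ∈ H := fun s => by
    have := hcomm _ _ _ (hA s) (hB 1) (m_ab _ _)
    simpa [ι_one] using this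
  have hY : ∀ s, m21 (ι s * τ) ∈ H := fun s => by
    have := hcomm _ _ _ (hB s) (hC 1) (m_bc _ _)
    simpa [ι_one] using this
  have hY' : ∀ s, m21 (-(ι s * τ)) ∈ H := fun s => by
    have := hcomm _ _ _ (hC s) (hB 1) (m_cb _ _)
    simpa [ι_one] using this
  have hZ : ∀ s, m32 (-(ι s * τ)) ∈ H := fun s => by
    have := hcomm _ _ _ (hA s) (hC 1) (m_ac _ _)
    simpa [ι_one] using this
  have hZ1 : m32 (τ : F) ∈ H := by
    have h1 := H.inv_mem (hZ 1)
    have h2 : (m32 (-(ι 1 * (τ : F))))⁻¹ = m32 (τ : F) := by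
      rw [inv_eq_iff_mul_eq_one, ← m32_add, ι_one]
      apply Subtype.ext
      simp [m32, Matrix.one_fin_three]
    rwa [h2] at h1
  have hpow : ∀ n : ℕ, m12 ((τ : F) ^ n) ∈ H := by
    intro n
    induction n with
    | zero => have := hA 1; simpa [A, ι_one] using this
    | succ n ih =>
      have h1 := hcomm _ _ _ ih (hB 1) (m_ab _ _)
      rw [ι_one, mul_one] at h1
      have h2 := hcomm _ _ _ h1 hZ1 (m_step _ _)
      rwa [← pow_succ] at h2
  have hall : ∀ u : Fˣ, m12 (u : F) ∈ H := by
    intro u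
    have := hτ u
    rw [← mem_powers_iff_mem_zpowers] at this
    obtain ⟨n, rfl⟩ := this
    have := hpow n
    simpa using this
  letI : Fintype H := Fintype.ofFinite H
  have hcard : N < Fintype.card H := by
    have hinj : Function.Injective (fun u : Fˣ => (⟨m12 (u : F), hall u⟩ : H)) := by
      intro u v h
      have h1 := congrArg (fun w : H => (w : SpecialLinearGroup (Fin 3) F).1 0 1) h
      simp [m12] at h1
      exact Units.ext h1
    have h1 := Nat.card_le_card_of_injective _ hinj
    rw [Nat.card_units, hcF, Nat.card_eq_fintype_card] at h1
    have h2 : N + 1 < 17 ^ (N + 1) := Nat.lt_pow_self (by norm_num)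
    omega
  refine ⟨H, inferInstance, inferInstance, _, hcard, 
    spec_three H (p := 17) (by norm_num) (fun s => ⟨A s, hA s⟩) (fun s => ⟨B s, hB s⟩) (fun s => ⟨C s, hC s⟩)
      (fun s => ⟨_, hX s⟩) (fun s => ⟨_, hY s⟩) (fun s => ⟨_, hY' s⟩) (fun s => ⟨_, hZ s⟩) 
      ?_ ?_ ?_ ?_ ?_ ?_ ?_ ?_ ?_ ?_ ?_ ?_ ?_ ?_ ?_ ?_⟩
  · intro s t; apply Subtype.ext; simp only [A, ι_add, m12_add, Subgroup.coe_mul]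
  · intro s t; apply Subtype.ext; simp only [B, ι_add, m23_add, Subgroup.coe_mul]
  · intro s t; apply Subtype.ext; simp only [C, ι_add, add_mul, m31_add, Subgroup.coe_mul]
  · intro s t; apply Subtype.ext; simp only [ι_add, m13_add, Subgroup.coe_mul]
  · intro s t; apply Subtype.ext; simp only [ι_add, add_mul, m21_add, Subgroup.coe_mul]
  · intro s t; apply Subtype.ext; simp only [ι_add, add_mul, neg_add, m21_add, Subgroup.coe_mul]
  · intro s t; apply Subtype.ext; simp only [ι_add, add_mul, neg_add, m32_add, Subgroup.coe_mul]
  · intro s t; apply Subtype.ext; simp only [A, B, Subgroup.coe_mul, ι_mul]; exact m_ab _ _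
  · intro s t; apply Subtype.ext; simp only [C, B, Subgroup.coe_mul, ι_mul, mul_assoc (ι s)]
    rw [m_bc]
  · intro s t; apply Subtype.ext; simp only [C, B, Subgroup.coe_mul, ι_mul]
    rw [m_cb, mul_right_comm (ι s)]
  · intro s t; apply Subtype.ext; simp only [C, A, Subgroup.coe_mul, ι_mul, mul_assoc (ι s)]
    rw [m_ac]
  · intro s t; apply Subtype.ext; exact m_xa _ _
  · intro s t; apply Subtype.ext; exact m_yb _ _
  · intro s t; apply Subtype.ext; exact m_yc _ _
  · intro s t; apply Subtype.ext; exact m_za _ _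
  · apply Subgroup.map_injective H.subtype_injective
    rw [MonoidHom.map_closure, ← MonoidHom.range_eq_map, Subgroup.range_subtype, Set.image_union, Set.image_union, ← Set.range_comp, ← Set.range_comp, ← Set.range_comp]
    rfl

lemma spec_family (η : ℝ) (hη : 0 < η) (m : ℕ) (hm : 0 < m) :
    ∃ (I : Type) (_ : Fintype I) (_ : Nonempty I), m ∣ Fintype.card I ∧ 
      ∀ N : ℕ, ∃ (G : Type) (_ : Group G) (_ : Fintype G) (γ : I → G),
        N < Fintype.card G ∧ SpecBound G I γ η := by
  haveI : Fact (Nat.Prime 17) := ⟨by norm_num⟩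
  have key : ∀ n : ℕ, ∃ (I : Type) (_ : Fintype I) (_ : Nonempty I), m ∣ Fintype.card I ∧ 
      ∀ N : ℕ, ∃ (G : Type) (_ : Group G) (_ : Fintype G) (γ : I → G) (δ : Fin 3 × ZMod 17 → G),
        N < Fintype.card G ∧ SpecBound G I γ ((1 - 1/1587) ^ n) ∧ SpecBound G _ δ (1 - 1/1587) := by
    intro n
    induction n with
    | zero =>
      refine ⟨Fin m, inferInstance, ⟨⟨0, hm⟩⟩, by simp, ?_⟩
      intro N
      obtain ⟨G, _, _, δ, h1, h2⟩ := mat_group N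
      refine ⟨G, inferInstance, inferInstance, fun _ => 1, δ, h1, ?_, h2⟩
      intro h _
      have : (m:ℝ) ≠ 0 := by exact_mod_cast hm.ne'
      simp [this]
    | succ n ih =>
      obtain ⟨I, hI, hI', hd, h⟩ := ih
      refine ⟨I × (Fin 3 × ZMod 17), inferInstance, inferInstance, ?_, ?_⟩
      · rw [Fintype.card_prod]; exact hd.mul_right _
      · intro N
        obtain ⟨G, _, _, γ, δ, h1, h2, h3⟩ := h N
        refine ⟨G, inferInstance, inferInstance, fun q => γ q.1 * δ q.2, δ, h1, ?_, h3⟩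
        rw [pow_succ]
        exact SpecBound.mul (by positivity) h2 h3
  obtain ⟨n, hn⟩ := exists_pow_lt_of_lt_one hη (show (1 - 1/1587 : ℝ) < 1 by norm_num)
  obtain ⟨I, hI, hI', hd, h⟩ := key n
  refine ⟨I, hI, hI', hd, fun N => ?_⟩
  obtain ⟨G, _, _, γ, δ, h1, h2, h3⟩ := h N
  refine ⟨G, inferInstance, inferInstance, γ, h1, ?_⟩
  intro f hf
  refine (h2 f hf).trans ?_
  gcongr
end mat

section mix

lemma sum_two_coords {I : Type} [Fintype I] [Nonempty I] {k : ℕ} {i j : Fin k} (hij : i ≠ j) (u v : I → ℝ) :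
    ∑ w : Fin k → I, u (w i) * v (w j) =
      (Fintype.card I : ℝ) ^ k * (((Fintype.card I : ℝ)⁻¹ * ∑ x, u x) * ((Fintype.card I : ℝ)⁻¹ * ∑ x, v x)) := by
  classical
  have hn : (Fintype.card I : ℝ) ≠ 0 := by exact_mod_cast Fintype.card_ne_zero
  set n : ℝ := (Fintype.card I : ℝ) with hndef
  have h1 := Finset.prod_univ_sum (fun _ : Fin k => (univ : Finset I))
    (fun l x => (if l = i then u x else 1) * (if l = j then v x else 1))
  rw [Fintype.piFinset_univ] at h1
  have h2 : ∀ w : Fin k → I, ∏ l, ((if l = i then u (w l) else 1) * (if l = j then v (w l) else 1)) = u (w i) * v (w j) := by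
    intro w
    rw [Finset.prod_mul_distrib]
    simp
  simp only [h2] at h1
  rw [← h1]
  have h3 : ∀ l : Fin k, ∑ x : I, ((if l = i then u x else 1) * (if l = j then v x else 1)) =
      n * ((if l = i then n⁻¹ * ∑ x, u x else 1) * (if l = j then n⁻¹ * ∑ x, v x else 1)) := by
    intro l
    by_cases h : l = i
    · have : l ≠ j := fun h' => hij (h.symm.trans h')
      simp [h, hij]
      field_simp
    · by_cases h' : l = j
      · simp [h', hij.symm]
        field_simp
      · simp [h, h', hndef]
  rw [Finset.prod_congr rfl (fun l _ => h3 l), Finset.prod_mul_distrib, Finset.prod_mul_distrib]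
  simp

lemma spec_full {G I : Type} [Group G] [Fintype G] [Fintype I] [Nonempty I] {γ : I → G} {η : ℝ} (hη : 0 ≤ η)
    (hs : SpecBound G I γ η) (h : G → ℝ) :
    ∑ g, ((Fintype.card I : ℝ)⁻¹ * ∑ i, h (g * γ i)) ^ 2 ≤ (∑ g, h g) ^ 2 / Fintype.card G + η * ∑ g, h g ^ 2 := by
  have hn : (Fintype.card I : ℝ) ≠ 0 := by exact_mod_cast Fintype.card_ne_zero
  have hG : (Fintype.card G : ℝ) ≠ 0 := by exact_mod_cast Fintype.card_ne_zero
  have hG0 : (0:ℝ) < Fintype.card G := by exact_mod_cast Fintype.card_pos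
  set n : ℝ := (Fintype.card I : ℝ) with hndef
  set q : ℝ := (Fintype.card G : ℝ) with hqdef
  set μ : ℝ := (∑ g, h g) / q with hμ
  have hsum : ∑ g, h g = q * μ := by rw [hμ]; field_simp
  have h1 := hs (fun g => h g - μ) (by
    rw [Finset.sum_sub_distrib, hsum]; simp [hqdef])
  have e1 : ∀ g, n⁻¹ * ∑ i, (h (g * γ i) - μ) = n⁻¹ * ∑ i, h (g * γ i) - μ := by
    intro g
    rw [Finset.sum_sub_distrib, mul_sub]
    simp only [Finset.sum_const, Finset.card_univ, nsmul_eq_mul]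
    rw [← hndef]; field_simp
  simp only [← hndef, e1] at h1
  have hA : ∑ g, n⁻¹ * ∑ i, h (g * γ i) = q * μ := by
    rw [← Finset.mul_sum, Finset.sum_comm]
    have : ∀ i, ∑ g, h (g * γ i) = q * μ := fun i => by
      rw [← hsum]; exact Equiv.sum_comp (Equiv.mulRight (γ i)) h
    simp only [this, Finset.sum_const, Finset.card_univ, nsmul_eq_mul]
    rw [← hndef]; field_simp
  have e2 : ∀ a : G → ℝ, ∑ g, a g = q * μ → ∑ g, (a g - μ)^2 = ∑ g, a g ^ 2 - q * μ^2 := by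
    intro a ha
    simp only [sub_sq, Finset.sum_add_distrib, Finset.sum_sub_distrib]
    have : ∑ x, 2 * a x * μ = 2 * μ * (q * μ) := by
      rw [← ha, Finset.mul_sum]; exact Finset.sum_congr rfl (fun _ _ => by ring)
    rw [this]
    simp [← hqdef]; ring
  rw [e2 _ hA, e2 _ hsum] at h1
  have : (∑ g, h g) ^ 2 / q = q * μ^2 := by rw [hsum]; field_simp
  rw [this]
  have : 0 ≤ η * (q * μ^2) := by positivity
  linarith

lemma mixing {G I : Type} [Group G] [Fintype G] [Fintype I] [Nonempty I] {γ : I → G} {η : ℝ} (hη : 0 ≤ η)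
    (hs : SpecBound G I γ η) (k : ℕ) (h : Fin k → G → ℝ) (h01 : ∀ i g, h i g = 0 ∨ h i g = 1) :
    ∑ g, ∑ w : Fin k → I, ((∑ i, h i (g * γ (w i))) ^ 2 - ∑ i, h i (g * γ (w i))) ≤
      (Fintype.card I : ℝ) ^ k * ((∑ i, ∑ g, h i g) ^ 2 / Fintype.card G + η * (k * ∑ i, ∑ g, h i g)) := by
  classical
  set n : ℝ := (Fintype.card I : ℝ) with hndef
  have hsq : ∀ i g, h i g ^ 2 = h i g := fun i g => by rcases h01 i g with h | h <;> simp [h]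
  have hnn : ∀ i g, 0 ≤ h i g := fun i g => by rcases h01 i g with h | h <;> simp [h]
  let A : Fin k → G → ℝ := fun i g => n⁻¹ * ∑ x, h i (g * γ x)
  have hAnn : ∀ i g, 0 ≤ A i g := fun i g => mul_nonneg (by positivity) (Finset.sum_nonneg fun _ _ => hnn _ _)
  have step : ∀ g, ∑ w : Fin k → I, ((∑ i, h i (g * γ (w i))) ^ 2 - ∑ i, h i (g * γ (w i))) ≤ n ^ k * (∑ i, A i g)^2 := by
    intro g
    have e : ∀ w : Fin k → I, ((∑ i, h i (g * γ (w i))) ^ 2 - ∑ i, h i (g * γ (w i))) =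
        ∑ i, ∑ j ∈ univ.erase i, h i (g * γ (w i)) * h j (g * γ (w j)) := by
      intro w
      rw [sq, Finset.sum_mul_sum, ← Finset.sum_sub_distrib]
      refine Finset.sum_congr rfl fun i _ => ?_
      rw [← Finset.add_sum_erase _ _ (Finset.mem_univ i), ← sq, hsq]; ring
    simp only [e]
    rw [Finset.sum_comm]
    have e2 : ∀ i, ∑ w : Fin k → I, ∑ j ∈ univ.erase i, h i (g * γ (w i)) * h j (g * γ (w j)) = 
        ∑ j ∈ univ.erase i, n ^ k * (A i g * A j g) := by
      intro i
      rw [Finset.sum_comm]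
      refine Finset.sum_congr rfl fun j hj => ?_
      exact sum_two_coords (Finset.ne_of_mem_erase hj).symm (fun x => h i (g * γ x)) (fun x => h j (g * γ x))
    simp only [e2]
    rw [sq, Finset.sum_mul_sum, Finset.mul_sum]
    refine Finset.sum_le_sum fun i _ => ?_
    rw [← Finset.mul_sum]
    refine mul_le_mul_of_nonneg_left ?_ (by positivity)
    exact Finset.sum_le_sum_of_subset_of_nonneg (Finset.subset_univ _) (fun j _ _ => mul_nonneg (hAnn _ _) (hAnn _ _))
  refine (Finset.sum_le_sum fun g _ => step g).trans ?_
  rw [← Finset.mul_sum]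
  refine mul_le_mul_of_nonneg_left ?_ (by positivity)
  have hsp := spec_full hη hs (fun g => ∑ i, h i g)
  have e3 : ∀ g, ∑ i, A i g = (Fintype.card I : ℝ)⁻¹ * ∑ x, ∑ i, h i (g * γ x) := by
    intro g
    simp only [A]
    rw [← Finset.mul_sum, Finset.sum_comm]
  simp only [e3]
  refine hsp.trans ?_
  rw [Finset.sum_comm]
  gcongr
  rw [Finset.sum_comm, Finset.mul_sum]
  refine Finset.sum_le_sum fun g _ => ?_
  have := sq_sum_le_card_mul_sum_sq (s := univ) (f := fun i => h i g)
  simpa [hsq] using this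

end mix

section core

lemma fiber_sum {G I : Type} [Group G] [Fintype G] [Fintype I] [DecidableEq G] [DecidableEq I] (γ : I → G) (k : ℕ)
    (S : Finset (G × (Fin k → I))) (φ : G × Fin k → ℝ) :
    ∑ p : G × Fin k, ((univ.filter (fun w : Fin k → I => (p.1 * (γ (w p.2))⁻¹, w) ∈ S)).card : ℝ) * φ p =
      ∑ x ∈ S, ∑ i, φ (x.1 * γ (x.2 i), i) := by
  have e1 : ∀ p : G × Fin k, ((univ.filter (fun w : Fin k → I => (p.1 * (γ (w p.2))⁻¹, w) ∈ S)).card : ℝ) * φ p =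
      ∑ w : Fin k → I, if (p.1 * (γ (w p.2))⁻¹, w) ∈ S then φ p else 0 := by
    intro p
    rw [← Finset.sum_filter]; simp
  simp only [e1]
  rw [Fintype.sum_prod_type_right]
  have e2 : ∀ i : Fin k, ∑ g : G, ∑ w : Fin k → I, (if (g * (γ (w i))⁻¹, w) ∈ S then φ (g, i) else 0) =
      ∑ x ∈ S, φ (x.1 * γ (x.2 i), i) := by
    intro i
    rw [Finset.sum_comm]
    have e3 : ∀ w : Fin k → I, ∑ g : G, (if (g * (γ (w i))⁻¹, w) ∈ S then φ (g, i) else 0) =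
        ∑ g : G, (if (g, w) ∈ S then φ (g * γ (w i), i) else 0) := by
      intro w
      rw [← Equiv.sum_comp (Equiv.mulRight (γ (w i)))]
      simp
    simp only [e3]
    rw [Finset.sum_comm, ← Fintype.sum_prod_type' (f := fun g w => if (g, w) ∈ S then φ (g * γ (w i), i) else 0)]
    simp
  simp only [e2]
  rw [Finset.sum_comm]

set_option maxHeartbeats 1000000 in
lemma lossless_core {G I : Type} [Group G] [Fintype G] [Fintype I] [Nonempty I] [DecidableEq G] [DecidableEq I]
    {γ : I → G} {η ε c : ℝ} (hη : 0 ≤ η)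
    (hsp : SpecBound G I γ η) (k d m s : ℕ) (hk : 0 < k) (hm : 0 < m) (hs : 0 < s) (hc : 0 < c)
    (hcard : Fintype.card I ^ k = m * s) (f : Fin d → (Fin k → I) → Fin s)
    (hf : ∀ S : Finset (Fin k → I), (S.card : ℝ) ≤ c * s → (1 - ε) * d * S.card ≤ ∑ j, ((S.image (f j)).card : ℝ))
    (hηc : η * k ≤ c / (2 * m)) (hεk : 2 ≤ ε * k) (hε1 : ε ≤ 1)
    (S : Finset (G × (Fin k → I))) (hS : (S.card : ℝ) ≤ c ^ 2 / (2 * k * m ^ 2) * (m * s * Fintype.card G)) :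
    (1 - 2 * ε) * (k * d) * S.card ≤ ∑ p : G × Fin k, ∑ j,
      (((univ.filter (fun w : Fin k → I => (p.1 * (γ (w p.2))⁻¹, w) ∈ S)).image (f j)).card : ℝ) := by
  have hk' : (0:ℝ) < k := by exact_mod_cast hk
  have hm' : (0:ℝ) < m := by exact_mod_cast hm
  have hs' : (0:ℝ) < s := by exact_mod_cast hs
  have hG0 : (0:ℝ) < Fintype.card G := by exact_mod_cast Fintype.card_pos
  set q : ℝ := (Fintype.card G : ℝ) with hq
  let Sm : G × Fin k → Finset (Fin k → I) := fun p => univ.filter (fun w : Fin k → I => (p.1 * (γ (w p.2))⁻¹, w) ∈ S)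
  let φ : G × Fin k → ℝ := fun p => if c * s < ((Sm p).card : ℝ) then 1 else 0
  have hφ : ∀ p, φ p = 0 ∨ φ p = 1 := fun p => by
    simp only [φ]; split_ifs <;> simp
  have hφ0 : ∀ p, 0 ≤ φ p := fun p => by rcases hφ p with h | h <;> rw [h]; norm_num
  have hφ1 : ∀ p, φ p ≤ 1 := fun p => by rcases hφ p with h | h <;> rw [h]; norm_num
  have hφ2 : ∀ p, φ p * φ p = φ p := fun p => by rcases hφ p with h | h <;> simp [h]
  set e : ℝ := ∑ p, ((Sm p).card : ℝ) * φ p with he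
  have hE1 : e = ∑ x ∈ S, ∑ i, φ (x.1 * γ (x.2 i), i) := fiber_sum γ k S φ
  have hE2 : ∑ p, ((Sm p).card : ℝ) = k * S.card := by
    have := fiber_sum γ k S (fun _ => 1)
    simp only [mul_one] at this
    simp only [Sm]
    rw [this]; simp [mul_comm]
  have he0 : 0 ≤ e := Finset.sum_nonneg fun p _ => mul_nonneg (by positivity) (hφ0 p)
  have hek : e ≤ k * S.card := by
    rw [← hE2]
    exact Finset.sum_le_sum fun p _ => mul_le_of_le_one_right (by positivity) (hφ1 p)
  set hh : ℝ := ∑ i : Fin k, ∑ g : G, φ (g, i) with hhdef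
  have hh' : hh = ∑ p, φ p := by rw [Fintype.sum_prod_type_right]
  have hh0 : 0 ≤ hh := by rw [hh']; exact Finset.sum_nonneg fun p _ => hφ0 p
  have hhe : hh * (c * s) ≤ e := by
    rw [hh', Finset.sum_mul]
    refine Finset.sum_le_sum fun p _ => ?_
    simp only [φ]
    split_ifs with h
    · linarith
    · simp
  have hmix := mixing hη hsp k (fun i g => φ (g, i)) (fun i g => hφ _)
  have hN : (Fintype.card I : ℝ) ^ k = m * s := by exact_mod_cast hcard
  rw [hN, ← hq, ← hhdef] at hmix
  have hpos : ∀ (g : G) (w : Fin k → I), 0 ≤ (∑ i, φ (g * γ (w i), i)) ^ 2 - ∑ i, φ (g * γ (w i), i) := by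
    intro g w
    rw [sq, Finset.sum_mul, ← Finset.sum_sub_distrib]
    refine Finset.sum_nonneg fun i _ => ?_
    have h1 : φ (g * γ (w i), i) ≤ ∑ i, φ (g * γ (w i), i) :=
      Finset.single_le_sum (f := fun i => φ (g * γ (w i), i)) (fun _ _ => hφ0 _) (Finset.mem_univ i)
    nlinarith [hφ0 (g * γ (w i), i), hφ2 (g * γ (w i), i), mul_le_mul_of_nonneg_left h1 (hφ0 (g * γ (w i), i))]
  have hSle : ∑ x ∈ S, ((∑ i, φ (x.1 * γ (x.2 i), i)) ^ 2 - ∑ i, φ (x.1 * γ (x.2 i), i)) ≤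
      m * s * (hh ^ 2 / q + η * (k * hh)) := by
    refine le_trans ?_ hmix
    rw [← Fintype.sum_prod_type' (f := fun (g : G) (w : Fin k → I) => (∑ i, φ (g * γ (w i), i)) ^ 2 - ∑ i, φ (g * γ (w i), i))]
    exact Finset.sum_le_sum_of_subset_of_nonneg (Finset.subset_univ _) (fun x _ _ => hpos _ _)
  have hHq : hh ≤ c * q / (2 * m) := by
    have h1 : hh * (c * s) ≤ k * (c ^ 2 / (2 * k * m ^ 2) * (m * s * q)) :=
      (hhe.trans hek).trans (mul_le_mul_of_nonneg_left hS hk'.le)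
    have h2 : k * (c ^ 2 / (2 * k * m ^ 2) * (m * s * q)) = c * q / (2 * m) * (c * s) := by
      field_simp
    rw [h2] at h1
    exact le_of_mul_le_mul_right h1 (by positivity)
  have hQ : m * s * (hh ^ 2 / q + η * (k * hh)) ≤ e := by
    have h1 : hh ^ 2 / q ≤ c / (2 * m) * hh := by
      rw [div_le_iff₀ hG0, sq]
      calc hh * hh ≤ c * q / (2 * m) * hh := mul_le_mul_of_nonneg_right hHq hh0
        _ = _ := by ring
    have h2 : η * (k * hh) ≤ c / (2 * m) * hh := by
      rw [← mul_assoc]; exact mul_le_mul_of_nonneg_right hηc hh0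
    calc m * s * (hh ^ 2 / q + η * (k * hh)) ≤ m * s * (c / (2 * m) * hh + c / (2 * m) * hh) := by gcongr
      _ = hh * (c * s) := by field_simp; ring
      _ ≤ e := hhe
  have hsq : e ^ 2 ≤ S.card * (2 * e) := by
    have h1 := sq_sum_le_card_mul_sum_sq (s := S) (f := fun x => ∑ i, φ (x.1 * γ (x.2 i), i))
    rw [← hE1] at h1
    refine h1.trans (mul_le_mul_of_nonneg_left ?_ (by positivity))
    rw [Finset.sum_sub_distrib, ← hE1] at hSle
    linarith
  have he2 : e ≤ 2 * S.card := by
    rcases he0.eq_or_lt with h | h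
    · have h0 : (0:ℝ) ≤ 2 * (S.card : ℝ) := mul_nonneg zero_le_two (Nat.cast_nonneg _)
      linarith
    · nlinarith
  have hfin : ∀ p, (1 - ε) * d * ((Sm p).card * (1 - φ p)) ≤ ∑ j, (((Sm p).image (f j)).card : ℝ) := by
    intro p
    by_cases h : c * s < ((Sm p).card : ℝ)
    · have : φ p = 1 := if_pos h
      rw [this]; simp only [sub_self, mul_zero]; exact Finset.sum_nonneg fun _ _ => Nat.cast_nonneg _
    · have : φ p = 0 := if_neg h
      rw [this, sub_zero, mul_one]
      exact hf _ (not_lt.mp h)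
  refine le_trans ?_ (Finset.sum_le_sum fun p _ => hfin p)
  rw [← Finset.mul_sum]
  have : ∑ p, ((Sm p).card : ℝ) * (1 - φ p) = k * S.card - e := by
    rw [he, ← hE2, ← Finset.sum_sub_distrib]
    exact Finset.sum_congr rfl fun _ _ => by ring
  rw [this]
  have h1 : (1 - ε) * k * S.card ≤ k * S.card - e := by
    have : 2 * (S.card:ℝ) ≤ ε * k * S.card := mul_le_mul_of_nonneg_right hεk (by positivity)
    linarith
  calc (1 - 2 * ε) * (k * d) * S.card ≤ (1 - ε) * (1 - ε) * (k * d) * S.card := by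
        gcongr; nlinarith [sq_nonneg ε]
    _ = (1 - ε) * d * ((1 - ε) * k * S.card) := by ring
    _ ≤ _ := mul_le_mul_of_nonneg_left h1 (mul_nonneg (by linarith) (by positivity))

end core

section final

def crvwEdge {G I : Type} [Group G] {k d s : ℕ} (γ : I → G) (f : Fin d → (Fin k → I) → Fin s) :
    Set ((G × (Fin k → I)) × (G × Fin k × Fin d × Fin s)) :=
  {e | e.2.1 = e.1.1 * γ (e.1.2 e.2.2.1) ∧ f e.2.2.2.1 e.1.2 = e.2.2.2.2}

def crvwAct (G X : Type) [Group G] : G →* Equiv.Perm (G × X) where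
  toFun g := (Equiv.mulLeft g).prodCongr (Equiv.refl X)
  map_one' := by ext x <;> simp
  map_mul' := by intro a b; ext x <;> simp [mul_assoc]

lemma crvwAct_apply (G X : Type) [Group G] (g : G) (x : G × X) : crvwAct G X g x = (g * x.1, x.2) := rfl

lemma crvw_left {G I : Type} [Group G] {k d s : ℕ} (γ : I → G) (f : Fin d → (Fin k → I) → Fin s) :
    LeftRegular (crvwEdge γ f) (k * d) := by
  rintro ⟨g, w⟩
  have e : Fin k × Fin d ≃ {x₁ | ((g, w), x₁) ∈ crvwEdge γ f} :=
    { toFun := fun p => ⟨(g * γ (w p.1), p.1, p.2, f p.2 w), ⟨rfl, rfl⟩⟩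
      invFun := fun y => (y.1.2.1, y.1.2.2.1)
      left_inv := fun p => rfl
      right_inv := by
        rintro ⟨⟨h, i, j, b⟩, h1, h2⟩
        apply Subtype.ext
        simp only at h1 h2
        simp [h1, h2] }
  rw [← Nat.card_congr e]
  simp

lemma crvw_right {G I : Type} [Group G] [Fintype I] {k d s m : ℕ} (γ : I → G) (f : Fin d → (Fin k → I) → Fin s)
    [DecidableEq I]
    (hf : ∀ j b, (univ.filter (fun x => f j x = b)).card = m) :
    RightRegular (crvwEdge γ f) m := by
  rintro ⟨h, i, j, b⟩
  have e : {w // f j w = b} ≃ {x₀ | (x₀, (h, i, j, b)) ∈ crvwEdge γ f} :=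
    { toFun := fun w => ⟨(h * (γ (w.1 i))⁻¹, w.1), ⟨by simp, w.2⟩⟩
      invFun := fun y => ⟨y.1.2, y.2.2⟩
      left_inv := fun p => rfl
      right_inv := by
        rintro ⟨⟨g, w⟩, h1, h2⟩
        apply Subtype.ext
        simp only at h1 h2
        simp [h1] }
  rw [← Nat.card_congr e, Nat.card_eq_fintype_card, Fintype.card_subtype]
  exact hf j b

lemma crvw_nbhd {G I : Type} [Group G] [Fintype G] [Fintype I] [DecidableEq G] [DecidableEq I] {k d s : ℕ} (γ : I → G)
    (f : Fin d → (Fin k → I) → Fin s) (S : Finset (G × (Fin k → I))) :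
    (Nat.card (Nbhd (crvwEdge γ f) (S : Set (G × (Fin k → I)))) : ℝ) = ∑ p : G × Fin k, ∑ j,
      (((univ.filter (fun w : Fin k → I => (p.1 * (γ (w p.2))⁻¹, w) ∈ S)).image (f j)).card : ℝ) := by
  have h1 : Nbhd (crvwEdge γ f) (S : Set (G × (Fin k → I))) =
      ((univ.filter (fun y : G × Fin k × Fin d × Fin s => y.2.2.2 ∈
        ((univ.filter (fun w : Fin k → I => (y.1 * (γ (w y.2.1))⁻¹, w) ∈ S)).image (f y.2.2.1))) : Finset _) :
        Set (G × Fin k × Fin d × Fin s)) := by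
    ext ⟨h, i, j, b⟩
    simp only [Nbhd, crvwEdge, Set.mem_setOf_eq, Finset.coe_filter, Finset.mem_univ, true_and, Finset.mem_image,
      Finset.mem_filter, Finset.mem_coe]
    constructor
    · rintro ⟨⟨g, w⟩, hS, h1, h2⟩
      exact ⟨w, by simpa [h1] using hS, h2⟩
    · rintro ⟨w, hw, hb⟩
      exact ⟨_, hw, by simp, hb⟩
  rw [h1, Nat.card_eq_card_toFinset, Finset.toFinset_coe, Finset.card_filter]
  push_cast
  rw [Fintype.sum_prod_type, Fintype.sum_prod_type]
  refine Finset.sum_congr rfl fun h _ => ?_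
  rw [Fintype.sum_prod_type]
  refine Finset.sum_congr rfl fun i _ => ?_
  rw [Fintype.sum_prod_type]
  refine Finset.sum_congr rfl fun j _ => ?_
  simp only [Finset.sum_boole, Finset.filter_univ_mem]

end final

end helpers

/-- the Capalbo–Reingold–Vadhan–Wigderson 1-sided lossless expanders
with free group symmetry, as restated in the paper. -/
theorem CRVW_lossless_expanders (ε₀ : ℝ) (hε₀ : 0 < ε₀) (T : ℕ) (hT : 0 < T) :
    ∃ (D : ℕ) (C γ : ℝ), 0 < D ∧ 1 ≤ C ∧ 0 < γ ∧
      ∀ N : ℕ,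
        ∃ (V₀ V₁ : Type) (_ : Finite V₀) (_ : Finite V₁) (E : Set (V₀ × V₁))
          (G : Type) (_ : Group G) (_ : Finite G)
          (σ₀ : G →* Equiv.Perm V₀) (σ₁ : G →* Equiv.Perm V₁),
          -- (D, D·T)-regular
          LeftRegular E D ∧ RightRegular E (D * T) ∧
          N < Nat.card V₀ ∧
          -- free edge-preserving action
          (∀ (g : G) (x₀ : V₀) (x₁ : V₁), (x₀, x₁) ∈ E → (σ₀ g x₀, σ₁ g x₁) ∈ E) ∧
          (∀ (g : G) (x : V₀), σ₀ g x = x → g = 1) ∧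
          (∀ (g : G) (x : V₁), σ₁ g x = x → g = 1) ∧
          (Nat.card V₀ : ℝ) ≤ C * Nat.card G ∧
          -- 1-sided (γ·ε₀/T, ε₀)-lossless expander
          IsLossless E D (γ * ε₀ / T) ε₀ := by
  classical
  have hT' : (0:ℝ) < T := by exact_mod_cast hT
  obtain ⟨ε, hε, hε1, hεε⟩ : ∃ ε : ℝ, 0 < ε ∧ ε ≤ 1 ∧ 2 * ε ≤ ε₀ :=
    ⟨min ε₀ 1 / 2, by positivity, by linarith [min_le_right ε₀ 1], by linarith [min_le_left ε₀ 1]⟩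
  obtain ⟨k, hk2⟩ := exists_nat_ge (2 / ε)
  rw [div_le_iff₀' hε] at hk2
  have hk' : (0:ℝ) < k := by
    by_contra h
    nlinarith [not_lt.mp h]
  have hk : 0 < k := by exact_mod_cast hk'
  have hm : 0 < k * k * T := by positivity
  obtain ⟨m, hmdef⟩ : ∃ m, m = k * k * T := ⟨_, rfl⟩
  rw [← hmdef] at hm
  have hm' : (0:ℝ) < m := by exact_mod_cast hm
  obtain ⟨c, hcdef⟩ : ∃ c : ℝ, c = 1 / (12 * m * 6 ^ k) := ⟨_, rfl⟩
  have hc : 0 < c := by rw [hcdef]; positivity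
  obtain ⟨I, _, _, hdvd, hfam⟩ := spec_family (c / (2 * m * k)) (by positivity) m hm
  obtain ⟨s, hs⟩ : m ∣ Fintype.card I ^ k := hdvd.trans (dvd_pow_self _ hk.ne')
  have hI : 0 < Fintype.card I ^ k := pow_pos Fintype.card_pos _
  have hs0 : 0 < s := by
    rcases Nat.eq_zero_or_pos s with h | h
    · rw [hs, h] at hI; simp at hI
    · exact h
  obtain ⟨f, hf1, hf2⟩ := gad_exists ε hε k m hk2 hm s hs0 (X := Fin k → I) (by simpa using hs)
  rw [← hcdef] at hf2
  refine ⟨k * k, (Fintype.card I ^ k : ℕ), c ^ 2 / (2 * k * m ^ 2) * T / ε₀, by positivity, by exact_mod_cast hI, 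
    by positivity, ?_⟩
  intro N
  obtain ⟨G, _, _, γ, hG, hsp⟩ := hfam N
  have hV : Nat.card (G × (Fin k → I)) = Fintype.card G * Fintype.card I ^ k := by
    rw [Nat.card_eq_fintype_card]; simp
  refine ⟨G × (Fin k → I), G × Fin k × Fin k × Fin s, inferInstance, inferInstance, crvwEdge γ f, G, inferInstance,
    inferInstance, crvwAct G _, crvwAct G _, crvw_left γ f, ?_, ?_, ?_, ?_, ?_, ?_, ?_⟩
  · rw [← hmdef]; exact crvw_right γ f hf1
  · rw [hV]; exact hG.trans_le (Nat.le_mul_of_pos_right _ hI)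
  · rintro g ⟨a, w⟩ ⟨h, i, j, b⟩ ⟨h1, h2⟩
    refine ⟨?_, h2⟩
    simp only at h1
    simp [crvwAct_apply, h1, mul_assoc]
  · intro g x h
    have := congrArg Prod.fst h
    simpa [crvwAct_apply] using this
  · intro g x h
    have := congrArg Prod.fst h
    simpa [crvwAct_apply] using this
  · rw [hV, Nat.card_eq_fintype_card, mul_comm]; push_cast; exact le_rfl
  · intro S hS
    obtain ⟨S', rfl⟩ : ∃ S' : Finset (G × (Fin k → I)), S = (S' : Set (G × (Fin k → I))) :=
      ⟨S.toFinset, by simp⟩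
    rw [crvw_nbhd]
    rw [hV, hs] at hS
    have hc1 : Nat.card ((S' : Set (G × (Fin k → I)))) = S'.card := by simp
    rw [hc1] at hS ⊢
    have hcore := lossless_core (ε := ε) (c := c) (by positivity) hsp k k m s hk hm hs0 hc hs f hf2
      (le_of_eq (by field_simp)) hk2 hε1 S' (by
        refine hS.le.trans (le_of_eq ?_)
        push_cast
        field_simp)
    refine le_trans ?_ hcore
    push_cast
    gcongr
end

section
/- Let G be a finite group, let X = (V₀*, V₁*, E↕) be a finite bipartite graph with a free edge-preserving G-action, and let W be a finite type with a free G-action. Let Ω = W/G be the orbit space, let V₀₀ = (V₀* × W)/G and V₁₀ = (V₁* × W)/G be the quotients by the diagonal G-actions, with [·] denoting equivalence classes, and let E_{*0} = {([x₀,y], [x₁,y]) : (x₀,x₁) ∈ E↕, y ∈ W} ⊆ V₀₀ × V₁₀. Then there exist bijections e₀ : V₀₀ ≃ V₀* × Ω and e₁ : V₁₀ ≃ V₁* × Ω such that for all u ∈ V₀₀ and v ∈ V₁₀, (u, v) ∈ E_{*0} if and only if the Ω-components of e₀(u) and e₁(v) are equal and the pair of their first components lies in E↕; in other words, the bipartite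 graph (V₀₀, V₁₀, E_{*0}) is isomorphic to |W/G| disjoint copies of X. -/
theorem bp_aux (G V W : Type) [Group G] [MulAction G V] [MulAction G W] (c : W → G)
    (hc : ∀ y, c y • y = (Quotient.mk (MulAction.orbitRel G W) y).out)
    (hc2 : ∀ (g : G) y, c (g • y) = c y * g⁻¹) :
    ∃ e : Quotient (MulAction.orbitRel G (V × W)) ≃ V × Quotient (MulAction.orbitRel G W),
      (∀ x y, e (Quotient.mk _ (x, y)) = (c y • x, Quotient.mk _ y)) ∧
      (∀ u, u = Quotient.mk _ ((e u).1, (e u).2.out)) := by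
  have hmk : ∀ (g : G) (y : W), Quotient.mk (MulAction.orbitRel G W) (g • y) =
      Quotient.mk (MulAction.orbitRel G W) y := fun g y => Quotient.sound ⟨g, rfl⟩
  let f : Quotient (MulAction.orbitRel G (V × W)) → V × Quotient (MulAction.orbitRel G W) :=
    Quotient.lift (fun p => (c p.2 • p.1, Quotient.mk _ p.2)) (by
      rintro _ ⟨x, y⟩ ⟨g, rfl⟩
      simp [hc2, hmk, mul_smul])
  have hf : ∀ u, u = Quotient.mk _ ((f u).1, (f u).2.out) := by
    intro u
    induction u using Quotient.inductionOn with
    | _ p =>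
      obtain ⟨x, y⟩ := p
      refine (Quotient.sound ?_ : _)
      refine ⟨(c y)⁻¹, ?_⟩
      change ((c y)⁻¹ • (c y • x), (c y)⁻¹ • (Quotient.mk (MulAction.orbitRel G W) y).out) = _
      rw [← hc]
      simp
  have hbij : Function.Bijective f := by
    constructor
    · intro u v h
      rw [hf u, hf v, h]
    · rintro ⟨x, w⟩
      induction w using Quotient.inductionOn with
      | _ y =>
        refine ⟨Quotient.mk _ ((c y)⁻¹ • x, y), ?_⟩
        change (c y • (c y)⁻¹ • x, _) = _
        simp
  exact ⟨Equiv.ofBijective f hbij, fun x y => rfl, hf⟩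

/-- the one-dimensional subgraph `(V₀₀, V₁₀, E_{*0})` of a balanced
product is isomorphic to `|W/G|` disjoint copies of `X = (V₀, V₁, E)`. -/
theorem balanced_product_1d_subgraph_copies
    (G : Type) [Group G] [Finite G]
    (V₀ V₁ W : Type) [Finite V₀] [Finite V₁] [Finite W]
    [MulAction G V₀] [MulAction G V₁] [MulAction G W]
    (E : Set (V₀ × V₁))
    (hpres : ∀ (g : G) (x₀ : V₀) (x₁ : V₁), (x₀, x₁) ∈ E → (g • x₀, g • x₁) ∈ E)
    (hfree₀ : ∀ (g : G) (x : V₀), g • x = x → g = 1)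
    (hfree₁ : ∀ (g : G) (x : V₁), g • x = x → g = 1)
    (hfreeW : ∀ (g : G) (y : W), g • y = y → g = 1) :
    ∃ (e₀ : Quotient (MulAction.orbitRel G (V₀ × W)) ≃ V₀ × Quotient (MulAction.orbitRel G W))
      (e₁ : Quotient (MulAction.orbitRel G (V₁ × W)) ≃ V₁ × Quotient (MulAction.orbitRel G W)),
      ∀ (u : Quotient (MulAction.orbitRel G (V₀ × W)))
        (v : Quotient (MulAction.orbitRel G (V₁ × W))),
        ((u, v) ∈ {p : Quotient (MulAction.orbitRel G (V₀ × W)) ×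
                       Quotient (MulAction.orbitRel G (V₁ × W)) |
            ∃ (x₀ : V₀) (x₁ : V₁) (y : W), (x₀, x₁) ∈ E ∧
              p = (Quotient.mk (MulAction.orbitRel G (V₀ × W)) (x₀, y),
                   Quotient.mk (MulAction.orbitRel G (V₁ × W)) (x₁, y))}) ↔
        ((e₀ u).2 = (e₁ v).2 ∧ ((e₀ u).1, (e₁ v).1) ∈ E) := by
  have hex : ∀ y : W, ∃ g : G, g • y = (Quotient.mk (MulAction.orbitRel G W) y).out := by
    intro y
    exact Quotient.exact (Quotient.out_eq (Quotient.mk (MulAction.orbitRel G W) y))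
  choose c hc using hex
  have hc2 : ∀ (g : G) y, c (g • y) = c y * g⁻¹ := by
    intro g y
    have h1 := hc (g • y)
    have h3 : Quotient.mk (MulAction.orbitRel G W) (g • y) =
      Quotient.mk (MulAction.orbitRel G W) y := Quotient.sound ⟨g, rfl⟩
    rw [h3, ← hc y, ← mul_smul] at h1
    have h2 := hfreeW ((c y)⁻¹ * (c (g • y) * g)) y (by rw [mul_smul, h1, inv_smul_smul])
    rw [inv_mul_eq_one] at h2
    rw [h2, mul_inv_cancel_right]
  obtain ⟨e₀, h₀, h₀'⟩ := bp_aux G V₀ W c hc hc2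
  obtain ⟨e₁, h₁, h₁'⟩ := bp_aux G V₁ W c hc hc2
  refine ⟨e₀, e₁, fun u v => ⟨?_, ?_⟩⟩
  · rintro ⟨x₀, x₁, y, hE, hp⟩
    obtain ⟨rfl, rfl⟩ := Prod.mk.inj hp
    rw [h₀, h₁]
    exact ⟨rfl, hpres _ _ _ hE⟩
  · rintro ⟨h, hE⟩
    refine ⟨_, _, (e₀ u).2.out, hE, ?_⟩
    refine Prod.ext (h₀' u) ?_
    rw [h]
    exact h₁' v
end

section
/- Let G be a finite group, let X = (V₀*, V₁*, E↕) be a (w↓, w↑)-regular finite bipartite graph with a free edge-preserving G-action which is a 1-sided (c↓, ε↓)-lossless expander, and let W be a finite type with a free G-action. Form V₀₀ = (V₀* × W)/G, V₁₀ = (V₁* × W)/G (quotients by the diagonal G-action, with [·] denoting classes) and E_{*0} = {([x₀,y], [x₁,y]) : (x₀,x₁) ∈ E↕, y ∈ W} ⊆ V₀₀ × V₁₀. Then the bipartite graph (V₀₀, V₁₀, E_{*0}) is (w↓, w↑)-regular and every S ⊆ V₀₀ with |S| < c↓·|V₀*| satisfies |N(S)| ≥ (1−ε↓)·w↓·|S|;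 that is, (V₀₀, V₁₀, E_{*0}) is a 1-sided (c↓·|V₀*|/|V₀₀|, ε↓)-lossless expander. -/
noncomputable def bpMap (G V W : Type) [Group G] [MulAction G V] [MulAction G W]
    (p : V × Quotient (MulAction.orbitRel G W)) : Quotient (MulAction.orbitRel G (V × W)) :=
  Quotient.mk (MulAction.orbitRel G (V × W)) (p.1, Quotient.out p.2)

theorem bp_mk_eq {G A : Type} [Group G] [MulAction G A] (a b : A) :
    Quotient.mk (MulAction.orbitRel G A) a = Quotient.mk (MulAction.orbitRel G A) b ↔
      ∃ g : G, g • b = a := by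
  rw [Quotient.eq, MulAction.orbitRel_apply, MulAction.mem_orbit_iff]

theorem bp_out_eq {G W : Type} [Group G] [MulAction G W]
    (o o' : Quotient (MulAction.orbitRel G W)) (g : G) (h : g • Quotient.out o' = Quotient.out o) :
    o = o' := by
  rw [← Quotient.out_eq o, ← Quotient.out_eq o']
  exact (bp_mk_eq _ _).2 ⟨g, h⟩

theorem bp_cancel {G W : Type} [Group G] [MulAction G W]
    (hfreeW : ∀ (g : G) (y : W), g • y = y → g = 1) (g h : G) (y : W) (e : g • y = h • y) :
    g = h := by
  have : (h⁻¹ * g) • y = y := by rw [mul_smul, e, inv_smul_smul]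
  have := hfreeW _ _ this
  exact (inv_mul_eq_one.1 this).symm

theorem bpMap_bij (G V W : Type) [Group G] [MulAction G V] [MulAction G W]
    (hfreeW : ∀ (g : G) (y : W), g • y = y → g = 1) : Function.Bijective (bpMap G V W) := by
  constructor
  · rintro ⟨x, o⟩ ⟨x', o'⟩ h
    obtain ⟨g, hg⟩ := (bp_mk_eq _ _).1 h
    simp only [Prod.smul_mk, Prod.mk.injEq] at hg
    obtain ⟨h1, h2⟩ := hg
    have := bp_out_eq _ _ g h2
    subst this
    have := hfreeW _ _ h2
    subst this
    simp at h1
    simp [h1]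
  · intro q
    induction q using Quotient.inductionOn with
    | h p =>
    obtain ⟨x, y⟩ := p
    obtain ⟨g, hg⟩ := (bp_mk_eq (G := G) _ _).1
      (Quotient.out_eq (Quotient.mk (MulAction.orbitRel G W) y))
    refine ⟨(g • x, Quotient.mk _ y), (bp_mk_eq _ _).2 ⟨g, ?_⟩⟩
    simp only [Prod.smul_mk, hg]

theorem bp_edge {G V₀ V₁ W : Type} [Group G] [MulAction G V₀] [MulAction G V₁] [MulAction G W]
    (E : Set (V₀ × V₁))
    (hpres : ∀ (g : G) (x₀ : V₀) (x₁ : V₁), (x₀, x₁) ∈ E → (g • x₀, g • x₁) ∈ E)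
    (hfreeW : ∀ (g : G) (y : W), g • y = y → g = 1)
    (p : V₀ × Quotient (MulAction.orbitRel G W)) (q : V₁ × Quotient (MulAction.orbitRel G W)) :
    (∃ (x₀ : V₀) (x₁ : V₁) (y : W), (x₀, x₁) ∈ E ∧
          (bpMap G V₀ W p, bpMap G V₁ W q) =
            (Quotient.mk (MulAction.orbitRel G (V₀ × W)) (x₀, y),
               Quotient.mk (MulAction.orbitRel G (V₁ × W)) (x₁, y))) ↔
      p.2 = q.2 ∧ (p.1, q.1) ∈ E := by
  obtain ⟨x, o⟩ := p
  obtain ⟨x', o'⟩ := q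
  constructor
  · rintro ⟨a, b, y, hab, h⟩
    obtain ⟨h1, h2⟩ := Prod.mk.inj h
    obtain ⟨g, hg⟩ := (bp_mk_eq _ _).1 h1
    obtain ⟨k, hk⟩ := (bp_mk_eq _ _).1 h2
    simp only [Prod.smul_mk, Prod.mk.injEq] at hg hk
    have ho : o = o' := by
      apply bp_out_eq o o' (g * k⁻¹)
      rw [← hk.2, mul_smul, inv_smul_smul, hg.2]
    subst ho
    have : g = k := bp_cancel hfreeW _ _ y (hg.2.trans hk.2.symm)
    subst this
    refine ⟨rfl, ?_⟩
    show (x, x') ∈ E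
    rw [← hg.1, ← hk.1]
    exact hpres _ _ _ hab
  · rintro ⟨h1, h2⟩
    simp only at h1 h2
    subst h1
    exact ⟨x, x', _, h2, rfl⟩

theorem bp_card {V Ω Q : Type} [Finite V] [Fintype Ω] (e : V × Ω → Q)
    (he : Function.Bijective e) (T : Set Q) :
    Nat.card T = ∑ o : Ω, Nat.card {x : V | e (x, o) ∈ T} := by
  rw [← Nat.card_sigma]
  refine (Nat.card_congr (Equiv.ofBijective
    (fun s : (Σ o : Ω, {x : V | e (x, o) ∈ T}) => (⟨e (s.2.1, s.1), s.2.2⟩ : T)) ⟨?_, ?_⟩)).symm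
  · rintro ⟨o, x, hx⟩ ⟨o', x', hx'⟩ h
    have := he.1 (Subtype.mk.inj h)
    simp only [Prod.mk.injEq] at this
    obtain ⟨rfl, rfl⟩ := this
    rfl
  · rintro ⟨q, hq⟩
    obtain ⟨⟨x, o⟩, rfl⟩ := he.2 q
    exact ⟨⟨o, x, hq⟩, rfl⟩

theorem bp_abstract {V₀ V₁ Ω Q₀ Q₁ : Type} [Finite V₀] [Finite V₁] [Finite Ω]
    (E : Set (V₀ × V₁)) (E' : Set (Q₀ × Q₁)) (e₀ : V₀ × Ω → Q₀) (e₁ : V₁ × Ω → Q₁)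
    (h₀ : Function.Bijective e₀) (h₁ : Function.Bijective e₁)
    (hE : ∀ p q, (e₀ p, e₁ q) ∈ E' ↔ p.2 = q.2 ∧ (p.1, q.1) ∈ E)
    (wd wu : ℕ) (hreg₀ : LeftRegular E wd) (hreg₁ : RightRegular E wu)
    (c εd : ℝ)
    (hlossless : ∀ S : Set V₀, (Nat.card S : ℝ) < c →
      (1 - εd) * (wd : ℝ) * (Nat.card S : ℝ) ≤ (Nat.card (Nbhd E S) : ℝ)) :
    LeftRegular E' wd ∧ RightRegular E' wu ∧ ∀ S : Set Q₀, (Nat.card S : ℝ) < c →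
      (1 - εd) * (wd : ℝ) * (Nat.card S : ℝ) ≤ (Nat.card (Nbhd E' S) : ℝ) := by
  have := Fintype.ofFinite Ω
  refine ⟨?_, ?_, ?_⟩
  · intro q
    obtain ⟨⟨x, o⟩, rfl⟩ := h₀.2 q
    rw [← hreg₀ x, ← Nat.card_image_of_injective (f := fun x' => e₁ (x', o))
      (fun a b h => (Prod.mk.inj (h₁.1 h)).1)]
    congr 2
    ext r
    obtain ⟨⟨x', o'⟩, rfl⟩ := h₁.2 r
    simp only [Set.mem_setOf_eq, hE, Set.mem_image, h₁.1.eq_iff, Prod.mk.injEq]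
    constructor
    · rintro ⟨rfl, h⟩
      exact ⟨x', h, rfl, rfl⟩
    · rintro ⟨_, h, rfl, rfl⟩
      exact ⟨rfl, h⟩
  · intro q
    obtain ⟨⟨x, o⟩, rfl⟩ := h₁.2 q
    rw [← hreg₁ x, ← Nat.card_image_of_injective (f := fun x' => e₀ (x', o))
      (fun a b h => (Prod.mk.inj (h₀.1 h)).1)]
    congr 2
    ext r
    obtain ⟨⟨x', o'⟩, rfl⟩ := h₀.2 r
    simp only [Set.mem_setOf_eq, hE, Set.mem_image, h₀.1.eq_iff, Prod.mk.injEq]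
    constructor
    · rintro ⟨rfl, h⟩
      exact ⟨x', h, rfl, rfl⟩
    · rintro ⟨_, h, rfl, rfl⟩
      exact ⟨rfl, h⟩
  · intro S hS
    have hN : ∀ o : Ω, {x : V₁ | e₁ (x, o) ∈ Nbhd E' S} = Nbhd E {x : V₀ | e₀ (x, o) ∈ S} := by
      intro o
      ext x
      simp only [Nbhd, Set.mem_setOf_eq]
      constructor
      · rintro ⟨q, hq, h⟩
        obtain ⟨⟨x', o'⟩, rfl⟩ := h₀.2 q
        obtain ⟨h1, h2⟩ := (hE _ _).1 h
        simp only at h1 h2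
        subst h1
        exact ⟨x', hq, h2⟩
      · rintro ⟨x', hq, h⟩
        exact ⟨_, hq, (hE _ _).2 ⟨rfl, h⟩⟩
    have hc := bp_card e₀ h₀ S
    rw [bp_card e₁ h₁ (Nbhd E' S), hc]
    push_cast
    rw [Finset.mul_sum]
    refine Finset.sum_le_sum fun o _ => ?_
    rw [hN o]
    apply hlossless
    refine lt_of_le_of_lt ?_ hS
    rw [hc]
    exact_mod_cast Finset.single_le_sum
      (f := fun o : Ω => Nat.card {x : V₀ | e₀ (x, o) ∈ S})
      (fun _ _ => Nat.zero_le _) (Finset.mem_univ o)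

/-- the one-dimensional subgraph `(V₀₀, V₁₀, E_{*0})` of a balanced
product of a `(w↓, w↑)`-regular 1-sided `(c↓, ε↓)`-lossless expander with a free
`G`-set `W` is `(w↓, w↑)`-regular, and every `S ⊆ V₀₀` with `|S| < c↓·|V₀|`
satisfies `|N(S)| ≥ (1 − ε↓)·w↓·|S|`. -/
theorem balanced_product_1d_subgraph_lossless
    (G : Type) [Group G] [Finite G]
    (V₀ V₁ W : Type) [Finite V₀] [Finite V₁] [Finite W]
    [MulAction G V₀] [MulAction G V₁] [MulAction G W]
    (E : Set (V₀ × V₁))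
    (hpres : ∀ (g : G) (x₀ : V₀) (x₁ : V₁), (x₀, x₁) ∈ E → (g • x₀, g • x₁) ∈ E)
    (hfree₀ : ∀ (g : G) (x : V₀), g • x = x → g = 1)
    (hfree₁ : ∀ (g : G) (x : V₁), g • x = x → g = 1)
    (hfreeW : ∀ (g : G) (y : W), g • y = y → g = 1)
    (wd wu : ℕ) (hreg₀ : LeftRegular E wd) (hreg₁ : RightRegular E wu)
    (cd εd : ℝ) (hcd : 0 < cd) (hεd : 0 < εd)
    (hlossless : ∀ S : Set V₀, (Nat.card S : ℝ) < cd * Nat.card V₀ →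
      (1 - εd) * (wd : ℝ) * (Nat.card S : ℝ) ≤ (Nat.card (Nbhd E S) : ℝ)) :
    LeftRegular {p : Quotient (MulAction.orbitRel G (V₀ × W)) ×
                     Quotient (MulAction.orbitRel G (V₁ × W)) |
        ∃ (x₀ : V₀) (x₁ : V₁) (y : W), (x₀, x₁) ∈ E ∧
          p = (Quotient.mk (MulAction.orbitRel G (V₀ × W)) (x₀, y),
               Quotient.mk (MulAction.orbitRel G (V₁ × W)) (x₁, y))} wd ∧
    RightRegular {p : Quotient (MulAction.orbitRel G (V₀ × W)) ×
                      Quotient (MulAction.orbitRel G (V₁ × W)) |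
        ∃ (x₀ : V₀) (x₁ : V₁) (y : W), (x₀, x₁) ∈ E ∧
          p = (Quotient.mk (MulAction.orbitRel G (V₀ × W)) (x₀, y),
               Quotient.mk (MulAction.orbitRel G (V₁ × W)) (x₁, y))} wu ∧
    ∀ S : Set (Quotient (MulAction.orbitRel G (V₀ × W))),
      (Nat.card S : ℝ) < cd * Nat.card V₀ →
      (1 - εd) * (wd : ℝ) * (Nat.card S : ℝ) ≤
        (Nat.card (Nbhd {p : Quotient (MulAction.orbitRel G (V₀ × W)) ×
                             Quotient (MulAction.orbitRel G (V₁ × W)) |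
            ∃ (x₀ : V₀) (x₁ : V₁) (y : W), (x₀, x₁) ∈ E ∧
              p = (Quotient.mk (MulAction.orbitRel G (V₀ × W)) (x₀, y),
                   Quotient.mk (MulAction.orbitRel G (V₁ × W)) (x₁, y))} S) : ℝ) := by
  exact bp_abstract E _ (bpMap G V₀ W) (bpMap G V₁ W) (bpMap_bij G V₀ W hfreeW)
    (bpMap_bij G V₁ W hfreeW) (bp_edge E hpres hfreeW) wd wu hreg₀ hreg₁ _ εd hlossless
end
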